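/- arXiv:2311.03013 — 2 statements merged into one kernel-verified Lean document; each statement's English description precedes it below -/
import Mathlib

section
/- Let μ be a locally finite signed Borel measure on [0,∞) whose Laplace–Stieltjes transform 𝓛{dS;s} = ∫_{[0,∞)} e^{−sx} dμ(x) converges absolutely for every complex s with Re s > 1, and let S(x) = μ([0,x]) be log-linearly slowly decreasing. Set U(s) = Re 𝓛{dS;s}. Assume U has L¹_loc-boundary behavior on 1 + i(ℝ∖{0}), and assume there exists λ > 0 such that sup_{1<σ<2} ∫_{−λ}^{λ} |U(σ+it)| dt < ∞. Then the limit a = lim_{σ→1⁺} (σ−1) U(σ) exists and S(x) ∼ a e^x as x → ∞, i.e. lim_{x→∞} e^{−x} S(x) = a. -/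
open MeasureTheory Filter Set

/-- `S` is log-linearly slowly decreasing. -/
def LogLinSlowlyDecreasing (S : ℝ → ℝ) : Prop :=
  ∀ ε : ℝ, 0 < ε → ∃ h : ℝ, 0 < h ∧ ∃ x₀ : ℝ, 0 < x₀ ∧ ∀ x y : ℝ,
    x₀ ≤ x → x ≤ y → y ≤ x + h → (S y - S x) / Real.exp x ≥ -ε

/-- `U` (defined on `Re s > 1`) has `L¹_loc`-boundary behavior on `1 + i(ℝ∖{0})`. -/
def L1locBoundaryBehavior (U : ℂ → ℝ) : Prop :=
  ∃ f : ℝ → ℝ, ∀ a b : ℝ, a ≤ b → (0 : ℝ) ∉ Icc a b →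
    IntegrableOn f (Icc a b) ∧
    Tendsto (fun σ : ℝ => ∫ t in a..b, |U (σ + t * Complex.I) - f t|)
      (nhdsWithin 1 (Ioi 1)) (nhds 0)

/-- The Laplace–Stieltjes transform `∫_{[0,∞)} e^{-sx} dμ(x)` of the locally finite
signed measure `μ = μp - μm` on `[0,∞)`. -/
noncomputable def laplaceStieltjes (μp μm : Measure ℝ) (s : ℂ) : ℂ :=
  (∫ x : ℝ, Complex.exp (-s * x) ∂μp) - ∫ x : ℝ, Complex.exp (-s * x) ∂μm


lemma wi_measure_Icc (ν : Measure ℝ) (h0 : ν (Iio 0) = 0) (v : ℝ) :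
    ν (Iic v) = ν (Icc 0 v) := by
  apply le_antisymm
  · calc ν (Iic v) ≤ ν (Iio 0 ∪ Icc 0 v) := by
          apply measure_mono
          intro x hx
          by_cases h : x < 0
          · exact Or.inl h
          · exact Or.inr ⟨not_lt.1 h, hx⟩
      _ ≤ ν (Iio 0) + ν (Icc 0 v) := measure_union_le _ _
      _ = ν (Icc 0 v) := by rw [h0, zero_add]
  · exact measure_mono (fun x hx => hx.2)

lemma wi_parts (ν : Measure ℝ) [IsLocallyFiniteMeasure ν] (h0 : ν (Iio 0) = 0)
    (s : ℂ) (hs : 1 < s.re) (hSint : Integrable (fun x : ℝ => Complex.exp (-s * x)) ν) :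
    Integrable (fun v : ℝ => ((ν (Icc 0 v)).toReal : ℂ) * (s * Complex.exp (-s * v))) ∧
    ∫ x : ℝ, Complex.exp (-s * x) ∂ν
      = ∫ v : ℝ, ((ν (Icc 0 v)).toReal : ℂ) * (s * Complex.exp (-s * v)) := by
  have hs0 : s ≠ 0 := by
    rintro rfl; simp at hs; linarith
  have hre : (-s).re < 0 := by simp; linarith
  let A : Set (ℝ × ℝ) := {p | p.1 ≤ p.2}
  have hA : MeasurableSet A := measurableSet_le measurable_fst measurable_snd
  let k : ℝ × ℝ → ℂ := A.indicator (fun p => s * Complex.exp (-s * p.2))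
  have hk1 : ∀ u : ℝ, (fun v : ℝ => k (u, v)) =
      (Ici u).indicator (fun v : ℝ => s * Complex.exp (-s * v)) := by
    intro u; ext v
    simp only [k, A, indicator, mem_ofPred_eq, mem_Ici]
  have hk2 : ∀ v : ℝ, (fun u : ℝ => k (u, v)) =
      (Iic v).indicator (fun _ : ℝ => s * Complex.exp (-s * v)) := by
    intro v; ext u
    simp only [k, A, indicator, mem_ofPred_eq, mem_Iic]
  have hio : ∀ u : ℝ, IntegrableOn (fun v : ℝ => s * Complex.exp (-s * v)) (Ici u) := by
    intro u
    rw [integrableOn_Ici_iff_integrableOn_Ioi]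
    exact (integrableOn_exp_mul_complex_Ioi hre u).const_mul s
  have hkm : AEStronglyMeasurable k (ν.prod volume) := by
    apply StronglyMeasurable.aestronglyMeasurable
    apply StronglyMeasurable.indicator _ hA
    apply Continuous.stronglyMeasurable
    fun_prop
  have hkint : Integrable k (ν.prod volume) := by
    rw [integrable_prod_iff hkm]
    constructor
    · refine Eventually.of_forall fun u => ?_
      rw [hk1 u, integrable_indicator_iff measurableSet_Ici]
      exact hio u
    · have : (fun u : ℝ => ∫ v : ℝ, ‖k (u, v)‖) =
          fun u : ℝ => (‖s‖ / s.re) * ‖Complex.exp (-s * u)‖ := by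
        ext u
        have h1 : (fun v : ℝ => ‖k (u, v)‖) =
            (Ici u).indicator (fun v : ℝ => ‖s‖ * Real.exp ((-s.re) * v)) := by
          ext v
          have := congrFun (hk1 u) v
          rw [this, norm_indicator_eq_indicator_norm]
          congr 1
          ext w
          rw [norm_mul, Complex.norm_exp]
          simp
        rw [h1, integral_indicator measurableSet_Ici, integral_Ici_eq_integral_Ioi,
          integral_const_mul, integral_exp_mul_Ioi (by linarith), Complex.norm_exp]
        simp
        have : s.re ≠ 0 := by linarith
        field_simp
      rw [this]
      exact hSint.norm.const_mul _
  have hin2 : ∀ v : ℝ, ∫ u : ℝ, k (u, v) ∂ν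
      = ((ν (Icc 0 v)).toReal : ℂ) * (s * Complex.exp (-s * v)) := by
    intro v
    rw [hk2 v, integral_indicator measurableSet_Iic, setIntegral_const, Measure.real,
      wi_measure_Icc ν h0]
    simp
  refine ⟨?_, ?_⟩
  · have := hkint.integral_prod_right
    simpa only [hin2] using this
  · have h := integral_integral_swap (f := fun u v => k (u, v)) hkint
    simp only [hin2] at h
    rw [← h]
    congr 1
    ext u
    rw [hk1 u, integral_indicator measurableSet_Ici, integral_Ici_eq_integral_Ioi,
      integral_const_mul, integral_exp_mul_complex_Ioi hre]
    field_simp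

lemma wi_parts_real (ν : Measure ℝ) [IsLocallyFiniteMeasure ν] (h0 : ν (Iio 0) = 0)
    (hSint : ∀ s : ℂ, 1 < s.re → Integrable (fun x : ℝ => Complex.exp (-s * x)) ν)
    (σ : ℝ) (hσ : 1 < σ) :
    Integrable (fun v : ℝ => (ν (Icc 0 v)).toReal * Real.exp (-σ * v)) ∧
    ∀ t : ℝ, (∫ x : ℝ, Complex.exp (-(σ + t * Complex.I) * x) ∂ν).re
      = ∫ v : ℝ, (ν (Icc 0 v)).toReal * Real.exp (-σ * v) *
          (σ * Real.cos (t * v) + t * Real.sin (t * v)) := by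
  have key := fun t : ℝ => wi_parts ν h0 (σ + t * Complex.I) (by simpa using hσ)
    (hSint _ (by simpa using hσ))
  have hre : ∀ t v : ℝ, (((ν (Icc 0 v)).toReal : ℂ) *
      ((σ + t * Complex.I) * Complex.exp (-(σ + t * Complex.I) * v))).re
      = (ν (Icc 0 v)).toReal * Real.exp (-σ * v) *
          (σ * Real.cos (t * v) + t * Real.sin (t * v)) := by
    intro t v
    rw [Complex.re_ofReal_mul, Complex.mul_re, Complex.exp_re, Complex.exp_im]
    simp
    ring
  constructor
  · have h := (key 0).1.re
    have h2 : Integrable (fun v : ℝ => (ν (Icc 0 v)).toReal * Real.exp (-σ * v) * σ) := by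
      refine h.congr (Eventually.of_forall fun v => ?_)
      have := hre 0 v
      simp only [RCLike.re_to_complex]
      rw [this]
      simp
    have h3 := h2.mul_const σ⁻¹
    refine h3.congr (Eventually.of_forall fun v => ?_)
    have : σ ≠ 0 := by linarith
    simp only
    field_simp
  · intro t
    rw [(key t).2]
    have := integral_re (key t).1
    simp only [RCLike.re_to_complex] at this
    rw [← this]
    congr 1
    ext v
    exact hre t v


/-- Band-limited kernel data. -/
structure WIKer (ψ : ℝ → ℝ) (b K : ℝ) (P R : ℝ → ℝ) : Prop where
  hb : 0 < b
  cont : Continuous ψ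
  hP : ∀ w, P w = ∫ t in (0:ℝ)..b, ψ t * Real.cos (t * w)
  hR : ∀ w, R w = ∫ t in (0:ℝ)..b, ψ t * (-(t * Real.sin (t * w)))
  bP : ∀ w, |P w| ≤ K / (1 + w ^ 2)
  bR : ∀ w, |R w| ≤ K / (1 + w ^ 2)

lemma wi_deriv_cos_integral (ψ : ℝ → ℝ) (hψ : Continuous ψ) (b w : ℝ) :
    HasDerivAt (fun w => ∫ t in (0:ℝ)..b, ψ t * Real.cos (t * w))
      (∫ t in (0:ℝ)..b, ψ t * (-(t * Real.sin (t * w)))) w := by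
  have h := intervalIntegral.hasDerivAt_integral_of_dominated_loc_of_deriv_le
    (μ := volume) (a := 0) (b := b) (bound := fun t => |ψ t| * |t|)
    (F := fun w t => ψ t * Real.cos (t * w))
    (F' := fun w t => ψ t * (-(t * Real.sin (t * w)))) (x₀ := w) (s := univ) univ_mem
    (Eventually.of_forall fun x => Continuous.aestronglyMeasurable (by fun_prop))
    (Continuous.intervalIntegrable (by fun_prop) _ _)
    (Continuous.aestronglyMeasurable (by fun_prop))
    (Eventually.of_forall fun t _ x _ => by
      rw [norm_mul, norm_neg, norm_mul, Real.norm_eq_abs, Real.norm_eq_abs, Real.norm_eq_abs]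
      have := Real.abs_sin_le_one (t * x)
      have h1 : |t| * |Real.sin (t * x)| ≤ |t| :=
        mul_le_of_le_one_right (abs_nonneg _) this
      exact mul_le_mul_of_nonneg_left h1 (abs_nonneg _))
    (Continuous.intervalIntegrable (by fun_prop) _ _)
    (Eventually.of_forall fun t _ x _ => by
      have h1 : HasDerivAt (fun x : ℝ => t * x) t x := by
        simpa using (hasDerivAt_id x).const_mul t
      have h2 := (h1.cos).const_mul (ψ t)
      exact h2.congr_deriv (by ring))
  exact h.2

lemma WIKer.deriv {ψ b K P R} (h : WIKer ψ b K P R) (w : ℝ) : HasDerivAt P (R w) w := by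
  have := wi_deriv_cos_integral ψ h.cont b w
  rw [← h.hR] at this
  have e : P = (fun w => ∫ t in (0:ℝ)..b, ψ t * Real.cos (t * w)) := funext h.hP
  rw [e]; exact this

lemma WIKer.contP {ψ b K P R} (h : WIKer ψ b K P R) : Continuous P :=
  continuous_iff_continuousAt.2 fun w => (h.deriv w).continuousAt

lemma WIKer.contR {ψ b K P R} (h : WIKer ψ b K P R) : Continuous R := by
  rw [show R = _ from funext h.hR]
  have hc := h.cont
  apply intervalIntegral.continuous_parametric_intervalIntegral_of_continuous
    (f := fun w t => ψ t * (-(t * Real.sin (t * w)))) (s := fun _ => b)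
  · have : Continuous (fun p : ℝ × ℝ => ψ p.2 * (-(p.2 * Real.sin (p.2 * p.1)))) := by fun_prop
    exact this
  · fun_prop

lemma WIKer.scale {ψ b K P R} (h : WIKer ψ b K P R) (δ : ℝ) (hδ : 0 < δ) :
    ∃ K', WIKer (fun t => ψ (t / δ)) (b * δ) K' (fun w => δ * P (δ * w))
      (fun w => δ ^ 2 * R (δ * w)) := by
  have hc := h.cont
  have hK : 0 ≤ K := by
    have := (abs_nonneg _).trans (h.bP 0)
    simpa using this
  have hden : ∀ w : ℝ, K / (1 + (δ * w) ^ 2) ≤ K * (1 + 1 / δ ^ 2) / (1 + w ^ 2) := by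
    intro w
    rw [div_le_div_iff₀ (by positivity) (by positivity), mul_assoc]
    apply mul_le_mul_of_nonneg_left _ hK
    have : (1 + 1 / δ ^ 2) * (1 + (δ * w) ^ 2) = 1 + w ^ 2 + (1 / δ ^ 2 + (δ * w) ^ 2) := by
      field_simp
      ring
    rw [this]
    have : 0 ≤ 1 / δ ^ 2 + (δ * w) ^ 2 := by positivity
    linarith
  refine ⟨(δ + δ ^ 2) * (K * (1 + 1 / δ ^ 2)), mul_pos h.hb hδ, by fun_prop, ?_, ?_, ?_, ?_⟩
  · intro w
    have := intervalIntegral.integral_comp_div (a := 0) (b := b * δ)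
      (fun t => ψ t * Real.cos (t * (δ * w))) hδ.ne'
    rw [h.hP]
    rw [zero_div, mul_div_cancel_right₀ _ hδ.ne', smul_eq_mul] at this
    rw [← this]
    apply intervalIntegral.integral_congr
    intro t _
    simp only
    rw [show t / δ * (δ * w) = t * w by field_simp]
  · intro w
    have := intervalIntegral.integral_comp_div (a := 0) (b := b * δ)
      (fun t => ψ t * (-(t * Real.sin (t * (δ * w))))) hδ.ne'
    rw [h.hR]
    rw [zero_div, mul_div_cancel_right₀ _ hδ.ne', smul_eq_mul] at this
    rw [pow_two, mul_assoc, ← this, ← intervalIntegral.integral_const_mul]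
    apply intervalIntegral.integral_congr
    intro t _
    simp only
    rw [show t / δ * (δ * w) = t * w by field_simp]
    field_simp
  · intro w
    rw [abs_mul, abs_of_pos hδ, mul_div_assoc]
    have := (h.bP (δ * w)).trans (hden w)
    apply mul_le_mul _ this (abs_nonneg _) (by positivity)
    nlinarith
  · intro w
    rw [abs_mul, abs_of_pos (by positivity : 0 < δ ^ 2), mul_div_assoc]
    have := (h.bR (δ * w)).trans (hden w)
    apply mul_le_mul _ this (abs_nonneg _) (by positivity)
    nlinarith

lemma wi_fejer (w : ℝ) (hw : w ≠ 0) :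
    ∫ t in (0:ℝ)..2, (1 - t / 2) * Real.cos (t * w) = (1 - Real.cos (2 * w)) / (2 * w ^ 2) := by
  have hd : ∀ t ∈ uIcc (0:ℝ) 2, HasDerivAt
      (fun t => (1 - t / 2) * (Real.sin (t * w) / w) - Real.cos (t * w) / (2 * w ^ 2))
      ((1 - t / 2) * Real.cos (t * w)) t := by
    intro t _
    have h1 : HasDerivAt (fun t : ℝ => t * w) w t := by
      simpa using (hasDerivAt_id t).mul_const w
    have h0 : HasDerivAt (fun t : ℝ => 1 - t / 2) (-(1 / 2)) t :=
      ((hasDerivAt_id t).div_const 2).const_sub 1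
    have := (h0.mul (h1.sin.div_const w)).sub (h1.cos.div_const (2 * w ^ 2))
    exact this.congr_deriv (by field_simp; ring)
  rw [intervalIntegral.integral_eq_sub_of_hasDerivAt hd
    (Continuous.intervalIntegrable (by fun_prop) _ _)]
  simp
  field_simp
  ring

lemma wi_fejer_deriv (w : ℝ) (hw : w ≠ 0) :
    ∫ t in (0:ℝ)..2, (1 - t / 2) * (-(t * Real.sin (t * w)))
      = Real.sin (2 * w) / w ^ 2 - (1 - Real.cos (2 * w)) / w ^ 3 := by
  have h1 := wi_deriv_cos_integral (fun t => 1 - t / 2) (by fun_prop) 2 w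
  have h2 : HasDerivAt (fun w : ℝ => (1 - Real.cos (2 * w)) / (2 * w ^ 2))
      (Real.sin (2 * w) / w ^ 2 - (1 - Real.cos (2 * w)) / w ^ 3) w := by
    have ha : HasDerivAt (fun w : ℝ => 2 * w) 2 w := by
      simpa using (hasDerivAt_id w).const_mul 2
    have hb : HasDerivAt (fun w : ℝ => 2 * w ^ 2) (2 * (2 * w)) w := by
      simpa using (hasDerivAt_pow 2 w).const_mul 2
    have := (ha.cos.const_sub 1).div hb (by positivity)
    exact this.congr_deriv (by field_simp)
  apply h1.unique
  refine h2.congr_of_eventuallyEq ?_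
  filter_upwards [isOpen_ne.mem_nhds hw] with y hy
  exact wi_fejer y hy

lemma wi_fejer_bound (w : ℝ) :
    |∫ t in (0:ℝ)..2, (1 - t / 2) * Real.cos (t * w)| ≤ 8 / (1 + w ^ 2) ∧
    |∫ t in (0:ℝ)..2, (1 - t / 2) * (-(t * Real.sin (t * w)))| ≤ 8 / (1 + w ^ 2) := by
  by_cases h1 : w ^ 2 ≤ 1
  · have h4 : (4:ℝ) ≤ 8 / (1 + w ^ 2) := by
      rw [le_div_iff₀ (by positivity)]; linarith
    constructor
    · have := intervalIntegral.norm_integral_le_of_norm_le_const (a := (0:ℝ)) (b := 2) (C := 2)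
        (f := fun t => (1 - t / 2) * Real.cos (t * w)) (by
          intro t ht
          rw [uIoc_of_le (by norm_num)] at ht
          rw [norm_mul, Real.norm_eq_abs, Real.norm_eq_abs]
          have ha : |1 - t / 2| ≤ 1 := by rw [abs_le]; constructor <;> linarith [ht.1, ht.2]
          have hb := Real.abs_cos_le_one (t * w)
          nlinarith [abs_nonneg (1 - t / 2), abs_nonneg (Real.cos (t * w))])
      rw [Real.norm_eq_abs] at this
      norm_num at this
      linarith
    · have := intervalIntegral.norm_integral_le_of_norm_le_const (a := (0:ℝ)) (b := 2) (C := 2)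
        (f := fun t => (1 - t / 2) * (-(t * Real.sin (t * w)))) (by
          intro t ht
          rw [uIoc_of_le (by norm_num)] at ht
          rw [norm_mul, norm_neg, norm_mul, Real.norm_eq_abs, Real.norm_eq_abs, Real.norm_eq_abs]
          have ha : |1 - t / 2| ≤ 1 := by rw [abs_le]; constructor <;> linarith [ht.1, ht.2]
          have ht2 : |t| ≤ 2 := by rw [abs_le]; constructor <;> linarith [ht.1, ht.2]
          have hb := Real.abs_sin_le_one (t * w)
          have hc : |t| * |Real.sin (t * w)| ≤ 2 * 1 :=
            mul_le_mul ht2 hb (abs_nonneg _) (by norm_num)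
          calc _ ≤ 1 * (2 * 1 : ℝ) := mul_le_mul ha hc (by positivity) (by norm_num)
            _ = 2 := by norm_num)
      rw [Real.norm_eq_abs] at this
      norm_num at this
      simp only [mul_neg, intervalIntegral.integral_neg, abs_neg]
      linarith
  · push Not at h1
    have hw : w ≠ 0 := by rintro rfl; norm_num at h1
    have h3 : 3 / w ^ 2 ≤ 8 / (1 + w ^ 2) := by
      rw [div_le_div_iff₀ (by positivity) (by positivity)]; nlinarith
    have hc1 := Real.abs_cos_le_one (2 * w)
    have hs1 := Real.abs_sin_le_one (2 * w)
    have hc2 : |1 - Real.cos (2 * w)| ≤ 2 := by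
      rw [abs_le] at *; constructor <;> linarith [hc1.1, hc1.2]
    constructor
    · rw [wi_fejer w hw, abs_div, abs_of_pos (by positivity : 0 < 2 * w ^ 2)]
      refine le_trans ?_ h3
      rw [div_le_div_iff₀ (by positivity) (by positivity)]
      nlinarith
    · rw [wi_fejer_deriv w hw]
      refine le_trans ?_ h3
      have hwa : 1 ≤ |w| := by
        by_contra h
        push Not at h
        have := sq_abs w
        nlinarith [abs_nonneg w]
      have e1 : |Real.sin (2 * w) / w ^ 2| ≤ 1 / w ^ 2 := by
        rw [abs_div, abs_of_pos (by positivity : 0 < w ^ 2)]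
        gcongr
      have e2 : |(1 - Real.cos (2 * w)) / w ^ 3| ≤ 2 / w ^ 2 := by
        rw [abs_div, abs_pow]
        rw [show w ^ 2 = |w| ^ 2 from (sq_abs w).symm]
        gcongr
        · norm_num
      calc _ ≤ |Real.sin (2 * w) / w ^ 2| + |(1 - Real.cos (2 * w)) / w ^ 3| := abs_sub _ _
        _ ≤ 1 / w ^ 2 + 2 / w ^ 2 := add_le_add e1 e2
        _ = 3 / w ^ 2 := by ring

lemma wi_fejer_lower (y M : ℝ) (h : |y| ≤ M) :
    Real.sin y ^ 2 ≤ (∫ t in (0:ℝ)..2, (1 - t / 2) * Real.cos (t * y)) * M ^ 2 := by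
  by_cases hy : y = 0
  · subst hy
    simp
    apply mul_nonneg _ (sq_nonneg _)
    norm_num
  · rw [wi_fejer y hy]
    have : 1 - Real.cos (2 * y) = 2 * Real.sin y ^ 2 := by
      rw [Real.cos_two_mul]; nlinarith [Real.sin_sq_add_cos_sq y]
    rw [this, mul_div_mul_left _ _ two_ne_zero, div_mul_eq_mul_div, le_div_iff₀ (by positivity)]
    have : y ^ 2 ≤ M ^ 2 := by rw [← sq_abs y]; gcongr
    exact mul_le_mul_of_nonneg_left this (sq_nonneg _)

lemma wi_exists_kernel : ∃ (ψ : ℝ → ℝ) (K C : ℝ) (P R : ℝ → ℝ), WIKer ψ 2 K P R ∧ 0 < ψ 0 ∧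
    (∀ w, 0 < P w) ∧ (∀ w, |R w| ≤ C * P w) ∧ 0 < C := by
  set c := Real.pi / 4 with hc
  have hc0 : 0 < c := by positivity
  have hc1 : c < 1 := by have := Real.pi_lt_four; rw [hc]; linarith
  let F : ℝ → ℝ := fun w => ∫ t in (0:ℝ)..2, (1 - t / 2) * Real.cos (t * w)
  let F' : ℝ → ℝ := fun w => ∫ t in (0:ℝ)..2, (1 - t / 2) * (-(t * Real.sin (t * w)))
  have hden : ∀ w d : ℝ, |d| < 1 → 8 / (1 + (w + d) ^ 2) ≤ 24 / (1 + w ^ 2) := by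
    intro w d hd
    rw [div_le_div_iff₀ (by positivity) (by positivity)]
    have : d ^ 2 < 1 := by rw [← sq_abs]; nlinarith [abs_nonneg d]
    nlinarith [sq_nonneg (w + 2 * d), sq_nonneg (w + d), sq_nonneg d]
  have hca : |c| < 1 := by rw [abs_of_pos hc0]; exact hc1
  have hca' : |-c| < 1 := by rw [abs_neg]; exact hca
  have hbR : ∀ w, |F' (w + c) + F' (w + -c)| ≤ 48 / (1 + w ^ 2) := by
    intro w
    have h1 := ((wi_fejer_bound (w + c)).2).trans (hden w c hca)
    have h2 := ((wi_fejer_bound (w + -c)).2).trans (hden w (-c) hca')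
    refine (abs_add_le _ _).trans ((add_le_add h1 h2).trans (le_of_eq ?_))
    ring
  have hlow : ∀ w, 1 / (2 * (1 + w ^ 2)) ≤ F (w + c) + F (w + -c) := by
    intro w
    have h1 := wi_fejer_lower (w + c) (|w| + 1) ((abs_add_le _ _).trans (by linarith))
    have h2 := wi_fejer_lower (w + -c) (|w| + 1) ((abs_add_le _ _).trans (by linarith))
    have h3 : Real.sin (w + -c) ^ 2 = Real.cos (w + c) ^ 2 := by
      have : w + -c = (w + c) - Real.pi / 2 := by rw [hc]; ring
      rw [this, Real.sin_sub_pi_div_two]; ring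
    have h4 := Real.sin_sq_add_cos_sq (w + c)
    have h5 : 1 ≤ (F (w + c) + F (w + -c)) * (|w| + 1) ^ 2 := by
      rw [add_mul]
      change _ ≤ F (w + c) * _ at h1
      change _ ≤ F (w + -c) * _ at h2
      linarith
    have h6 : (|w| + 1) ^ 2 ≤ 2 * (1 + w ^ 2) := by
      nlinarith [sq_abs w, sq_nonneg (|w| - 1)]
    have h7 : 0 < F (w + c) + F (w + -c) := by
      by_contra h
      push Not at h
      have : 0 < (|w| + 1) ^ 2 := by positivity
      nlinarith
    rw [div_le_iff₀ (by positivity)]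
    nlinarith
  refine ⟨fun t => (1 - t / 2) * (2 * Real.cos (t * c)), 48, 96, fun w => F (w + c) + F (w + -c),
    fun w => F' (w + c) + F' (w + -c), ⟨by norm_num, by fun_prop, ?_, ?_, ?_, hbR⟩, by norm_num,
    ?_, ?_, by norm_num⟩
  · intro w
    simp only [F]
    rw [← intervalIntegral.integral_add (Continuous.intervalIntegrable (by fun_prop) _ _)
      (Continuous.intervalIntegrable (by fun_prop) _ _)]
    apply intervalIntegral.integral_congr
    intro t _
    simp only
    rw [mul_add, mul_add, mul_neg, ← sub_eq_add_neg, Real.cos_add, Real.cos_sub]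
    ring
  · intro w
    simp only [F']
    rw [← intervalIntegral.integral_add (Continuous.intervalIntegrable (by fun_prop) _ _)
      (Continuous.intervalIntegrable (by fun_prop) _ _)]
    apply intervalIntegral.integral_congr
    intro t _
    simp only
    rw [mul_add t, mul_add t, mul_neg t, ← sub_eq_add_neg, Real.sin_add, Real.sin_sub]
    ring
  · intro w
    have h1 := ((wi_fejer_bound (w + c)).1).trans (hden w c hca)
    have h2 := ((wi_fejer_bound (w + -c)).1).trans (hden w (-c) hca')
    refine (abs_add_le _ _).trans ((add_le_add h1 h2).trans (le_of_eq ?_))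
    ring
  · intro w
    exact lt_of_lt_of_le (by positivity) (hlow w)
  · intro w
    refine (hbR w).trans ?_
    have := mul_le_mul_of_nonneg_left (hlow w) (by norm_num : (0:ℝ) ≤ 96)
    refine le_trans (le_of_eq ?_) this
    field_simp
    norm_num


lemma wi_V_cont (S : ℝ → ℝ) (V : ℝ → ℝ → ℝ)
    (hSint : ∀ σ : ℝ, 1 < σ → Integrable (fun v => S v * Real.exp (-σ * v)))
    (hV : ∀ σ : ℝ, 1 < σ → ∀ t, V σ t = ∫ v, S v * Real.exp (-σ * v) *
      (σ * Real.cos (t * v) + t * Real.sin (t * v))) (σ : ℝ) (hσ : 1 < σ) :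
    Continuous (V σ) := by
  have hi := hSint σ hσ
  have hbc : ∀ t : ℝ, Integrable (fun v => S v * Real.exp (-σ * v) * Real.cos (t * v)) := by
    intro t
    refine hi.mul_bdd (c := 1) (Continuous.aestronglyMeasurable (by fun_prop)) ?_
    exact Eventually.of_forall fun v => Real.abs_cos_le_one _
  have hbs : ∀ t : ℝ, Integrable (fun v => S v * Real.exp (-σ * v) * Real.sin (t * v)) := by
    intro t
    refine hi.mul_bdd (c := 1) (Continuous.aestronglyMeasurable (by fun_prop)) ?_
    exact Eventually.of_forall fun v => Real.abs_sin_le_one _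
  have e : V σ = fun t => σ * (∫ v, S v * Real.exp (-σ * v) * Real.cos (t * v)) +
      t * (∫ v, S v * Real.exp (-σ * v) * Real.sin (t * v)) := by
    ext t
    rw [hV σ hσ t, ← integral_const_mul, ← integral_const_mul, ← integral_add]
    · congr 1; ext v; ring
    · exact (hbc t).const_mul _
    · exact (hbs t).const_mul _
  rw [e]
  have c1 : Continuous (fun t => ∫ v, S v * Real.exp (-σ * v) * Real.cos (t * v)) := by
    apply continuous_of_dominated (bound := fun v => ‖S v * Real.exp (-σ * v)‖)
    · intro t; exact (hbc t).aestronglyMeasurable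
    · intro t
      refine Eventually.of_forall fun v => ?_
      rw [norm_mul]
      exact mul_le_of_le_one_right (norm_nonneg _) (Real.abs_cos_le_one _)
    · exact hi.norm
    · exact Eventually.of_forall fun v => by fun_prop
  have c2 : Continuous (fun t => ∫ v, S v * Real.exp (-σ * v) * Real.sin (t * v)) := by
    apply continuous_of_dominated (bound := fun v => ‖S v * Real.exp (-σ * v)‖)
    · intro t; exact (hbs t).aestronglyMeasurable
    · intro t
      refine Eventually.of_forall fun v => ?_
      rw [norm_mul]
      exact mul_le_of_le_one_right (norm_nonneg _) (Real.abs_sin_le_one _)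
    · exact hi.norm
    · exact Eventually.of_forall fun v => by fun_prop
  fun_prop

lemma wi_identity (S : ℝ → ℝ) (V : ℝ → ℝ → ℝ)
    (hSint : ∀ σ : ℝ, 1 < σ → Integrable (fun v => S v * Real.exp (-σ * v)))
    (hV : ∀ σ : ℝ, 1 < σ → ∀ t, V σ t = ∫ v, S v * Real.exp (-σ * v) *
      (σ * Real.cos (t * v) + t * Real.sin (t * v)))
    {ψ b K P R} (hk : WIKer ψ b K P R) (σ : ℝ) (hσ : 1 < σ) (x : ℝ) :
    ∫ t in (0:ℝ)..b, V σ t * (ψ t * Real.cos (x * t)) =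
      (1 / 2) * ∫ v, S v * Real.exp (-σ * v) *
        (σ * (P (x - v) + P (x + v)) + (R (x - v) - R (x + v))) := by
  have hi := hSint σ hσ
  have hc := hk.cont
  let q : ℝ → ℝ → ℝ := fun t v => ψ t * Real.cos (x * t) *
    (σ * Real.cos (t * v) + t * Real.sin (t * v))
  have hqc : Continuous (Function.uncurry q) := by
    have : Continuous (fun p : ℝ × ℝ => ψ p.1 * Real.cos (x * p.1) *
      (σ * Real.cos (p.1 * p.2) + p.1 * Real.sin (p.1 * p.2))) := by fun_prop
    exact this
  have hinner : ∀ v, ∫ t in (0:ℝ)..b, q t v =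
      (1 / 2) * (σ * (P (x - v) + P (x + v)) + (R (x - v) - R (x + v))) := by
    intro v
    rw [hk.hP, hk.hP, hk.hR, hk.hR]
    rw [← intervalIntegral.integral_add (Continuous.intervalIntegrable (by fun_prop) _ _)
      (Continuous.intervalIntegrable (by fun_prop) _ _),
      ← intervalIntegral.integral_sub (Continuous.intervalIntegrable (by fun_prop) _ _)
      (Continuous.intervalIntegrable (by fun_prop) _ _),
      ← intervalIntegral.integral_const_mul,
      ← intervalIntegral.integral_add (Continuous.intervalIntegrable (by fun_prop) _ _)
      (Continuous.intervalIntegrable (by fun_prop) _ _),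
      ← intervalIntegral.integral_const_mul]
    apply intervalIntegral.integral_congr
    intro t _
    simp only [q]
    rw [mul_sub t x v, mul_add t x v, Real.cos_add, Real.cos_sub, Real.sin_add, Real.sin_sub,
      mul_comm x t]
    ring
  have hqb : ∃ B, ∀ t ∈ Ioc 0 b, ∀ v, |q t v| ≤ B := by
    obtain ⟨B, hB⟩ := (isCompact_Icc (a := (0:ℝ)) (b := b)).exists_bound_of_continuousOn
      hc.continuousOn
    refine ⟨B * (σ + b), fun t ht v => ?_⟩
    simp only [q]
    have h1 := hB t ⟨ht.1.le, ht.2⟩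
    have hB0 : 0 ≤ B := (norm_nonneg _).trans h1
    rw [abs_mul, abs_mul]
    have h2 : |ψ t| * |Real.cos (x * t)| ≤ B :=
      (mul_le_of_le_one_right (abs_nonneg _) (Real.abs_cos_le_one _)).trans h1
    have h3 : |σ * Real.cos (t * v) + t * Real.sin (t * v)| ≤ σ + b := by
      refine (abs_add_le _ _).trans ?_
      rw [abs_mul, abs_mul]
      have e1 : |σ| * |Real.cos (t * v)| ≤ σ := by
        rw [abs_of_pos (by linarith : 0 < σ)]
        exact mul_le_of_le_one_right (by linarith) (Real.abs_cos_le_one _)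
      have e2 : |t| * |Real.sin (t * v)| ≤ b := by
        rw [abs_of_pos ht.1]
        exact (mul_le_of_le_one_right ht.1.le (Real.abs_sin_le_one _)).trans ht.2
      linarith
    exact mul_le_mul h2 h3 (abs_nonneg _) hB0
  obtain ⟨B, hB⟩ := hqb
  have hprod : Integrable (Function.uncurry fun t v => q t v * (S v * Real.exp (-σ * v)))
      ((volume.restrict (Ioc 0 b)).prod volume) := by
    have h1 : Integrable (fun p : ℝ × ℝ => (1:ℝ) * (S p.2 * Real.exp (-σ * p.2)))
        ((volume.restrict (Ioc 0 b)).prod volume) :=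
      Integrable.mul_prod (f := fun _ : ℝ => (1:ℝ)) (integrable_const _) hi
    have h2 := h1.bdd_mul (c := B) (f := Function.uncurry q) hqc.aestronglyMeasurable (by
      have : ∀ᵐ p : ℝ × ℝ ∂((volume.restrict (Ioc 0 b)).prod volume), p.1 ∈ Ioc 0 b := by
        have := Measure.ae_prod_mem_iff_ae_ae_mem (μ := volume.restrict (Ioc 0 b))
          (ν := (volume : Measure ℝ)) (s := {p : ℝ × ℝ | p.1 ∈ Ioc 0 b})
          (measurable_fst measurableSet_Ioc)
        refine this.2 ?_
        filter_upwards [ae_restrict_mem measurableSet_Ioc] with t ht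
        exact Eventually.of_forall fun _ => ht
      filter_upwards [this] with p hp
      exact hB p.1 hp p.2)
    refine h2.congr (Eventually.of_forall fun p => ?_)
    simp [Function.uncurry]
  have hsw := integral_integral_swap hprod
  rw [intervalIntegral.integral_of_le hk.hb.le]
  have e1 : ∀ t, V σ t * (ψ t * Real.cos (x * t)) =
      ∫ v, q t v * (S v * Real.exp (-σ * v)) := by
    intro t
    rw [hV σ hσ t, ← integral_mul_const]
    congr 1; ext v; simp only [q]; ring
  simp only [e1]
  rw [hsw, ← integral_const_mul]
  congr 1
  ext v
  rw [integral_mul_const, ← intervalIntegral.integral_of_le hk.hb.le, hinner]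
  ring


lemma wi_ii (f : ℝ → ℝ) (a b : ℝ) (hab : a ≤ b) (h : IntegrableOn f (Icc a b)) :
    IntervalIntegrable f volume a b := by
  rw [intervalIntegrable_iff_integrableOn_Icc_of_le hab]
  exact h

lemma wi_bdd (V : ℝ → ℝ → ℝ) (f : ℝ → ℝ) (lam M : ℝ) (hlam : 0 < lam)
    (hVc : ∀ σ : ℝ, 1 < σ → Continuous (V σ))
    (hf : ∀ a b : ℝ, 0 < a → a ≤ b → IntegrableOn f (Icc a b) ∧
      Tendsto (fun σ : ℝ => ∫ t in a..b, |V σ t - f t|) (nhdsWithin 1 (Ioi 1)) (nhds 0))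
    (hM : ∀ σ ∈ Ioo (1:ℝ) 2, ∫ t in (0:ℝ)..lam, |V σ t| ≤ M) (b : ℝ) (hb : 0 < b) :
    ∃ M', ∀ᶠ σ in nhdsWithin (1:ℝ) (Ioi 1), ∫ t in (0:ℝ)..b, |V σ t| ≤ M' := by
  set m := max b lam with hm
  have hlm : lam ≤ m := le_max_right _ _
  obtain ⟨h1, h2⟩ := hf lam m hlam hlm
  have hfi := wi_ii f lam m hlm h1
  refine ⟨M + (1 + ∫ t in lam..m, |f t|), ?_⟩
  have hev : ∀ᶠ σ in nhdsWithin (1:ℝ) (Ioi 1), σ ∈ Ioo (1:ℝ) 2 :=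
    Ioo_mem_nhdsGT (by norm_num)
  filter_upwards [hev, h2.eventually (gt_mem_nhds (zero_lt_one))] with σ hσ h3
  have hc := hVc σ hσ.1
  have hca : Continuous (fun t => |V σ t|) := hc.abs
  have e1 : ∫ t in (0:ℝ)..b, |V σ t| ≤ ∫ t in (0:ℝ)..m, |V σ t| := by
    apply intervalIntegral.integral_mono_interval le_rfl hb.le (le_max_left _ _)
    · exact Eventually.of_forall fun t => abs_nonneg _
    · exact hca.intervalIntegrable _ _
  have e2 : ∫ t in (0:ℝ)..m, |V σ t| = (∫ t in (0:ℝ)..lam, |V σ t|) + ∫ t in lam..m, |V σ t| :=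
    (intervalIntegral.integral_add_adjacent_intervals (hca.intervalIntegrable _ _)
      (hca.intervalIntegrable _ _)).symm
  have e3 : ∫ t in lam..m, |V σ t| ≤ (∫ t in lam..m, |V σ t - f t|) + ∫ t in lam..m, |f t| := by
    rw [← intervalIntegral.integral_add
      ((hc.intervalIntegrable _ _).sub hfi).abs hfi.abs]
    apply intervalIntegral.integral_mono_on hlm (hca.intervalIntegrable _ _)
      (((hc.intervalIntegrable _ _).sub hfi).abs.add hfi.abs)
    intro t _
    have := abs_add_le (V σ t - f t) (f t)
    simpa using this
  have := hM σ hσ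
  linarith

lemma wi_f_int (V : ℝ → ℝ → ℝ) (f : ℝ → ℝ) (lam M : ℝ) (hlam : 0 < lam)
    (hVc : ∀ σ : ℝ, 1 < σ → Continuous (V σ))
    (hf : ∀ a b : ℝ, 0 < a → a ≤ b → IntegrableOn f (Icc a b) ∧
      Tendsto (fun σ : ℝ => ∫ t in a..b, |V σ t - f t|) (nhdsWithin 1 (Ioi 1)) (nhds 0))
    (hM : ∀ σ ∈ Ioo (1:ℝ) 2, ∫ t in (0:ℝ)..lam, |V σ t| ≤ M) (b : ℝ) (hb : 0 < b) :
    IntervalIntegrable f volume 0 b := by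
  obtain ⟨M', hM'⟩ := wi_bdd V f lam M hlam hVc hf hM b hb
  rw [intervalIntegrable_iff_integrableOn_Ioc_of_le hb.le]
  have hpos : ∀ n : ℕ, 0 < b / (n + 1 : ℝ) := fun n => by positivity
  have hle : ∀ n : ℕ, b / (n + 1 : ℝ) ≤ b := fun n => by
    apply div_le_self hb.le
    have : (0:ℝ) ≤ n := Nat.cast_nonneg n
    linarith
  apply integrableOn_Ioc_of_intervalIntegral_norm_bounded_left (l := atTop)
    (a := fun n : ℕ => b / (n + 1 : ℝ)) (I := 1 + M')
  · intro n
    exact ((hf _ b (hpos n) (hle n)).1).mono_set Ioc_subset_Icc_self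
  · have := (tendsto_one_div_add_atTop_nhds_zero_nat (𝕜 := ℝ)).const_mul b
    simpa [div_eq_mul_inv] using this
  · refine Eventually.of_forall fun n => ?_
    obtain ⟨h1, h2⟩ := hf _ b (hpos n) (hle n)
    have hfi := wi_ii f _ b (hle n) h1
    have hev : ∀ᶠ σ in nhdsWithin (1:ℝ) (Ioi 1), σ ∈ Ioo (1:ℝ) 2 :=
      Ioo_mem_nhdsGT (by norm_num)
    obtain ⟨σ, hσ, h3, h4⟩ :=
      (hev.and ((h2.eventually (gt_mem_nhds (zero_lt_one))).and hM')).exists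
    have hc := hVc σ hσ.1
    have hca : Continuous (fun t => |V σ t|) := hc.abs
    have e1 : ∫ t in (b / (n + 1 : ℝ))..b, |V σ t| ≤ ∫ t in (0:ℝ)..b, |V σ t| := by
      apply intervalIntegral.integral_mono_interval (hpos n).le (hle n) le_rfl
      · exact Eventually.of_forall fun t => abs_nonneg _
      · exact hca.intervalIntegrable _ _
    have e3 : ∫ t in (b / (n + 1 : ℝ))..b, |f t| ≤
        (∫ t in (b / (n + 1 : ℝ))..b, |V σ t - f t|) + ∫ t in (b / (n + 1 : ℝ))..b, |V σ t| := by
      rw [← intervalIntegral.integral_add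
        ((hc.intervalIntegrable _ _).sub hfi).abs (hca.intervalIntegrable _ _)]
      apply intervalIntegral.integral_mono_on (hle n) hfi.abs
        (((hc.intervalIntegrable _ _).sub hfi).abs.add (hca.intervalIntegrable _ _))
      intro t _
      have := abs_add_le (f t - V σ t) (V σ t)
      rw [abs_sub_comm (f t)] at this
      simpa using this
    rw [← intervalIntegral.integral_of_le (hle n)]
    simp only [Real.norm_eq_abs]
    linarith

lemma wi_lim0 (V : ℝ → ℝ → ℝ) (f : ℝ → ℝ) (lam M : ℝ) (hlam : 0 < lam)
    (hVc : ∀ σ : ℝ, 1 < σ → Continuous (V σ))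
    (hf : ∀ a b : ℝ, 0 < a → a ≤ b → IntegrableOn f (Icc a b) ∧
      Tendsto (fun σ : ℝ => ∫ t in a..b, |V σ t - f t|) (nhdsWithin 1 (Ioi 1)) (nhds 0))
    (hM : ∀ σ ∈ Ioo (1:ℝ) 2, ∫ t in (0:ℝ)..lam, |V σ t| ≤ M) (b : ℝ) (hb : 0 < b)
    (g : ℝ → ℝ) (hg : Continuous g) (hg0 : g 0 = 0) :
    Tendsto (fun σ => ∫ t in (0:ℝ)..b, V σ t * g t) (nhdsWithin 1 (Ioi 1))
      (nhds (∫ t in (0:ℝ)..b, f t * g t)) := by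
  obtain ⟨M', hM'⟩ := wi_bdd V f lam M hlam hVc hf hM b hb
  have hfi := wi_f_int V f lam M hlam hVc hf hM b hb
  obtain ⟨G, hG⟩ := (isCompact_Icc (a := (0:ℝ)) (b := b)).exists_bound_of_continuousOn
      hg.continuousOn
  have hG0 : 0 ≤ G := (norm_nonneg _).trans (hG 0 ⟨le_rfl, hb.le⟩)
  set N := max M' 0 + ∫ t in (0:ℝ)..b, |f t| with hN
  have hfa : 0 ≤ ∫ t in (0:ℝ)..b, |f t| :=
    intervalIntegral.integral_nonneg hb.le fun _ _ => abs_nonneg _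
  have hN0 : 0 ≤ N := add_nonneg (le_max_right _ _) hfa
  rw [Metric.tendsto_nhds]
  intro ε hε
  -- choose η
  set ε1 := ε / (2 * (N + 1)) with hε1
  have hεpos : 0 < ε1 := by positivity
  obtain ⟨η0, hη0, hη0'⟩ := Metric.continuousAt_iff.1 hg.continuousAt ε1 hεpos
  set η := min (η0 / 2) b with hη
  have hηp : 0 < η := lt_min (by linarith) hb
  have hηb : η ≤ b := min_le_right _ _
  have hgs : ∀ t ∈ Icc 0 η, |g t| ≤ ε1 := by
    intro t ht
    have : dist t 0 < η0 := by
      rw [Real.dist_eq, sub_zero, abs_of_nonneg ht.1]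
      have := ht.2.trans (min_le_left _ _)
      linarith
    have := hη0' this
    rw [hg0, Real.dist_eq, sub_zero] at this
    exact this.le
  obtain ⟨h1, h2⟩ := hf η b hηp hηb
  have hev : ∀ᶠ σ in nhdsWithin (1:ℝ) (Ioi 1), σ ∈ Ioo (1:ℝ) 2 :=
    Ioo_mem_nhdsGT (by norm_num)
  have hsm : 0 < ε / (2 * (G + 1)) := by positivity
  filter_upwards [hev, hM', h2.eventually (gt_mem_nhds hsm)] with σ hσ hMσ h3
  have hc := hVc σ hσ.1
  have hVi : ∀ a c, IntervalIntegrable (V σ) volume a c := fun a c => hc.intervalIntegrable _ _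
  have hsub1 : uIcc 0 η ⊆ uIcc 0 b := by
    rw [uIcc_of_le hηp.le, uIcc_of_le hb.le]; exact Icc_subset_Icc le_rfl hηb
  have hsub2 : uIcc η b ⊆ uIcc 0 b := by
    rw [uIcc_of_le hηb, uIcc_of_le hb.le]; exact Icc_subset_Icc hηp.le le_rfl
  have hf1 : IntervalIntegrable f volume 0 η := hfi.mono_set hsub1
  have hf2 : IntervalIntegrable f volume η b := hfi.mono_set hsub2
  have hd1 := (hVi 0 η).sub hf1
  have hd2 := (hVi η b).sub hf2
  have hgc : ∀ a c, ContinuousOn g (uIcc a c) := fun a c => hg.continuousOn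
  rw [Real.dist_eq, ← intervalIntegral.integral_sub ((hVi 0 b).mul_continuousOn (hgc _ _))
    (hfi.mul_continuousOn (hgc _ _))]
  have hsplit : ∫ t in (0:ℝ)..b, (V σ t * g t - f t * g t) =
      (∫ t in (0:ℝ)..η, (V σ t - f t) * g t) + ∫ t in η..b, (V σ t - f t) * g t := by
    rw [intervalIntegral.integral_add_adjacent_intervals (hd1.mul_continuousOn (hgc _ _))
      (hd2.mul_continuousOn (hgc _ _))]
    congr 1; ext t; ring
  rw [hsplit]
  have b1 : |∫ t in (0:ℝ)..η, (V σ t - f t) * g t| ≤ ε1 * N := by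
    calc |∫ t in (0:ℝ)..η, (V σ t - f t) * g t|
        ≤ ∫ t in (0:ℝ)..η, |(V σ t - f t) * g t| :=
          intervalIntegral.abs_integral_le_integral_abs hηp.le
      _ ≤ ∫ t in (0:ℝ)..η, ε1 * (|V σ t| + |f t|) := by
          apply intervalIntegral.integral_mono_on hηp.le (hd1.mul_continuousOn (hgc _ _)).abs
            (((hVi _ _).abs.add hf1.abs).const_mul _)
          intro t ht
          rw [abs_mul, mul_comm]
          exact mul_le_mul (hgs t ht) (abs_sub _ _) (abs_nonneg _) hεpos.le
      _ = ε1 * ((∫ t in (0:ℝ)..η, |V σ t|) + ∫ t in (0:ℝ)..η, |f t|) := by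
          rw [intervalIntegral.integral_const_mul,
            intervalIntegral.integral_add (hVi _ _).abs hf1.abs]
      _ ≤ ε1 * N := by
          apply mul_le_mul_of_nonneg_left _ hεpos.le
          have k1 : ∫ t in (0:ℝ)..η, |V σ t| ≤ ∫ t in (0:ℝ)..b, |V σ t| :=
            intervalIntegral.integral_mono_interval le_rfl hηp.le hηb
              (Eventually.of_forall fun t => abs_nonneg _) (hVi _ _).abs
          have k2 : ∫ t in (0:ℝ)..η, |f t| ≤ ∫ t in (0:ℝ)..b, |f t| :=
            intervalIntegral.integral_mono_interval le_rfl hηp.le hηb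
              (Eventually.of_forall fun t => abs_nonneg _) hfi.abs
          have := le_max_left M' 0
          linarith
  have b2 : |∫ t in η..b, (V σ t - f t) * g t| ≤ G * ∫ t in η..b, |V σ t - f t| := by
    calc |∫ t in η..b, (V σ t - f t) * g t|
        ≤ ∫ t in η..b, |(V σ t - f t) * g t| :=
          intervalIntegral.abs_integral_le_integral_abs hηb
      _ ≤ ∫ t in η..b, G * |V σ t - f t| := by
          apply intervalIntegral.integral_mono_on hηb (hd2.mul_continuousOn (hgc _ _)).abs
            (hd2.abs.const_mul _)
          intro t ht
          rw [abs_mul, mul_comm]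
          exact mul_le_mul_of_nonneg_right (hG t ⟨hηp.le.trans ht.1, ht.2⟩) (abs_nonneg _)
      _ = G * ∫ t in η..b, |V σ t - f t| := intervalIntegral.integral_const_mul _ _
  have h3' : G * ∫ t in η..b, |V σ t - f t| ≤ G * (ε / (2 * (G + 1))) :=
    mul_le_mul_of_nonneg_left h3.le hG0
  have q1 : G * (ε / (2 * (G + 1))) < ε / 2 := by
    rw [mul_div_assoc', div_lt_div_iff₀ (by positivity) (by positivity)]
    nlinarith
  have q2 : ε1 * N < ε / 2 := by
    rw [hε1, div_mul_eq_mul_div, div_lt_div_iff₀ (by positivity) (by positivity)]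
    nlinarith
  have := abs_add_le (∫ t in (0:ℝ)..η, (V σ t - f t) * g t) (∫ t in η..b, (V σ t - f t) * g t)
  linarith

lemma wi_lim1 (V : ℝ → ℝ → ℝ) (f : ℝ → ℝ) (lam M : ℝ) (hlam : 0 < lam)
    (hVc : ∀ σ : ℝ, 1 < σ → Continuous (V σ))
    (hf : ∀ a b : ℝ, 0 < a → a ≤ b → IntegrableOn f (Icc a b) ∧
      Tendsto (fun σ : ℝ => ∫ t in a..b, |V σ t - f t|) (nhdsWithin 1 (Ioi 1)) (nhds 0))
    (hM : ∀ σ ∈ Ioo (1:ℝ) 2, ∫ t in (0:ℝ)..lam, |V σ t| ≤ M) (b : ℝ) (hb : 0 < b)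
    (g : ℝ → ℝ) (hg : Continuous g) :
    Tendsto (fun σ => (∫ t in (0:ℝ)..b, V σ t * g t) - g 0 * ∫ t in (0:ℝ)..1, V σ t)
      (nhdsWithin 1 (Ioi 1))
      (nhds ((∫ t in (0:ℝ)..b, f t * g t) - g 0 * ∫ t in (0:ℝ)..1, f t)) := by
  have hfi := fun b hb => wi_f_int V f lam M hlam hVc hf hM b hb
  have hf01 : IntervalIntegrable f volume 0 1 := hfi 1 one_pos
  have hfb : IntervalIntegrable f volume 0 b := hfi b hb
  have hf1b : IntervalIntegrable f volume 1 b := hf01.symm.trans hfb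
  have hev : ∀ᶠ σ in nhdsWithin (1:ℝ) (Ioi 1), σ ∈ Ioo (1:ℝ) 2 :=
    Ioo_mem_nhdsGT (by norm_num)
  have hgc : ∀ a c, ContinuousOn g (uIcc a c) := fun a c => hg.continuousOn
  have key : ∀ F : ℝ → ℝ, IntervalIntegrable F volume 0 1 → IntervalIntegrable F volume 0 b →
      (∫ t in (0:ℝ)..b, F t * g t) - g 0 * ∫ t in (0:ℝ)..1, F t =
      (∫ t in (0:ℝ)..b, F t * (g t - g 0)) + g 0 * ∫ t in (1:ℝ)..b, F t := by
    intro F h1 h2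
    have e1 : ∫ t in (0:ℝ)..b, F t * (g t - g 0) =
        (∫ t in (0:ℝ)..b, F t * g t) - g 0 * ∫ t in (0:ℝ)..b, F t := by
      rw [← intervalIntegral.integral_const_mul, ← intervalIntegral.integral_sub
        (h2.mul_continuousOn (hgc _ _)) (h2.const_mul _)]
      congr 1; ext t; ring
    rw [e1, ← intervalIntegral.integral_add_adjacent_intervals h1 (h1.symm.trans h2)]
    ring
  rw [key f hf01 hfb]
  have hlimb : Tendsto (fun σ => ∫ t in (1:ℝ)..b, V σ t) (nhdsWithin 1 (Ioi 1))
      (nhds (∫ t in (1:ℝ)..b, f t)) := by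
    have hz : Tendsto (fun σ => abs (∫ t in (1:ℝ)..b, abs (V σ t - f t))) (nhdsWithin 1 (Ioi 1))
        (nhds 0) := by
      rw [← abs_zero]
      apply Tendsto.abs
      rcases le_total 1 b with h | h
      · exact (hf 1 b one_pos h).2
      · have := ((hf b 1 hb h).2).neg
        simp only [neg_zero] at this
        refine this.congr fun σ => ?_
        rw [intervalIntegral.integral_symm b 1]
    rw [tendsto_iff_norm_sub_tendsto_zero]
    refine squeeze_zero' (Eventually.of_forall fun σ => norm_nonneg _) ?_ hz
    filter_upwards [hev] with σ hσ
    rw [← intervalIntegral.integral_sub ((hVc σ hσ.1).intervalIntegrable _ _) hf1b]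
    exact intervalIntegral.norm_integral_le_abs_integral_norm
  have hl0 := wi_lim0 V f lam M hlam hVc hf hM b hb (fun t => g t - g 0) (by fun_prop) (by simp)
  refine (hl0.add (hlimb.const_mul (g 0))).congr' ?_
  filter_upwards [hev] with σ hσ
  exact (key (V σ) ((hVc σ hσ.1).intervalIntegrable _ _)
    ((hVc σ hσ.1).intervalIntegrable _ _)).symm


lemma wi_slow (S : ℝ → ℝ) (hS0 : ∀ x < 0, S x = 0) (hloc : ∀ x0, ∃ B, ∀ x ≤ x0, |S x| ≤ B)
    (hslow : LogLinSlowlyDecreasing S) :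
    ∃ C, 0 ≤ C ∧ ∀ x y, x ≤ y → S x - C * Real.exp y ≤ S y := by
  obtain ⟨h, hh, x0, hx0, H⟩ := hslow 1 one_pos
  obtain ⟨B, hB⟩ := hloc x0
  have hB0 : 0 ≤ B := (abs_nonneg _).trans (hB x0 le_rfl)
  set r := Real.exp (-h) with hr
  have hr1 : r < 1 := by rw [hr, Real.exp_lt_one_iff]; linarith
  have hr0 : 0 < r := Real.exp_pos _
  set C := 1 / (1 - r) with hC
  have hC1 : C * (1 - r) = 1 := by
    rw [hC]; apply one_div_mul_cancel; linarith
  have hC0 : 1 ≤ C := by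
    rw [hC, le_div_iff₀ (by linarith)]; linarith
  have step : ∀ x y, x0 ≤ x → x ≤ y → y ≤ x + h → S x - Real.exp x ≤ S y := by
    intro x y h1 h2 h3
    have := H x y h1 h2 h3
    rw [ge_iff_le, le_div_iff₀ (Real.exp_pos _)] at this
    linarith
  have ind : ∀ n : ℕ, ∀ x y, x0 ≤ x → x ≤ y → y ≤ x + (n + 1 : ℝ) * h →
      S x - C * Real.exp y ≤ S y := by
    intro n
    induction n with
    | zero =>
      intro x y h1 h2 h3
      have h4 := step x y h1 h2 (by simpa using h3)
      have h5 : Real.exp x ≤ Real.exp y := Real.exp_le_exp.2 h2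
      have := Real.exp_pos y
      nlinarith
    | succ n ih =>
      intro x y h1 h2 h3
      push_cast at h3
      by_cases h4 : y ≤ x + h
      · have h4 := step x y h1 h2 h4
        have h5 : Real.exp x ≤ Real.exp y := Real.exp_le_exp.2 h2
        have := Real.exp_pos y
        nlinarith
      · push Not at h4
        have h5 := ih x (y - h) h1 (by linarith) (by linarith)
        have h6 := step (y - h) y (by linarith) (by linarith) (by linarith)
        have h7 : Real.exp (y - h) = Real.exp y * r := by
          rw [hr, ← Real.exp_add, sub_eq_add_neg]
        rw [h7] at h5 h6
        have h8 := Real.exp_pos y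
        have h9 : C * (Real.exp y * r) + Real.exp y * r ≤ C * Real.exp y := by
          have : C * Real.exp y = C * (Real.exp y * r) + Real.exp y * (C * (1 - r)) := by ring
          rw [this, hC1]
          nlinarith
        linarith
  have full : ∀ x y, x0 ≤ x → x ≤ y → S x - C * Real.exp y ≤ S y := by
    intro x y h1 h2
    obtain ⟨n, hn⟩ := exists_nat_ge ((y - x) / h)
    rw [div_le_iff₀ hh] at hn
    exact ind n x y h1 h2 (by nlinarith)
  refine ⟨C + 2 * B, by linarith, ?_⟩
  intro x y hxy
  have hey := Real.exp_pos y
  by_cases hy0 : y < 0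
  · rw [hS0 y hy0, hS0 x (by linarith)]
    nlinarith
  · push Not at hy0
    have hey1 : 1 ≤ Real.exp y := Real.one_le_exp hy0
    by_cases hx : x0 ≤ x
    · have := full x y hx hxy
      nlinarith
    · push Not at hx
      have hb := abs_le.1 (hB x hx.le)
      by_cases hy : y ≤ x0
      · have hb2 := abs_le.1 (hB y hy)
        nlinarith
      · push Not at hy
        have h1 := full x0 y le_rfl hy.le
        have hb2 := abs_le.1 (hB x0 le_rfl)
        nlinarith

lemma WIKer.intP {ψ b K P R} (h : WIKer ψ b K P R) : Integrable P := by
  apply (integrable_inv_one_add_sq.const_mul K).mono' h.contP.aestronglyMeasurable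
  exact Eventually.of_forall fun w => by
    simpa [div_eq_mul_inv] using h.bP w

lemma WIKer.intR {ψ b K P R} (h : WIKer ψ b K P R) : Integrable R := by
  apply (integrable_inv_one_add_sq.const_mul K).mono' h.contR.aestronglyMeasurable
  exact Eventually.of_forall fun w => by
    simpa [div_eq_mul_inv] using h.bR w

lemma WIKer.bPK {ψ b K P R} (h : WIKer ψ b K P R) (w : ℝ) : |P w| ≤ K ∧ |R w| ≤ K := by
  have hK : 0 ≤ K := by
    have := (abs_nonneg _).trans (h.bP 0)
    simpa using this
  have : K / (1 + w ^ 2) ≤ K := div_le_self hK (by nlinarith [sq_nonneg w])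
  exact ⟨(h.bP w).trans this, (h.bR w).trans this⟩

lemma wi_T_bdd (S : ℝ → ℝ) (V : ℝ → ℝ → ℝ) (f : ℝ → ℝ) (lam M : ℝ) (hlam : 0 < lam)
    (hS0 : ∀ x < 0, S x = 0) (hloc : ∀ x0, ∃ B, ∀ x ≤ x0, |S x| ≤ B)
    (hslow : LogLinSlowlyDecreasing S)
    (hSint : ∀ σ : ℝ, 1 < σ → Integrable (fun v => S v * Real.exp (-σ * v)))
    (hV : ∀ σ : ℝ, 1 < σ → ∀ t, V σ t = ∫ v, S v * Real.exp (-σ * v) *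
      (σ * Real.cos (t * v) + t * Real.sin (t * v)))
    (hf : ∀ a b : ℝ, 0 < a → a ≤ b → IntegrableOn f (Icc a b) ∧
      Tendsto (fun σ : ℝ => ∫ t in a..b, |V σ t - f t|) (nhdsWithin 1 (Ioi 1)) (nhds 0))
    (hM : ∀ σ ∈ Ioo (1:ℝ) 2, ∫ t in (0:ℝ)..lam, |V σ t| ≤ M) :
    ∃ B, ∀ x, |S x * Real.exp (-x)| ≤ B := by
  have hVc := wi_V_cont S V hSint hV
  obtain ⟨C, hC0, hC⟩ := wi_slow S hS0 hloc hslow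
  -- kernel
  obtain ⟨ψ, b, K, P, R, hk, hPpos, hRP⟩ : ∃ (ψ : ℝ → ℝ) (b K : ℝ) (P R : ℝ → ℝ),
      WIKer ψ b K P R ∧ (∀ w, 0 < P w) ∧ (∀ w, |R w| ≤ P w / 2) := by
    obtain ⟨ψ, K, D, P, R, hk, _, hP, hR, hD⟩ := wi_exists_kernel
    set δ := 1 / (2 * D) with hδ
    have hδp : 0 < δ := by positivity
    obtain ⟨K', hk'⟩ := hk.scale δ hδp
    refine ⟨_, _, K', _, _, hk', fun w => mul_pos hδp (hP _), fun w => ?_⟩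
    rw [abs_mul, abs_of_pos (by positivity : 0 < δ ^ 2)]
    have h1 := mul_le_mul_of_nonneg_left (hR (δ * w)) (sq_nonneg δ)
    refine h1.trans (le_of_eq ?_)
    rw [hδ]
    field_simp
  have hPi := hk.intP
  have hPc := hk.contP
  have hRc := hk.contR
  set I := ∫ w, P w with hI
  have hI0 : 0 ≤ I := integral_nonneg fun w => (hPpos w).le
  obtain ⟨M', hM'⟩ := wi_bdd V f lam M hlam hVc hf hM b hk.hb
  obtain ⟨G, hG⟩ := (isCompact_Icc (a := (0:ℝ)) (b := b)).exists_bound_of_continuousOn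
      hk.cont.continuousOn
  have hG0 : 0 ≤ G := (norm_nonneg _).trans (hG 0 ⟨le_rfl, hk.hb.le⟩)
  obtain ⟨z0, hz0, hz⟩ := (isCompact_Icc (a := (-1:ℝ)) (b := 0)).exists_isMinOn
    ⟨0, by simp⟩ hPc.continuousOn
  set p := P z0 with hp
  have hpp : 0 < p := hPpos _
  have hpl : ∀ w ∈ Icc (-1:ℝ) 0, p ≤ P w := fun w hw => hz hw
  set A := 2 * (G * M') + C * (6 * I) with hA
  have hev : ∀ᶠ σ in nhdsWithin (1:ℝ) (Ioi 1), σ ∈ Ioo (1:ℝ) 2 :=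
    Ioo_mem_nhdsGT (by norm_num)
  have main : ∀ x, 0 ≤ x → 0 ≤ S x → ∀ᶠ σ in nhdsWithin (1:ℝ) (Ioi 1),
      Real.exp (-2) * (S x * Real.exp (-σ * x)) * (p / 2) ≤ A := by
    intro x hx hSx
    filter_upwards [hev, hM'] with σ hσ hMσ
    have hc := hVc σ hσ.1
    have hid := wi_identity S V hSint hV hk σ hσ.1 x
    have hH : |∫ t in (0:ℝ)..b, V σ t * (ψ t * Real.cos (x * t))| ≤ G * M' := by
      have hψc := hk.cont
      calc _ ≤ ∫ t in (0:ℝ)..b, |V σ t * (ψ t * Real.cos (x * t))| :=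
            intervalIntegral.abs_integral_le_integral_abs hk.hb.le
        _ ≤ ∫ t in (0:ℝ)..b, G * |V σ t| := by
            apply intervalIntegral.integral_mono_on hk.hb.le
              (Continuous.intervalIntegrable (by fun_prop) _ _)
              (Continuous.intervalIntegrable (by fun_prop) _ _)
            intro t ht
            rw [abs_mul, mul_comm, abs_mul]
            apply mul_le_mul_of_nonneg_right _ (abs_nonneg _)
            exact (mul_le_of_le_one_right (abs_nonneg _) (Real.abs_cos_le_one _)).trans (hG t ht)
        _ = G * ∫ t in (0:ℝ)..b, |V σ t| := intervalIntegral.integral_const_mul _ _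
        _ ≤ G * M' := mul_le_mul_of_nonneg_left hMσ hG0
    set w : ℝ → ℝ := fun v => σ * (P (x - v) + P (x + v)) + (R (x - v) - R (x + v)) with hw
    have hwc : Continuous w := by fun_prop
    have hwl : ∀ v, P (x - v) / 2 ≤ w v := by
      intro v
      have h1 := abs_le.1 (hRP (x - v))
      have h2 := abs_le.1 (hRP (x + v))
      have h3 := hPpos (x - v)
      have h4 := hPpos (x + v)
      simp only [hw]
      nlinarith [hσ.1]
    have hw0 : ∀ v, 0 ≤ w v := fun v => le_trans (by have := hPpos (x - v); positivity) (hwl v)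
    have hwu : ∀ v, w v ≤ 3 * (P (x - v) + P (x + v)) := by
      intro v
      have h1 := abs_le.1 (hRP (x - v))
      have h2 := abs_le.1 (hRP (x + v))
      have h3 := hPpos (x - v)
      have h4 := hPpos (x + v)
      simp only [hw]
      nlinarith [hσ.2]
    have hP1 : Integrable (fun v => P (x - v)) := hPi.comp_sub_left x
    have hP2 : Integrable (fun v => P (x + v)) := hPi.comp_add_left x
    have hui : Integrable (fun v => 3 * (P (x - v) + P (x + v))) := (hP1.add hP2).const_mul 3
    have hwi : Integrable w := by
      apply hui.mono' hwc.aestronglyMeasurable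
      exact Eventually.of_forall fun v => by
        rw [Real.norm_eq_abs, abs_of_nonneg (hw0 v)]; exact hwu v
    have hwint : ∫ v, w v ≤ 6 * I := by
      calc ∫ v, w v ≤ ∫ v, 3 * (P (x - v) + P (x + v)) := integral_mono hwi hui hwu
        _ = 6 * I := by
          rw [integral_const_mul, integral_add hP1 hP2, integral_sub_left_eq_self,
            integral_add_left_eq_self]
          ring
    -- the exponential comparison
    let E : ℝ → ℝ := (Ici (0:ℝ)).indicator (fun v => Real.exp (-(σ - 1) * v))
    have hE0 : ∀ v, 0 ≤ E v := fun v => indicator_nonneg (fun _ _ => (Real.exp_pos _).le) v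
    have hE1 : ∀ v, E v ≤ 1 := by
      intro v
      apply indicator_le' (g := fun _ => (1:ℝ))
      · intro v hv
        rw [Real.exp_le_one_iff]
        have : 0 ≤ v := hv
        nlinarith [hσ.1]
      · intro v _; exact zero_le_one
    have hEm : Measurable E := Measurable.indicator (by fun_prop) measurableSet_Ici
    have hEw : Integrable (fun v => E v * w v) := by
      apply hwi.bdd_mul (c := 1) hEm.aestronglyMeasurable
      exact Eventually.of_forall fun v => by
        rw [Real.norm_eq_abs, abs_of_nonneg (hE0 v)]; exact hE1 v
    have hEwint : ∫ v, E v * w v ≤ 6 * I := by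
      refine (integral_mono hEw hwi fun v => ?_).trans hwint
      exact mul_le_of_le_one_left (hw0 v) (hE1 v)
    have hTw : Integrable (fun v => S v * Real.exp (-σ * v) * w v) := by
      apply (hSint σ hσ.1).mul_bdd (c := 3 * (K + K)) hwc.aestronglyMeasurable
      exact Eventually.of_forall fun v => by
        rw [Real.norm_eq_abs, abs_of_nonneg (hw0 v)]
        have h1 := (le_abs_self _).trans (hk.bPK (x - v)).1
        have h2 := (le_abs_self _).trans (hk.bPK (x + v)).1
        have := hwu v
        linarith
    have hTE : ∀ v, 0 ≤ v → S v * Real.exp (-σ * v) + C * E v =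
        (S v + C * Real.exp v) * Real.exp (-σ * v) := by
      intro v hv
      have : E v = Real.exp v * Real.exp (-σ * v) := by
        simp only [E]
        rw [indicator_of_mem (by exact hv), ← Real.exp_add]
        congr 1; ring
      rw [this]; ring
    have hT0 : ∀ v, 0 ≤ S v * Real.exp (-σ * v) + C * E v := by
      intro v
      by_cases hv : 0 ≤ v
      · rw [hTE v hv]
        apply mul_nonneg _ (Real.exp_pos _).le
        have := hC (-1) v (by linarith)
        rw [hS0 (-1) (by norm_num)] at this
        linarith
      · rw [hS0 v (not_le.1 hv)]
        have := mul_nonneg hC0 (hE0 v)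
        linarith
    have hiall : Integrable (fun v => (S v * Real.exp (-σ * v) + C * E v) * w v) := by
      refine (hTw.add (hEw.const_mul C)).congr (Eventually.of_forall fun v => ?_)
      simp only [Pi.add_apply]; ring
    have hup : ∫ v, (S v * Real.exp (-σ * v) + C * E v) * w v ≤ A := by
      have e : ∫ v, (S v * Real.exp (-σ * v) + C * E v) * w v =
          (∫ v, S v * Real.exp (-σ * v) * w v) + C * ∫ v, E v * w v := by
        rw [← integral_const_mul, ← integral_add hTw (hEw.const_mul C)]
        congr 1; ext v; ring
      rw [e]
      have h1 := (abs_le.1 hH).2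
      rw [hid] at h1
      have h2 := mul_le_mul_of_nonneg_left hEwint hC0
      rw [hA]
      linarith
    refine le_trans ?_ hup
    calc Real.exp (-2) * (S x * Real.exp (-σ * x)) * (p / 2)
        = ∫ v in Icc x (x + 1), Real.exp (-2) * (S x * Real.exp (-σ * x)) * (p / 2) := by
          rw [setIntegral_const]; simp
      _ ≤ ∫ v in Icc x (x + 1), (S v * Real.exp (-σ * v) + C * E v) * w v := by
          apply setIntegral_mono_on _ hiall.integrableOn measurableSet_Icc
          · intro v hv
            have h1 : p / 2 ≤ w v := by
              refine le_trans ?_ (hwl v)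
              have := hpl (x - v) ⟨by linarith [hv.2], by linarith [hv.1]⟩
              linarith
            refine mul_le_mul ?_ h1 (by positivity) (hT0 v)
            rw [hTE v (hx.trans hv.1)]
            have h2 := hC x v hv.1
            have h3 : S x * Real.exp (-σ * v) ≤ (S v + C * Real.exp v) * Real.exp (-σ * v) :=
              mul_le_mul_of_nonneg_right (by linarith) (Real.exp_pos _).le
            refine le_trans ?_ h3
            rw [← mul_assoc, mul_comm (Real.exp (-2)), mul_assoc, ← Real.exp_add]
            apply mul_le_mul_of_nonneg_left _ hSx
            apply Real.exp_le_exp.2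
            nlinarith [hv.1, hv.2, hσ.1, hσ.2]
          · exact integrableOn_const (by simp)
      _ ≤ _ := setIntegral_le_integral hiall
          (Eventually.of_forall fun v => mul_nonneg (hT0 v) (hw0 v))
  set B := A / (Real.exp (-2) * (p / 2)) with hB
  have hup : ∀ x, 0 ≤ x → 0 ≤ S x → S x * Real.exp (-x) ≤ B := by
    intro x hx hSx
    have hlim : Tendsto (fun σ : ℝ => Real.exp (-2) * (S x * Real.exp (-σ * x)) * (p / 2))
        (nhdsWithin 1 (Ioi 1)) (nhds (Real.exp (-2) * (S x * Real.exp (-1 * x)) * (p / 2))) := by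
      apply Tendsto.mono_left _ nhdsWithin_le_nhds
      apply Continuous.tendsto
      fun_prop
    have := le_of_tendsto hlim (main x hx hSx)
    rw [hB, le_div_iff₀ (by positivity)]
    rw [neg_one_mul] at this
    linarith
  refine ⟨max B C, fun x => ?_⟩
  by_cases hx : x < 0
  · rw [hS0 x hx]; simp [hC0]
  push Not at hx
  have hlow : -C ≤ S x * Real.exp (-x) := by
    have := hC (-1) x (by linarith)
    rw [hS0 (-1) (by norm_num)] at this
    have h2 : -C = (0 - C * Real.exp x) * Real.exp (-x) := by
      rw [zero_sub, neg_mul, mul_assoc, ← Real.exp_add]; simp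
    rw [h2]
    exact mul_le_mul_of_nonneg_right this (Real.exp_pos _).le
  rw [abs_le]
  constructor
  · have := le_max_right B C; linarith
  · by_cases hSx : 0 ≤ S x
    · exact (hup x hx hSx).trans (le_max_left _ _)
    · have : S x * Real.exp (-x) ≤ 0 :=
        mul_nonpos_of_nonpos_of_nonneg (not_le.1 hSx).le (Real.exp_pos _).le
      exact this.trans (hC0.trans (le_max_right _ _))


lemma wi_RL (g : ℝ → ℝ) (b : ℝ) (hb : 0 < b) (hg : IntervalIntegrable g volume 0 b) :
    Tendsto (fun x : ℝ => ∫ t in (0:ℝ)..b, g t * Real.cos (x * t)) atTop (nhds 0) := by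
  have hgi : Integrable ((Ioc 0 b).indicator g) := by
    rw [integrable_indicator_iff measurableSet_Ioc]
    exact (intervalIntegrable_iff_integrableOn_Ioc_of_le hb.le).1 hg
  set F : ℝ → ℂ := fun t => (((Ioc 0 b).indicator g t : ℝ) : ℂ) with hF
  have hFi : Integrable F := hgi.ofReal
  have h1 := Real.tendsto_integral_exp_smul_cocompact F
  have h2 : Tendsto (fun x : ℝ => x / (2 * Real.pi)) atTop (cocompact ℝ) :=
    (tendsto_id.atTop_div_const (by positivity)).mono_right atTop_le_cocompact
  have h3 := (Complex.continuous_re.tendsto _).comp (h1.comp h2)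
  simp only [Complex.zero_re] at h3
  refine h3.congr fun x => ?_
  simp only [Function.comp]
  have hi : Integrable (fun v : ℝ => Real.fourierChar (-(v * (x / (2 * Real.pi)))) • F v) := by
    have := (Real.fourierIntegral_convergent_iff (μ := volume) (f := F)
      (x / (2 * Real.pi))).2 hFi
    refine this.congr (Eventually.of_forall fun v => ?_)
    simp only [RCLike.inner_apply, conj_trivial]
    rw [mul_comm v]
  have := integral_re hi
  simp only [RCLike.re_to_complex] at this
  rw [← this, intervalIntegral.integral_of_le hb.le, ← integral_indicator measurableSet_Ioc]
  congr 1
  ext v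
  rw [Circle.smul_def, Real.fourierChar_apply, smul_eq_mul]
  simp only [hF]
  rw [Complex.re_mul_ofReal, Complex.exp_ofReal_mul_I_re]
  have : 2 * Real.pi * -(v * (x / (2 * Real.pi))) = -(x * v) := by
    field_simp
  rw [this, Real.cos_neg]
  by_cases hv : v ∈ Ioc 0 b
  · rw [indicator_of_mem hv, indicator_of_mem hv]; ring
  · rw [indicator_of_notMem hv, indicator_of_notMem hv]; ring

lemma wi_ode (g h : ℝ → ℝ) (L : ℝ) (hd : ∀ x, HasDerivAt g (h x - g x) x)
    (hh : Tendsto h atTop (nhds L)) : Tendsto g atTop (nhds L) := by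
  -- one-sided statement, applied to `g` and `-g`
  have one : ∀ (g h : ℝ → ℝ) (L : ℝ), (∀ x, HasDerivAt g (h x - g x) x) →
      Tendsto h atTop (nhds L) → ∀ ε > 0, ∀ᶠ x in atTop, g x < L + ε := by
    intro g h L hd hh ε hε
    obtain ⟨X, hX⟩ := eventually_atTop.1 (hh.eventually (gt_mem_nhds (by linarith : L < L + ε / 2)))
    let k : ℝ → ℝ := fun x => Real.exp x * (g x - (L + ε / 2))
    have hk : ∀ x, HasDerivAt k (Real.exp x * (h x - (L + ε / 2))) x := by
      intro x
      have := (Real.hasDerivAt_exp x).mul ((hd x).sub_const (L + ε / 2))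
      exact this.congr_deriv (by ring)
    have hanti : AntitoneOn k (Ici X) := by
      apply antitoneOn_of_deriv_nonpos (convex_Ici X)
      · exact fun x _ => (hk x).continuousAt.continuousWithinAt
      · exact fun x _ => (hk x).differentiableAt.differentiableWithinAt
      · intro x hx
        rw [interior_Ici] at hx
        rw [(hk x).deriv]
        exact mul_nonpos_of_nonneg_of_nonpos (Real.exp_pos _).le
          (by linarith [hX x (le_of_lt hx)])
    have hlim : Tendsto (fun x => L + ε / 2 + k X * Real.exp (-x)) atTop
        (nhds (L + ε / 2 + k X * 0)) :=
      (Real.tendsto_exp_neg_atTop_nhds_zero.const_mul (k X)).const_add _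
    rw [mul_zero, add_zero] at hlim
    filter_upwards [hlim.eventually (gt_mem_nhds (by linarith : L + ε / 2 < L + ε)),
      eventually_ge_atTop X] with x hx hxX
    have h1 := hanti (mem_Ici.2 le_rfl) (mem_Ici.2 hxX) hxX
    have h2 : g x = L + ε / 2 + k x * Real.exp (-x) := by
      simp only [k]
      rw [mul_comm (Real.exp x), mul_assoc, ← Real.exp_add]
      simp
    have h3 := mul_le_mul_of_nonneg_right h1 (Real.exp_pos (-x)).le
    linarith
  rw [Metric.tendsto_nhds]
  intro ε hε
  have h1 := one g h L hd hh ε hε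
  have h2 := one (fun x => -g x) (fun x => -h x) (-L)
    (fun x => (hd x).neg.congr_deriv (by ring)) hh.neg ε hε
  filter_upwards [h1, h2] with x e1 e2
  rw [Real.dist_eq, abs_lt]
  constructor <;> linarith

lemma wi_dct_sigma (S : ℝ → ℝ) (B : ℝ) (hS0 : ∀ x < 0, S x = 0)
    (hSint : ∀ σ : ℝ, 1 < σ → Integrable (fun v => S v * Real.exp (-σ * v)))
    (hB : ∀ x, |S x * Real.exp (-x)| ≤ B)
    {ψ b K P R} (hk : WIKer ψ b K P R) (x : ℝ) :
    Tendsto (fun σ : ℝ => ∫ v, S v * Real.exp (-σ * v) *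
        (σ * (P (x - v) + P (x + v)) + (R (x - v) - R (x + v))))
      (nhdsWithin 1 (Ioi 1))
      (nhds (∫ v, S v * Real.exp (-v) *
        ((P (x - v) + P (x + v)) + (R (x - v) - R (x + v))))) := by
  have hPc := hk.contP
  have hRc := hk.contR
  have hP1 : Integrable (fun v => |P (x - v)|) := (hk.intP.comp_sub_left x).abs
  have hP2 : Integrable (fun v => |P (x + v)|) := (hk.intP.comp_add_left x).abs
  have hR1 : Integrable (fun v => |R (x - v)|) := (hk.intR.comp_sub_left x).abs
  have hR2 : Integrable (fun v => |R (x + v)|) := (hk.intR.comp_add_left x).abs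
  have hev : ∀ᶠ σ in nhdsWithin (1:ℝ) (Ioi 1), σ ∈ Ioo (1:ℝ) 2 :=
    Ioo_mem_nhdsGT (by norm_num)
  have hB0 : 0 ≤ B := (abs_nonneg _).trans (hB 0)
  apply tendsto_integral_filter_of_dominated_convergence
    (bound := fun v => B * (2 * (|P (x - v)| + |P (x + v)|) + (|R (x - v)| + |R (x + v)|)))
  · filter_upwards [hev] with σ hσ
    exact (hSint σ hσ.1).aestronglyMeasurable.mul (Continuous.aestronglyMeasurable (by fun_prop))
  · filter_upwards [hev] with σ hσ
    refine Eventually.of_forall fun v => ?_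
    rw [norm_mul, Real.norm_eq_abs, Real.norm_eq_abs]
    have h1 : |S v * Real.exp (-σ * v)| ≤ B := by
      by_cases hv : v < 0
      · rw [hS0 v hv]; simpa using hB0
      · push Not at hv
        refine le_trans ?_ (hB v)
        rw [abs_mul, abs_mul, abs_of_pos (Real.exp_pos _), abs_of_pos (Real.exp_pos _)]
        apply mul_le_mul_of_nonneg_left _ (abs_nonneg _)
        apply Real.exp_le_exp.2
        nlinarith [hσ.1]
    apply mul_le_mul h1 _ (abs_nonneg _) hB0
    refine (abs_add_le _ _).trans (add_le_add ?_ (abs_sub _ _))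
    rw [abs_mul, abs_of_pos (by linarith [hσ.1] : 0 < σ)]
    exact mul_le_mul hσ.2.le (abs_add_le _ _) (abs_nonneg _) (by norm_num)
  · exact (((hP1.add hP2).const_mul 2).add (hR1.add hR2)).const_mul B
  · refine Eventually.of_forall fun v => ?_
    apply Tendsto.mono_left _ nhdsWithin_le_nhds
    have : Continuous (fun σ : ℝ => S v * Real.exp (-σ * v) *
        (σ * (P (x - v) + P (x + v)) + (R (x - v) - R (x + v)))) := by fun_prop
    have := this.tendsto 1
    simpa using this

lemma wi_T_meas (S : ℝ → ℝ)
    (hSint : ∀ σ : ℝ, 1 < σ → Integrable (fun v => S v * Real.exp (-σ * v))) :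
    AEStronglyMeasurable (fun v => S v * Real.exp (-v)) volume := by
  have h1 := (hSint 2 (by norm_num)).aestronglyMeasurable
  have h2 : AEStronglyMeasurable (fun v : ℝ => Real.exp v) volume :=
    Continuous.aestronglyMeasurable (by fun_prop)
  refine (h1.mul h2).congr (Eventually.of_forall fun v => ?_)
  simp only [Pi.mul_apply]
  rw [mul_assoc, ← Real.exp_add]
  congr 2; ring

lemma wi_reflect (T : ℝ → ℝ) (B : ℝ) (hT0 : ∀ x < 0, T x = 0)
    (hTm : AEStronglyMeasurable T volume) (hB : ∀ x, |T x| ≤ B)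
    {ψ b K P R} (hk : WIKer ψ b K P R) :
    Tendsto (fun x : ℝ => ∫ v, T v * (P (x + v) - R (x + v))) atTop (nhds 0) := by
  have hPc := hk.contP
  have hRc := hk.contR
  have hB0 : 0 ≤ B := (abs_nonneg _).trans (hB 0)
  have hK : 0 ≤ K := by
    have := (abs_nonneg _).trans (hk.bP 0)
    simpa using this
  have hz : Tendsto (fun w : ℝ => 2 * K * (1 + w ^ 2)⁻¹) atTop (nhds 0) := by
    have : Tendsto (fun w : ℝ => 1 + w ^ 2) atTop atTop :=
      tendsto_atTop_add_const_left _ _ (tendsto_pow_atTop (by norm_num))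
    simpa using this.inv_tendsto_atTop.const_mul (2 * K)
  have hPR : ∀ w, |P w - R w| ≤ 2 * K * (1 + w ^ 2)⁻¹ := by
    intro w
    have h1 := hk.bP w
    have h2 := hk.bR w
    have := abs_sub (P w) (R w)
    rw [div_eq_mul_inv] at h1 h2
    linarith
  have key : Tendsto (fun x : ℝ => ∫ v, T v * (P (x + v) - R (x + v))) atTop
      (nhds (∫ _ : ℝ, (0:ℝ))) := by
    apply tendsto_integral_filter_of_dominated_convergence
      (bound := fun v => B * (2 * K * (1 + v ^ 2)⁻¹))
    · exact Eventually.of_forall fun x => hTm.mul (Continuous.aestronglyMeasurable (by fun_prop))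
    · filter_upwards [eventually_ge_atTop 0] with x hx
      refine Eventually.of_forall fun v => ?_
      by_cases hv : v < 0
      · rw [hT0 v hv]
        simp only [zero_mul, norm_zero]
        positivity
      · push Not at hv
        rw [norm_mul, Real.norm_eq_abs, Real.norm_eq_abs]
        apply mul_le_mul (hB v) _ (abs_nonneg _) hB0
        refine (hPR _).trans ?_
        apply mul_le_mul_of_nonneg_left _ (by positivity)
        apply inv_anti₀ (by positivity)
        nlinarith
    · exact (integrable_inv_one_add_sq.const_mul _).const_mul _
    · refine Eventually.of_forall fun v => ?_
      have h1 : Tendsto (fun x : ℝ => x + v) atTop atTop := tendsto_atTop_add_const_right _ _ tendsto_id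
      have h2 : Tendsto (fun x : ℝ => P (x + v) - R (x + v)) atTop (nhds 0) :=
        squeeze_zero_norm (fun x => hPR (x + v)) (hz.comp h1)
      simpa using h2.const_mul (T v)
  simpa using key

lemma wi_conv_deriv (T : ℝ → ℝ) (B : ℝ)
    (hTm : AEStronglyMeasurable T volume) (hB : ∀ x, |T x| ≤ B)
    {ψ b K P R} (hk : WIKer ψ b K P R) (x : ℝ) :
    HasDerivAt (fun x => ∫ v, T v * P (x - v)) (∫ v, T v * R (x - v)) x := by
  have hPc := hk.contP
  have hRc := hk.contR
  have hB0 : 0 ≤ B := (abs_nonneg _).trans (hB 0)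
  have hK : 0 ≤ K := by
    have := (abs_nonneg _).trans (hk.bP 0)
    simpa using this
  have h := hasDerivAt_integral_of_dominated_loc_of_deriv_le (μ := (volume : Measure ℝ))
    (F := fun x v => T v * P (x - v)) (F' := fun x v => T v * R (x - v)) (x₀ := x)
    (s := Metric.ball x 1) (bound := fun v => B * (3 * K * (1 + (x - v) ^ 2)⁻¹))
    (Metric.ball_mem_nhds x one_pos)
    (Eventually.of_forall fun y => hTm.mul (Continuous.aestronglyMeasurable (by fun_prop)))
    ((hk.intP.comp_sub_left x).bdd_mul hTm (Eventually.of_forall hB))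
    (hTm.mul (Continuous.aestronglyMeasurable (by fun_prop)))
    (Eventually.of_forall fun v y hy => by
      rw [norm_mul, Real.norm_eq_abs, Real.norm_eq_abs]
      apply mul_le_mul (hB v) _ (abs_nonneg _) hB0
      refine (hk.bR _).trans ?_
      rw [← div_eq_mul_inv, div_le_div_iff₀ (by positivity) (by positivity), mul_comm 3 K,
        mul_assoc]
      apply mul_le_mul_of_nonneg_left _ hK
      rw [Metric.mem_ball, Real.dist_eq] at hy
      have h1 : (y - x) ^ 2 < 1 := by
        rw [← sq_abs]; nlinarith [abs_nonneg (y - x)]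
      nlinarith [sq_nonneg ((y - v) + (y - x)), sq_nonneg (y - v)])
    (((integrable_inv_one_add_sq.comp_sub_left x).const_mul _).const_mul _)
    (Eventually.of_forall fun v y _ => by
      have h1 : HasDerivAt (fun y : ℝ => y - v) 1 y := (hasDerivAt_id y).sub_const v
      have h2 := ((hk.deriv (y - v)).comp y h1).const_mul (T v)
      exact h2.congr_deriv (by ring))
  exact h.2

lemma wi_conv_lim (S : ℝ → ℝ) (V : ℝ → ℝ → ℝ) (f : ℝ → ℝ) (lam M B : ℝ) (hlam : 0 < lam)
    (hS0 : ∀ x < 0, S x = 0)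
    (hSint : ∀ σ : ℝ, 1 < σ → Integrable (fun v => S v * Real.exp (-σ * v)))
    (hV : ∀ σ : ℝ, 1 < σ → ∀ t, V σ t = ∫ v, S v * Real.exp (-σ * v) *
      (σ * Real.cos (t * v) + t * Real.sin (t * v)))
    (hf : ∀ a b : ℝ, 0 < a → a ≤ b → IntegrableOn f (Icc a b) ∧
      Tendsto (fun σ : ℝ => ∫ t in a..b, |V σ t - f t|) (nhdsWithin 1 (Ioi 1)) (nhds 0))
    (hM : ∀ σ ∈ Ioo (1:ℝ) 2, ∫ t in (0:ℝ)..lam, |V σ t| ≤ M)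
    (hB : ∀ x, |S x * Real.exp (-x)| ≤ B) :
    ∃ c : ℝ, ∀ (ψ : ℝ → ℝ) (b K : ℝ) (P R : ℝ → ℝ), WIKer ψ b K P R →
      Tendsto (fun x => ∫ v, (S v * Real.exp (-v)) * P (x - v)) atTop (nhds (ψ 0 * c)) := by
  have hVc := wi_V_cont S V hSint hV
  have hTm := wi_T_meas S hSint
  have hT0 : ∀ x < 0, S x * Real.exp (-x) = 0 := fun x hx => by rw [hS0 x hx, zero_mul]
  have hev : ∀ᶠ σ in nhdsWithin (1:ℝ) (Ioi 1), σ ∈ Ioo (1:ℝ) 2 :=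
    Ioo_mem_nhdsGT (by norm_num)
  -- limits of the smoothed transforms
  have hH : ∀ (ψ : ℝ → ℝ) (b K : ℝ) (P R : ℝ → ℝ), WIKer ψ b K P R → ∀ x : ℝ,
      Tendsto (fun σ => ∫ t in (0:ℝ)..b, V σ t * (ψ t * Real.cos (x * t))) (nhdsWithin 1 (Ioi 1))
        (nhds ((1 / 2) * ∫ v, S v * Real.exp (-v) *
          ((P (x - v) + P (x + v)) + (R (x - v) - R (x + v))))) := by
    intro ψ b K P R hk x
    refine ((wi_dct_sigma S B hS0 hSint hB hk x).const_mul (1 / 2)).congr' ?_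
    filter_upwards [hev] with σ hσ
    exact (wi_identity S V hSint hV hk σ hσ.1 x).symm
  -- convergence of `∫₀¹ V`
  obtain ⟨c0, hc0⟩ : ∃ c0, Tendsto (fun σ => ∫ t in (0:ℝ)..1, V σ t) (nhdsWithin 1 (Ioi 1))
      (nhds c0) := by
    obtain ⟨ψ, K, _, P, R, hk, hψ0, _⟩ := wi_exists_kernel
    have h1 := hH ψ 2 K P R hk 0
    simp only [zero_mul, Real.cos_zero, mul_one] at h1
    have h2 := wi_lim1 V f lam M hlam hVc hf hM 2 (by norm_num) ψ hk.cont
    refine ⟨_, ((h1.sub h2).div_const (ψ 0)).congr fun σ => ?_⟩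
    rw [sub_sub_cancel, mul_div_cancel_left₀ _ hψ0.ne']
  refine ⟨2 * (c0 - ∫ t in (0:ℝ)..1, f t), ?_⟩
  intro ψ b K P R hk
  have hψc := hk.cont
  have hPc := hk.contP
  have hRc := hk.contR
  have hfi := wi_f_int V f lam M hlam hVc hf hM b hk.hb
  have hi : ∀ Q : ℝ → ℝ, Integrable Q →
      Integrable (fun v => S v * Real.exp (-v) * Q v) := fun Q hQ =>
    hQ.bdd_mul hTm (Eventually.of_forall hB)
  have heq : ∀ x : ℝ, (∫ v, S v * Real.exp (-v) * P (x - v)) +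
      (∫ v, S v * Real.exp (-v) * R (x - v)) +
      (∫ v, S v * Real.exp (-v) * (P (x + v) - R (x + v))) =
      2 * ((∫ t in (0:ℝ)..b, (f t * ψ t) * Real.cos (x * t)) +
        ψ 0 * (c0 - ∫ t in (0:ℝ)..1, f t)) := by
    intro x
    have h1 := hH ψ b K P R hk x
    have h2 := wi_lim1 V f lam M hlam hVc hf hM b hk.hb (fun t => ψ t * Real.cos (x * t))
      (by fun_prop)
    simp only [mul_zero, Real.cos_zero, mul_one] at h2
    have h3 := (h2.add (hc0.const_mul (ψ 0))).congr (fun σ => sub_add_cancel _ _)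
    have h4 := tendsto_nhds_unique h1 h3
    have e : ∫ v, S v * Real.exp (-v) *
          ((P (x - v) + P (x + v)) + (R (x - v) - R (x + v))) =
        (∫ v, S v * Real.exp (-v) * P (x - v)) +
      (∫ v, S v * Real.exp (-v) * R (x - v)) +
      (∫ v, S v * Real.exp (-v) * (P (x + v) - R (x + v))) := by
      have i1 : Integrable (fun v => S v * Real.exp (-v) * P (x - v)) :=
        hi _ (hk.intP.comp_sub_left x)
      have i2 : Integrable (fun v => S v * Real.exp (-v) * R (x - v)) :=
        hi _ (hk.intR.comp_sub_left x)
      have i3 : Integrable (fun v => S v * Real.exp (-v) * (P (x + v) - R (x + v))) :=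
        hi (fun v => P (x + v) - R (x + v))
          ((hk.intP.comp_add_left x).sub (hk.intR.comp_add_left x))
      have i12 : Integrable (fun v => S v * Real.exp (-v) * P (x - v) +
          S v * Real.exp (-v) * R (x - v)) := i1.add i2
      rw [← integral_add i1 i2, ← integral_add i12 i3]
      congr 1; ext v; ring
    rw [← e]
    simp only [← mul_assoc] at h4 ⊢
    linarith
  have hRL := wi_RL (fun t => f t * ψ t) b hk.hb (hfi.mul_continuousOn hψc.continuousOn)
  have hrefl := wi_reflect (fun v => S v * Real.exp (-v)) B hT0 hTm hB hk
  apply wi_ode _ (fun x => (∫ v, S v * Real.exp (-v) * P (x - v)) +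
      (∫ v, S v * Real.exp (-v) * R (x - v)))
  · intro x
    exact (wi_conv_deriv (fun v => S v * Real.exp (-v)) B hTm hB hk x).congr_deriv (by ring)
  · have h1 := ((hRL.add_const (ψ 0 * (c0 - ∫ t in (0:ℝ)..1, f t))).const_mul 2).sub hrefl
    have e : 2 * (0 + ψ 0 * (c0 - ∫ t in (0:ℝ)..1, f t)) - 0 =
        ψ 0 * (2 * (c0 - ∫ t in (0:ℝ)..1, f t)) := by ring
    rw [e] at h1
    refine h1.congr fun x => ?_
    rw [← heq x]
    ring


lemma wi_T_slow (S : ℝ → ℝ) (B : ℝ) (hslow : LogLinSlowlyDecreasing S)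
    (hB : ∀ x, |S x * Real.exp (-x)| ≤ B) (ε : ℝ) (hε : 0 < ε) :
    ∃ h, 0 < h ∧ ∃ x0, ∀ x y, x0 ≤ x → x ≤ y → y ≤ x + h →
      S x * Real.exp (-x) - ε ≤ S y * Real.exp (-y) := by
  obtain ⟨h, hh, x0, -, H⟩ := hslow (ε / 2) (by positivity)
  have hB0 : 0 ≤ B := (abs_nonneg _).trans (hB 0)
  have hpos : 0 < ε / (2 * (B + 1)) := by positivity
  refine ⟨min h (ε / (2 * (B + 1))), lt_min hh hpos, x0, fun x y h1 h2 h3 => ?_⟩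
  have h4 := H x y h1 h2 (h3.trans (by gcongr; exact min_le_left _ _))
  have h5 : y - x ≤ ε / (2 * (B + 1)) := by
    have := min_le_right h (ε / (2 * (B + 1))); linarith
  rw [ge_iff_le, le_div_iff₀ (Real.exp_pos _)] at h4
  set q := Real.exp (-(y - x)) with hq
  have hq1 : q ≤ 1 := by rw [hq, Real.exp_le_one_iff]; linarith
  have hq0 : 0 < q := Real.exp_pos _
  have hq2 : 1 - (y - x) ≤ q := by
    have := Real.add_one_le_exp (-(y - x)); rw [← hq] at this; linarith
  have e1 : Real.exp (-y) = q * Real.exp (-x) := by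
    rw [hq, ← Real.exp_add]; congr 1; ring
  have e2 : Real.exp x * Real.exp (-x) = 1 := by rw [← Real.exp_add]; simp
  have h6 : (S x - ε / 2 * Real.exp x) * Real.exp (-y) ≤ S y * Real.exp (-y) :=
    mul_le_mul_of_nonneg_right (by linarith) (Real.exp_pos _).le
  have h7 : (S x - ε / 2 * Real.exp x) * Real.exp (-y) =
      q * (S x * Real.exp (-x)) - q * (ε / 2) := by
    rw [e1]
    linear_combination (-(ε / 2) * q) * e2
  have h8 := abs_le.1 (hB x)
  set T := S x * Real.exp (-x)
  have h9 : (1 - q) * T ≤ ε / 2 := by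
    have a1 : (1 - q) * T ≤ (1 - q) * (B + 1) :=
      mul_le_mul_of_nonneg_left (by linarith) (by linarith)
    have a2 : (1 - q) * (B + 1) ≤ ε / (2 * (B + 1)) * (B + 1) :=
      mul_le_mul_of_nonneg_right (by linarith) (by linarith)
    have a3 : ε / (2 * (B + 1)) * (B + 1) = ε / 2 := by field_simp
    linarith
  nlinarith

lemma wi_tail (P : ℝ → ℝ) (hP : Integrable P) (ε : ℝ) (hε : 0 < ε) :
    ∃ N : ℝ, 0 < N ∧ ∫ u, {u : ℝ | N < |u|}.indicator P u ≤ ε := by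
  have h : Tendsto (fun n : ℕ => ∫ u, {u : ℝ | (n : ℝ) < |u|}.indicator P u) atTop
      (nhds (∫ u : ℝ, (0:ℝ))) := by
    apply tendsto_integral_of_dominated_convergence (fun u => |P u|)
    · intro n
      exact hP.aestronglyMeasurable.indicator (measurableSet_lt measurable_const (by fun_prop))
    · exact hP.abs
    · intro n
      exact Eventually.of_forall fun u => norm_indicator_le_norm_self _ _
    · refine Eventually.of_forall fun u => ?_
      apply tendsto_const_nhds.congr'
      filter_upwards [eventually_ge_atTop ⌈|u|⌉₊] with n hn
      rw [indicator_of_notMem]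
      have := Nat.ceil_le.1 hn
      simpa using this
  rw [integral_zero] at h
  obtain ⟨n, h1, h2⟩ := ((h.eventually_lt_const hε).and (eventually_gt_atTop 0)).exists
  exact ⟨n, by exact_mod_cast h2, h1.le⟩

lemma wi_tauber (T P : ℝ → ℝ) (B A : ℝ) (hTm : AEStronglyMeasurable T) (hB : ∀ x, |T x| ≤ B)
    (hslow : ∀ ε, 0 < ε → ∃ h, 0 < h ∧ ∃ x0, ∀ x y, x0 ≤ x → x ≤ y → y ≤ x + h → T x - ε ≤ T y)
    (hP : Integrable P) (hPpos : ∀ w, 0 < P w)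
    (hlim : ∀ δ : ℝ, 0 < δ → Tendsto (fun x => ∫ v, T v * (δ * P (δ * (x - v)))) atTop (nhds A)) :
    Tendsto (fun x => T x * ∫ u, P u) atTop (nhds A) := by
  have hB0 : 0 ≤ B := (abs_nonneg _).trans (hB 0)
  have hI : 0 ≤ ∫ u, P u := integral_nonneg fun u => (hPpos u).le
  set I := ∫ u, P u with hIdef
  have key : ∀ ε, 0 < ε → ∀ᶠ x in atTop, |T x * I - A| ≤ ε * (I + 2 * B + 1) := by
    intro ε hε
    obtain ⟨h, hh, x0, H⟩ := hslow ε hε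
    obtain ⟨N, hN, htail⟩ := wi_tail P hP ε hε
    set δ := 2 * N / h with hδ
    have hδ0 : 0 < δ := by positivity
    have hNδ : N = δ * (h / 2) := by rw [hδ]; field_simp
    have hl := Metric.tendsto_atTop.1 (hlim δ hδ0) ε hε
    obtain ⟨x1, hx1⟩ := hl
    have hiP : ∀ z, Integrable (fun v => T v * (δ * P (δ * (z - v)))) := fun z => by
      have : Integrable (fun v => δ * P (δ * (z - v))) :=
        ((hP.comp_mul_left' hδ0.ne').comp_sub_left z).const_mul δ
      exact this.bdd_mul hTm (Eventually.of_forall hB)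
    have hi1 : ∀ z, Integrable (fun v => δ * P (δ * (z - v))) := fun z =>
      ((hP.comp_mul_left' hδ0.ne').comp_sub_left z).const_mul δ
    set τ := {u : ℝ | N < |u|}.indicator P with hτ
    have hτi : Integrable τ := hP.indicator (measurableSet_lt measurable_const (by fun_prop))
    have hi2 : ∀ z, Integrable (fun v => δ * τ (δ * (z - v))) := fun z =>
      ((hτi.comp_mul_left' hδ0.ne').comp_sub_left z).const_mul δ
    have hsub : ∀ (Q : ℝ → ℝ) z, ∫ v, δ * Q (δ * (z - v)) = ∫ u, Q u := fun Q z => by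
      rw [integral_const_mul, integral_sub_left_eq_self (fun v => Q (δ * v)) volume z,
        Measure.integral_comp_mul_left, abs_of_pos (inv_pos.2 hδ0), smul_eq_mul,
        mul_inv_cancel_left₀ hδ0.ne']
    have hτ0 : ∀ u, 0 ≤ τ u := fun u => indicator_nonneg (fun u _ => (hPpos u).le) u
    filter_upwards [eventually_ge_atTop (x0 + h), eventually_ge_atTop (x1 + h)] with x hx hx'
    have hTx := abs_le.1 (hB x)
    -- a point `v` is either near the centre or in the tail
    have near : ∀ z v, ¬ (N < |δ * (z - v)|) → z - h / 2 ≤ v ∧ v ≤ z + h / 2 := by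
      intro z v hv
      rw [not_lt, abs_mul, abs_of_pos hδ0, hNδ, mul_le_mul_iff_right₀ hδ0, abs_le] at hv
      constructor <;> linarith
    have lower : (T x - ε) * I - 2 * B * (∫ u, τ u) ≤
        ∫ v, T v * (δ * P (δ * (x + h / 2 - v))) := by
      rw [hIdef, ← hsub P (x + h / 2), ← hsub τ (x + h / 2), ← integral_const_mul,
        ← integral_const_mul, ← integral_sub ((hi1 _).const_mul _) ((hi2 _).const_mul _)]
      apply integral_mono (((hi1 _).const_mul _).sub ((hi2 _).const_mul _)) (hiP _)
      intro v
      have hp : 0 < δ * P (δ * (x + h / 2 - v)) := mul_pos hδ0 (hPpos _)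
      have hTv := abs_le.1 (hB v)
      simp only [Pi.sub_apply]
      by_cases hv : N < |δ * (x + h / 2 - v)|
      · have : τ (δ * (x + h / 2 - v)) = P (δ * (x + h / 2 - v)) :=
          indicator_of_mem (by simpa using hv) _
        rw [this]
        nlinarith
      · have : τ (δ * (x + h / 2 - v)) = 0 :=
          indicator_of_notMem (by simpa using hv) _
        rw [this]
        obtain ⟨a1, a2⟩ := near _ _ hv
        have := H x v (by linarith) (by linarith) (by linarith)
        nlinarith
    have upper : ∫ v, T v * (δ * P (δ * (x - h / 2 - v))) ≤
        (T x + ε) * I + 2 * B * (∫ u, τ u) := by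
      rw [hIdef, ← hsub P (x - h / 2), ← hsub τ (x - h / 2), ← integral_const_mul,
        ← integral_const_mul, ← integral_add ((hi1 _).const_mul _) ((hi2 _).const_mul _)]
      apply integral_mono (hiP _) (((hi1 _).const_mul _).add ((hi2 _).const_mul _))
      intro v
      have hp : 0 < δ * P (δ * (x - h / 2 - v)) := mul_pos hδ0 (hPpos _)
      have hTv := abs_le.1 (hB v)
      simp only [Pi.add_apply]
      by_cases hv : N < |δ * (x - h / 2 - v)|
      · have : τ (δ * (x - h / 2 - v)) = P (δ * (x - h / 2 - v)) :=
          indicator_of_mem (by simpa using hv) _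
        rw [this]
        nlinarith
      · have : τ (δ * (x - h / 2 - v)) = 0 :=
          indicator_of_notMem (by simpa using hv) _
        rw [this]
        obtain ⟨a1, a2⟩ := near _ _ hv
        have := H v x (by linarith) (by linarith) (by linarith)
        nlinarith
    have b1 := hx1 (x + h / 2) (by linarith)
    have b2 := hx1 (x - h / 2) (by linarith)
    rw [Real.dist_eq, abs_lt] at b1 b2
    have b3 : 2 * B * (∫ u, τ u) ≤ 2 * B * ε := mul_le_mul_of_nonneg_left htail (by linarith)
    rw [abs_le]
    constructor <;> nlinarith
  rw [Metric.tendsto_atTop']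
  intro ε hε
  have hpos : 0 < I + 2 * B + 1 := by positivity
  obtain ⟨N, hN⟩ := eventually_atTop.1 (key (ε / (2 * (I + 2 * B + 1))) (by positivity))
  refine ⟨N, fun x hx => ?_⟩
  have := hN x hx.le
  rw [Real.dist_eq]
  have e : ε / (2 * (I + 2 * B + 1)) * (I + 2 * B + 1) = ε / 2 := by field_simp
  rw [e] at this
  linarith

lemma wi_abel (T : ℝ → ℝ) (B a : ℝ) (hT0 : ∀ x < 0, T x = 0)
    (hTm : Measurable T) (hB : ∀ x, |T x| ≤ B) (ha : Tendsto T atTop (nhds a)) :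
    Tendsto (fun σ : ℝ => (σ - 1) * ∫ v, T v * Real.exp (-(σ - 1) * v)) (nhdsWithin 1 (Ioi 1))
      (nhds a) := by
  have h : Tendsto (fun σ : ℝ => ∫ u in Ioi (0:ℝ), T (u / (σ - 1)) * Real.exp (-u))
      (nhdsWithin 1 (Ioi 1)) (nhds (∫ u in Ioi (0:ℝ), a * Real.exp (-u))) := by
    apply tendsto_integral_filter_of_dominated_convergence (fun u => B * Real.exp (-u))
    · refine Eventually.of_forall fun σ => ?_
      have : Measurable (fun u => T (u / (σ - 1)) * Real.exp (-u)) := by fun_prop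
      exact this.aestronglyMeasurable
    · refine Eventually.of_forall fun σ => Eventually.of_forall fun u => ?_
      rw [Real.norm_eq_abs, abs_mul, abs_of_pos (Real.exp_pos _)]
      exact mul_le_mul_of_nonneg_right (hB _) (Real.exp_pos _).le
    · exact (integrableOn_exp_neg_Ioi 0).const_mul B
    · filter_upwards [ae_restrict_mem measurableSet_Ioi] with u hu
      refine Tendsto.mul_const _ (ha.comp ?_)
      have h1 : Tendsto (fun σ : ℝ => σ - 1) (nhdsWithin 1 (Ioi 1)) (nhdsWithin 0 (Ioi 0)) := by
        apply tendsto_nhdsWithin_of_tendsto_nhds_of_eventually_within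
        · have : Tendsto (fun σ : ℝ => σ - 1) (nhds 1) (nhds (1 - 1)) :=
            (continuous_id.sub continuous_const).tendsto 1
          rw [sub_self] at this
          exact this.mono_left nhdsWithin_le_nhds
        · filter_upwards [self_mem_nhdsWithin] with σ hσ
          simpa using hσ
      simpa [div_eq_mul_inv] using (tendsto_inv_nhdsGT_zero.comp h1).const_mul_atTop hu
  rw [integral_const_mul, integral_exp_neg_Ioi_zero, mul_one] at h
  refine h.congr' ?_
  filter_upwards [self_mem_nhdsWithin] with σ hσ
  have hσ' : 0 < σ - 1 := sub_pos.2 hσ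
  have e1 : ∫ v, T v * Real.exp (-(σ - 1) * v) =
      ∫ v in Ioi (0:ℝ), T v * Real.exp (-(σ - 1) * v) := by
    rw [← integral_Ici_eq_integral_Ioi, setIntegral_eq_integral_of_forall_compl_eq_zero]
    intro v hv
    rw [hT0 v (by simpa using hv), zero_mul]
  have e2 := integral_comp_mul_left_Ioi (fun u => T (u / (σ - 1)) * Real.exp (-u)) 0 hσ'
  rw [mul_zero, smul_eq_mul] at e2
  rw [e1]
  have e3 : ∀ v, T ((σ - 1) * v / (σ - 1)) * Real.exp (-((σ - 1) * v)) =
      T v * Real.exp (-(σ - 1) * v) := fun v => by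
    rw [mul_div_cancel_left₀ _ hσ'.ne', neg_mul]
  simp only [e3] at e2
  rw [e2, mul_inv_cancel_left₀ hσ'.ne']

lemma wi_mass_mono (ν : Measure ℝ) [IsLocallyFiniteMeasure ν] :
    Monotone (fun x : ℝ => (ν (Icc 0 x)).toReal) := fun _ _ hxy =>
  ENNReal.toReal_mono isCompact_Icc.measure_lt_top.ne (measure_mono (Icc_subset_Icc_right hxy))

/-- Analytic core of the theorem, in terms of `S` and `V σ t = Re L(σ + it)`. -/
theorem wi_core (S : ℝ → ℝ) (V : ℝ → ℝ → ℝ) (f : ℝ → ℝ) (lam M : ℝ) (hlam : 0 < lam)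
    (hSm : Measurable S)
    (hS0 : ∀ x < 0, S x = 0) (hloc : ∀ x0, ∃ B, ∀ x ≤ x0, |S x| ≤ B)
    (hslow : LogLinSlowlyDecreasing S)
    (hSint : ∀ σ : ℝ, 1 < σ → Integrable (fun v => S v * Real.exp (-σ * v)))
    (hV : ∀ σ : ℝ, 1 < σ → ∀ t, V σ t = ∫ v, S v * Real.exp (-σ * v) *
      (σ * Real.cos (t * v) + t * Real.sin (t * v)))
    (hf : ∀ a b : ℝ, 0 < a → a ≤ b → IntegrableOn f (Icc a b) ∧
      Tendsto (fun σ : ℝ => ∫ t in a..b, |V σ t - f t|) (nhdsWithin 1 (Ioi 1)) (nhds 0))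
    (hM : ∀ σ ∈ Ioo (1:ℝ) 2, ∫ t in (0:ℝ)..lam, |V σ t| ≤ M) :
    ∃ a : ℝ,
      Tendsto (fun σ : ℝ => (σ - 1) * V σ 0) (nhdsWithin 1 (Ioi 1)) (nhds a) ∧
      Tendsto (fun x : ℝ => Real.exp (-x) * S x) atTop (nhds a) := by
  obtain ⟨B, hB⟩ := wi_T_bdd S V f lam M hlam hS0 hloc hslow hSint hV hf hM
  obtain ⟨c, hc⟩ := wi_conv_lim S V f lam M B hlam hS0 hSint hV hf hM hB
  obtain ⟨ψ, K, _, P, R, hk, hψ0, hPpos, _⟩ := wi_exists_kernel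
  have hT := wi_tauber (fun v => S v * Real.exp (-v)) P B (ψ 0 * c) (wi_T_meas S hSint) hB
    (wi_T_slow S B hslow hB) hk.intP hPpos (by
      intro δ hδ
      obtain ⟨K', hk'⟩ := hk.scale δ hδ
      have := hc _ _ _ _ _ hk'
      simpa using this)
  have hI : 0 < ∫ u, P u := by
    rw [integral_pos_iff_support_of_nonneg (fun u => (hPpos u).le) hk.intP]
    have : Function.support P = univ := by
      ext u; simp [(hPpos u).ne']
    rw [this]; simp
  have hT' : Tendsto (fun v => S v * Real.exp (-v)) atTop (nhds (ψ 0 * c / ∫ u, P u)) :=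
    (hT.div_const _).congr fun x => mul_div_cancel_right₀ _ hI.ne'
  refine ⟨ψ 0 * c / ∫ u, P u, ?_, hT'.congr fun x => mul_comm _ _⟩
  have h1 := wi_abel (fun v => S v * Real.exp (-v)) B _
    (fun x hx => by simp [hS0 x hx]) (by fun_prop) hB hT'
  have h2 : Tendsto (fun σ : ℝ => σ) (nhdsWithin 1 (Ioi 1)) (nhds 1) :=
    tendsto_id.mono_left nhdsWithin_le_nhds
  have h3 := h2.mul h1
  rw [one_mul] at h3
  refine h3.congr' ?_
  filter_upwards [self_mem_nhdsWithin] with σ hσ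
  rw [hV σ hσ 0]
  simp only [zero_mul, Real.cos_zero, mul_one, add_zero]
  rw [integral_mul_const]
  have : ∀ v, S v * Real.exp (-v) * Real.exp (-(σ - 1) * v) = S v * Real.exp (-σ * v) := by
    intro v
    rw [mul_assoc, ← Real.exp_add]
    congr 2; ring
  simp only [this]
  ring

lemma wi_lint (g : ℝ → ℝ) (hg : Continuous g) (lam M : ℝ) (hlam : 0 < lam)
    (h : (∫⁻ t in Ioo (-lam) lam, ENNReal.ofReal |g t|) ≤ ENNReal.ofReal M) :
    ∫ t in (0:ℝ)..lam, |g t| ≤ max M 0 := by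
  rw [intervalIntegral.integral_of_le hlam.le, integral_Ioc_eq_integral_Ioo]
  rw [integral_eq_lintegral_of_nonneg_ae (Eventually.of_forall fun t => abs_nonneg _)
    (by fun_prop)]
  apply ENNReal.toReal_le_of_le_ofReal (le_max_right _ _)
  refine (lintegral_mono_set (Ioo_subset_Ioo_left (by linarith))).trans (h.trans ?_)
  exact ENNReal.ofReal_le_ofReal (le_max_left _ _)

/-- Theorem 1.3 for the Laplace–Stieltjes transform.
Here the locally finite signed Borel measure `μ` on `[0,∞)` is represented by the
Jordan-type decomposition `μ = μp - μm` into locally finite nonnegative measures,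
and `S x = μ([0,x])`. -/
theorem wiener_ikehara_stieltjes_B2 (μp μm : Measure ℝ)
    [IsLocallyFiniteMeasure μp] [IsLocallyFiniteMeasure μm]
    (hμp : μp (Iio 0) = 0) (hμm : μm (Iio 0) = 0)
    (hconv : ∀ s : ℂ, 1 < s.re →
      Integrable (fun x : ℝ => Complex.exp (-s * x)) μp ∧
      Integrable (fun x : ℝ => Complex.exp (-s * x)) μm)
    (S : ℝ → ℝ) (hSdef : ∀ x : ℝ, S x = (μp (Icc 0 x)).toReal - (μm (Icc 0 x)).toReal)
    (hslow : LogLinSlowlyDecreasing S)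
    (U : ℂ → ℝ) (hU : ∀ s : ℂ, U s = (laplaceStieltjes μp μm s).re)
    (hbd : L1locBoundaryBehavior U)
    (lam : ℝ) (hlam : 0 < lam)
    (hsup : ∃ M : ℝ, ∀ σ ∈ Ioo (1 : ℝ) 2,
      (∫⁻ t in Ioo (-lam) lam, ENNReal.ofReal |U (σ + t * Complex.I)|) ≤ ENNReal.ofReal M) :
    ∃ a : ℝ,
      Tendsto (fun σ : ℝ => (σ - 1) * U σ) (nhdsWithin 1 (Ioi 1)) (nhds a) ∧
      Tendsto (fun x : ℝ => Real.exp (-x) * S x) atTop (nhds a) := by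
  have hp := wi_parts_real μp hμp (fun s hs => (hconv s hs).1)
  have hm := wi_parts_real μm hμm (fun s hs => (hconv s hs).2)
  have hS : S = fun x => (μp (Icc 0 x)).toReal - (μm (Icc 0 x)).toReal := funext hSdef
  have hSm : Measurable S := by
    rw [hS]
    exact (wi_mass_mono μp).measurable.sub (wi_mass_mono μm).measurable
  have hSint : ∀ σ : ℝ, 1 < σ → Integrable (fun v => S v * Real.exp (-σ * v)) := by
    intro σ hσ
    refine ((hp σ hσ).1.sub (hm σ hσ).1).congr (Eventually.of_forall fun v => ?_)
    simp only [Pi.sub_apply, hSdef v]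
    ring
  have hmul : ∀ (g : ℝ → ℝ) (σ t : ℝ), Integrable g → Integrable (fun v => g v *
      (σ * Real.cos (t * v) + t * Real.sin (t * v))) := by
    intro g σ t hg
    refine hg.mul_bdd (c := |σ| + |t|) (Continuous.aestronglyMeasurable (by fun_prop))
      (Eventually.of_forall fun v => ?_)
    refine (norm_add_le _ _).trans ?_
    rw [Real.norm_eq_abs, Real.norm_eq_abs, abs_mul, abs_mul]
    exact add_le_add (mul_le_of_le_one_right (abs_nonneg _) (Real.abs_cos_le_one _))
      (mul_le_of_le_one_right (abs_nonneg _) (Real.abs_sin_le_one _))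
  have hV : ∀ σ : ℝ, 1 < σ → ∀ t : ℝ, U (σ + t * Complex.I) = ∫ v, S v * Real.exp (-σ * v) *
      (σ * Real.cos (t * v) + t * Real.sin (t * v)) := by
    intro σ hσ t
    rw [hU, laplaceStieltjes, Complex.sub_re, (hp σ hσ).2 t, (hm σ hσ).2 t,
      ← integral_sub (hmul _ σ t (hp σ hσ).1) (hmul _ σ t (hm σ hσ).1)]
    congr 1
    ext v
    rw [hSdef v]
    ring
  obtain ⟨f, hf⟩ := hbd
  obtain ⟨M, hM⟩ := hsup
  have hVc := wi_V_cont S (fun σ t => U (σ + t * Complex.I)) hSint hV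
  obtain ⟨a, h1, h2⟩ := wi_core S (fun σ t => U (σ + t * Complex.I)) f lam (max M 0) hlam hSm
    (fun x hx => by rw [hSdef x, Icc_eq_empty (not_le.2 hx)]; simp)
    (fun x0 => ⟨(μp (Icc 0 x0)).toReal + (μm (Icc 0 x0)).toReal, fun x hx => by
      have a1 := wi_mass_mono μp hx
      have a2 := wi_mass_mono μm hx
      have a3 : 0 ≤ (μp (Icc 0 x)).toReal := ENNReal.toReal_nonneg
      have a4 : 0 ≤ (μm (Icc 0 x)).toReal := ENNReal.toReal_nonneg
      simp only at a1 a2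
      rw [hSdef x, abs_le]
      constructor <;> linarith⟩)
    hslow hSint hV
    (fun a b ha hab => hf a b hab (fun h => absurd h.1 (not_le.2 ha)))
    (fun σ hσ => wi_lint _ (hVc σ hσ.1) lam M hlam (hM σ hσ))
  exact ⟨a, by simpa using h1, h2⟩
end

section
/- Let μ be a locally finite signed Borel measure on [0,∞) whose Laplace–Stieltjes transform 𝓛{dS;s} = ∫_{[0,∞)} e^{−sx} dμ(x) converges absolutely for every complex s with Re s > 1, and let S(x) = μ([0,x]) be log-linearly slowly decreasing. Set U(s) = Re 𝓛{dS;s}. Assume U has L¹_loc-boundary behavior on 1 + i(ℝ∖{0}), and assume there exist λ > 0, g ∈ L¹(−λ,λ), k ∈ ℕ and C > 0 such that U(σ+it) ≥ g(t) for a.e. t ∈ (−λ,λ) and all σ ∈ (1,2], and |U(σ+it)| ≤ C(σ−1)^{−k} for all t ∈ (−λ,λ) and σ ∈ (1,2]. Then the limit a = lim_{σ→1⁺} (σ−1) U(σ) exists and S(x) ∼ a e^x as x → ∞, i.e. lim_{x→∞} e^{−x} S(x) = a. -/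
open MeasureTheory Filter Set

open scoped FourierTransform ContDiff in
lemma WI_fourier (w : ℝ → ℝ) (hw : Integrable w) (y : ℝ) :
    𝓕 (fun t => (w t : ℂ)) (-(y / (2 * Real.pi))) =
      ((∫ t, w t * Real.cos (t * y) : ℝ) : ℂ) + ((∫ t, w t * Real.sin (t * y) : ℝ) : ℂ) * Complex.I := by
  have hc : Integrable (fun t => w t * Real.cos (t * y)) := by
    refine hw.mul_bdd (c := 1) (by fun_prop) (Eventually.of_forall fun t => ?_)
    simpa using Real.abs_cos_le_one _
  have hs : Integrable (fun t => w t * Real.sin (t * y)) := by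
    refine hw.mul_bdd (c := 1) (by fun_prop) (Eventually.of_forall fun t => ?_)
    simpa using Real.abs_sin_le_one _
  rw [Real.fourier_real_eq_integral_exp_smul, ← integral_complex_ofReal, ← integral_complex_ofReal,
    ← integral_mul_const, ← integral_add hc.ofReal (hs.ofReal.mul_const _)]
  congr 1
  ext t
  have : (-2 * Real.pi * t * (-(y / (2 * Real.pi)))) = t * y := by
    field_simp
  rw [this, Complex.exp_mul_I, ← Complex.ofReal_cos, ← Complex.ofReal_sin]
  simp only [smul_eq_mul]
  push_cast
  ring

open scoped FourierTransform ContDiff in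
lemma WI_decay (w : ℝ → ℝ) (hw : ContDiff ℝ ∞ w) (hcs : HasCompactSupport w) (N : ℕ) :
    ∃ C : ℝ, 0 ≤ C ∧ ∀ y : ℝ, |∫ t, w t * Real.cos (t * y)| ≤ C / (1 + |y|) ^ N ∧
      |∫ t, w t * Real.sin (t * y)| ≤ C / (1 + |y|) ^ N := by
  have hint : Integrable w := hw.continuous.integrable_of_hasCompactSupport hcs
  have h1 : ContDiff ℝ ∞ (fun t => (w t : ℂ)) := Complex.ofRealCLM.contDiff.comp hw
  have h2 : HasCompactSupport (fun t => (w t : ℂ)) := hcs.comp_left (g := Complex.ofReal) (by simp)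
  set F : SchwartzMap ℝ ℂ := 𝓕 (h2.toSchwartzMap h1) with hF
  obtain ⟨C, hC⟩ : ∃ C, ∀ x : ℝ, (1 + ‖x‖) ^ N * ‖F x‖ ≤ C := by
    refine ⟨2 ^ N * ((Finset.Iic (N, 0)).sup fun m => SchwartzMap.seminorm ℝ m.1 m.2) F, fun x => ?_⟩
    simpa only [norm_iteratedFDeriv_zero] using SchwartzMap.one_add_le_sup_seminorm_apply (𝕜 := ℝ) (m := (N, 0)) (k := N) (n := 0)
      le_rfl le_rfl F x
  have hC0 : 0 ≤ C := le_trans (by positivity) (hC 0)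
  have hpi : (1 : ℝ) ≤ 2 * Real.pi := by linarith [Real.pi_gt_three]
  have key : ∀ y : ℝ, ‖F (-(y / (2 * Real.pi)))‖ ≤ (2 * Real.pi) ^ N * C / (1 + |y|) ^ N := by
    intro y
    have h := hC (-(y / (2 * Real.pi)))
    rw [le_div_iff₀ (by positivity)]
    have h3 : (1 + |y|) ≤ (2 * Real.pi) * (1 + ‖(-(y / (2 * Real.pi)))‖) := by
      rw [norm_neg, Real.norm_eq_abs, abs_div, abs_of_pos (by positivity : 0 < 2 * Real.pi), mul_add,
        mul_div_cancel₀ _ (by positivity)]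
      linarith
    calc _ ≤ ‖F (-(y / (2 * Real.pi)))‖ * ((2 * Real.pi) * (1 + ‖(-(y / (2 * Real.pi)))‖)) ^ N := by
          gcongr
      _ = (2 * Real.pi) ^ N * ((1 + ‖(-(y / (2 * Real.pi)))‖) ^ N * ‖F (-(y / (2 * Real.pi)))‖) := by
          rw [mul_pow]; ring
      _ ≤ _ := by gcongr
  have hFe : ∀ y : ℝ, F (-(y / (2 * Real.pi))) = ((∫ t, w t * Real.cos (t * y) : ℝ) : ℂ)
      + ((∫ t, w t * Real.sin (t * y) : ℝ) : ℂ) * Complex.I := by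
    intro y
    rw [← WI_fourier w hint y]
    rfl
  refine ⟨(2 * Real.pi) ^ N * C, by positivity, fun y => ⟨?_, ?_⟩⟩
  · refine le_trans ?_ (key y)
    rw [hFe]
    refine le_trans (le_of_eq ?_) (Complex.abs_re_le_norm _)
    simp
  · refine le_trans ?_ (key y)
    rw [hFe]
    refine le_trans (le_of_eq ?_) (Complex.abs_im_le_norm _)
    simp

open scoped ContDiff Convolution in
lemma WI_kernel : ∃ k : ℝ → ℝ, ContDiff ℝ ∞ k ∧ HasCompactSupport k ∧
    (∀ y : ℝ, 0 ≤ ∫ t, k t * Real.cos (t * y)) ∧ 0 < ∫ t, k t * Real.cos (t * 0) := by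
  let χ : ContDiffBump (0 : ℝ) := default
  have hχ : ContDiff ℝ ∞ χ := χ.contDiff
  have hcs : HasCompactSupport χ := χ.hasCompactSupport
  have hint : Integrable χ := hχ.continuous.integrable_of_hasCompactSupport hcs
  let k : ℝ → ℝ := (χ : ℝ → ℝ) ⋆[ContinuousLinearMap.mul ℝ ℝ, volume] (χ : ℝ → ℝ)
  have hk : ContDiff ℝ ∞ k := hcs.contDiff_convolution_right _ hint.locallyIntegrable hχ
  have hkc : HasCompactSupport k := hcs.convolution _ hcs
  have hkint : Integrable k := hk.continuous.integrable_of_hasCompactSupport hkc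
  have key : ∀ y : ℝ, ∫ t, k t * Real.cos (t * y) = (∫ t, χ t * Real.cos (t * y)) ^ 2 := by
    intro y
    let e : ℝ → ℂ := fun t => (χ t : ℂ) * Complex.exp ((t * y : ℝ) * Complex.I)
    have hecont : Continuous e := by fun_prop
    have heint : Integrable e := hecont.integrable_of_hasCompactSupport
      ((hcs.comp_left (g := Complex.ofReal) (by simp)).mul_right)
    have h := integral_convolution (μ := volume) (ν := volume) (ContinuousLinearMap.mul ℂ ℂ) heint heint
    have hconv : ∀ x, (e ⋆[ContinuousLinearMap.mul ℂ ℂ, volume] e) x =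
        (k x : ℂ) * Complex.exp ((x * y : ℝ) * Complex.I) := by
      intro x
      simp only [k, convolution_def, ContinuousLinearMap.mul_apply']
      rw [← integral_complex_ofReal, ← integral_mul_const]
      congr 1
      ext t
      simp only [e]
      have : Complex.exp ((x * y : ℝ) * Complex.I) = Complex.exp ((t * y : ℝ) * Complex.I) *
          Complex.exp (((x - t) * y : ℝ) * Complex.I) := by
        rw [← Complex.exp_add]; congr 1; push_cast; ring
      rw [this]; push_cast; ring
    simp only [hconv, ContinuousLinearMap.mul_apply'] at h
    have hre : ∀ (w : ℝ → ℝ), Integrable w →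
        ∫ t, (w t : ℂ) * Complex.exp ((t * y : ℝ) * Complex.I) =
        ((∫ t, w t * Real.cos (t * y) : ℝ) : ℂ)
      + ((∫ t, w t * Real.sin (t * y) : ℝ) : ℂ) * Complex.I := by
      intro w hw
      rw [← WI_fourier w hw y, Real.fourier_real_eq_integral_exp_smul]
      congr 1
      ext t
      have : (-2 * Real.pi * t * (-(y / (2 * Real.pi)))) = t * y := by
        field_simp
      rw [this, smul_eq_mul, mul_comm]
    have hsin : ∫ t, χ t * Real.sin (t * y) = 0 := by
      have h1 := integral_neg_eq_self (fun t => χ t * Real.sin (t * y)) (volume : Measure ℝ)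
      have h2 : ∀ t : ℝ, χ (-t) * Real.sin (-t * y) = - (χ t * Real.sin (t * y)) := by
        intro t
        rw [χ.neg, neg_mul, Real.sin_neg]; ring
      simp only [h2, integral_neg] at h1
      linarith
    simp only [e] at h
    rw [hre k hkint, hre χ hint, hsin] at h
    have := congrArg Complex.re h
    simp only [Complex.add_re, Complex.ofReal_re, Complex.mul_re, Complex.I_re, Complex.I_im,
      Complex.ofReal_im, Complex.add_im, Complex.mul_im] at this
    nlinarith [this]
  refine ⟨k, hk, hkc, fun y => ?_, ?_⟩
  · rw [key]; positivity
  · rw [key]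
    have : 0 < ∫ t, χ t := χ.integral_pos
    simp only [mul_zero, Real.cos_zero, mul_one]
    positivity

lemma WI_measure (μ : Measure ℝ) [IsLocallyFiniteMeasure μ] (hμ : μ (Iio 0) = 0) (s : ℂ)
    (hs : 0 < s.re) (hint : Integrable (fun x : ℝ => Complex.exp (-s * x)) μ) :
    Integrable (fun y : ℝ => Complex.exp (-s * y) * ((μ (Icc 0 y)).toReal : ℂ)) ∧
    s * ∫ y : ℝ, Complex.exp (-s * y) * ((μ (Icc 0 y)).toReal : ℂ) =
      ∫ x : ℝ, Complex.exp (-s * x) ∂μ := by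
  have hs0 : s ≠ 0 := by rintro rfl; simp at hs
  let A : Set (ℝ × ℝ) := {p | 0 ≤ p.1 ∧ p.1 ≤ p.2}
  have hA : MeasurableSet A :=
    (measurableSet_le measurable_const measurable_fst).inter
      (measurableSet_le measurable_fst measurable_snd)
  let H : ℝ × ℝ → ℂ := A.indicator (fun p => Complex.exp (-s * p.2))
  have hHm : AEStronglyMeasurable H (μ.prod volume) := by
    refine AEStronglyMeasurable.indicator ?_ hA
    exact Continuous.aestronglyMeasurable (by fun_prop)
  have hnorm : ∀ y : ℝ, ‖Complex.exp (-s * y)‖ = Real.exp (-s.re * y) := by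
    intro y
    rw [Complex.norm_exp]; simp
  have hsec : ∀ x : ℝ, 0 ≤ x → (fun y => H (x, y)) = (Ici x).indicator (fun y : ℝ => Complex.exp (-s * y)) := by
    intro x hx
    ext y
    simp only [H, A, indicator, mem_ofPred_eq, mem_Ici, hx, true_and]
  have hae : ∀ᵐ x ∂μ, 0 ≤ x := by
    rw [ae_iff]
    convert hμ using 2
    ext x; simp
  have hIexp : ∀ x : ℝ, IntegrableOn (fun y : ℝ => Complex.exp (-s * y)) (Ici x) := by
    intro x
    rw [integrableOn_Ici_iff_integrableOn_Ioi]
    exact integrableOn_exp_mul_complex_Ioi (by simpa using hs) x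
  have hVexp : ∀ x : ℝ, ∫ y in Ici x, Complex.exp (-s * y) = Complex.exp (-s * x) / s := by
    intro x
    rw [integral_Ici_eq_integral_Ioi, integral_exp_mul_complex_Ioi (by simpa using hs) x]
    field_simp
  have hint' : Integrable (fun x : ℝ => Real.exp (-s.re * x)) μ := by
    refine hint.norm.congr (Eventually.of_forall fun x => ?_)
    exact hnorm x
  have hHint : Integrable H (μ.prod volume) := by
    rw [integrable_prod_iff hHm]
    constructor
    · filter_upwards [hae] with x hx
      rw [hsec x hx]
      exact (integrable_indicator_iff measurableSet_Ici).2 (hIexp x)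
    · refine (hint'.div_const s.re).congr ?_
      filter_upwards [hae] with x hx
      have : (fun y => ‖H (x, y)‖) = (Ici x).indicator (fun y : ℝ => Real.exp (-s.re * y)) := by
        ext y
        rw [congrFun (hsec x hx) y, norm_indicator_eq_indicator_norm]
        simp only [hnorm]
      rw [this, integral_indicator measurableSet_Ici, integral_Ici_eq_integral_Ioi,
        integral_exp_mul_Ioi (by linarith) x]
      field_simp
  have hsecy : ∀ y : ℝ, ∫ x, H (x, y) ∂μ = Complex.exp (-s * y) * ((μ (Icc 0 y)).toReal : ℂ) := by
    intro y
    have : (fun x => H (x, y)) = (Icc 0 y).indicator (fun _ : ℝ => Complex.exp (-s * y)) := by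
      ext x
      simp only [H, A, indicator, mem_ofPred_eq, mem_Icc]
    rw [this, integral_indicator measurableSet_Icc, setIntegral_const, Complex.real_smul, mul_comm]
    rfl
  have h1 := hHint.integral_prod_right
  have h2 := integral_integral_swap (f := fun x y => H (x, y)) hHint
  simp only [hsecy] at h1 h2
  refine ⟨h1, ?_⟩
  rw [← h2]
  have : ∫ x, ∫ y, H (x, y) ∂volume ∂μ = ∫ x : ℝ, Complex.exp (-s * x) / s ∂μ := by
    refine integral_congr_ae ?_
    filter_upwards [hae] with x hx
    rw [hsec x hx, integral_indicator measurableSet_Ici, hVexp]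
  rw [this, integral_div]
  field_simp

lemma WI_measure_real (μ : Measure ℝ) [IsLocallyFiniteMeasure μ] (hμ : μ (Iio 0) = 0) (σ t : ℝ)
    (hs : 0 < σ) (hint : Integrable (fun x : ℝ => Complex.exp (-(σ + t * Complex.I) * x)) μ) :
    Integrable (fun y : ℝ => Real.exp (-σ * y) * (μ (Icc 0 y)).toReal) ∧
    ∫ y : ℝ, (Real.exp (-σ * y) * (μ (Icc 0 y)).toReal) * (σ * Real.cos (t * y) + t * Real.sin (t * y)) =
      (∫ x : ℝ, Complex.exp (-(σ + t * Complex.I) * x) ∂μ).re := by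
  obtain ⟨h1, h2⟩ := WI_measure μ hμ (σ + t * Complex.I) (by simpa using hs) hint
  constructor
  · refine h1.norm.congr (Eventually.of_forall fun y => ?_)
    simp only [norm_mul, Complex.norm_exp]
    simp
  · rw [← h2, ← integral_const_mul]
    have := Complex.reCLM.integral_comp_comm (h1.const_mul (σ + t * Complex.I))
    simp only [Complex.reCLM_apply] at this
    rw [← this]
    congr 1
    ext y
    have : Complex.exp (-(σ + t * Complex.I) * y) = (Real.exp (-σ * y) : ℂ) *
        (Real.cos (t * y) - Real.sin (t * y) * Complex.I) := by
      have : (-(σ + t * Complex.I) * y) = ((-σ * y : ℝ) : ℂ) + ((-(t * y) : ℝ) : ℂ) * Complex.I := by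
        push_cast; ring
      rw [this, Complex.exp_add, Complex.exp_mul_I, ← Complex.ofReal_exp, ← Complex.ofReal_cos,
        ← Complex.ofReal_sin, Real.cos_neg, Real.sin_neg]
      push_cast; ring
    rw [this]
    generalize Real.cos (t * y) = c
    generalize Real.sin (t * y) = d
    generalize Real.exp (-σ * y) = e
    simp
    ring

lemma WI_slow (S : ℝ → ℝ) (hslow : LogLinSlowlyDecreasing S) (ε : ℝ) (hε : 0 < ε) :
    ∃ h : ℝ, 0 < h ∧ ∃ x₀ : ℝ, 0 < x₀ ∧ ∀ x y : ℝ,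
    x₀ ≤ x → x ≤ y → y ≤ x + h → S x - ε * Real.exp x ≤ S y := by
  obtain ⟨h, hh, x₀, hx₀, H⟩ := hslow ε hε
  refine ⟨h, hh, x₀, hx₀, fun x y h1 h2 h3 => ?_⟩
  have := H x y h1 h2 h3
  rw [ge_iff_le, le_div_iff₀ (Real.exp_pos x)] at this
  linarith

lemma WI_lower (S : ℝ → ℝ) (hslow : LogLinSlowlyDecreasing S) (hS0 : ∀ x < 0, S x = 0)
    (hloc : ∀ R : ℝ, ∃ B : ℝ, ∀ x ≤ R, |S x| ≤ B) :
    ∃ A : ℝ, 0 ≤ A ∧ ∀ y : ℝ, -(A * Real.exp y) ≤ S y := by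
  obtain ⟨h, hh, x₀, hx₀, H⟩ := WI_slow S hslow 1 one_pos
  obtain ⟨B, hB⟩ := hloc (x₀ + h)
  have hB0 : 0 ≤ B := (abs_nonneg _).trans (hB x₀ (by linarith))
  have he1 : Real.exp (-h) < 1 := by simpa using hh
  have he0 := Real.exp_pos (-h)
  set A := B + 1 / (1 - Real.exp (-h)) with hA
  have h1e : 0 < 1 - Real.exp (-h) := by linarith
  have hA0 : 0 ≤ A := by positivity
  have hA1 : (A + 1) * Real.exp (-h) ≤ A := by
    have : 1 ≤ A * (1 - Real.exp (-h)) := by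
      rw [hA, add_mul, div_mul_cancel₀ _ h1e.ne']
      nlinarith [mul_nonneg hB0 h1e.le]
    nlinarith
  have hAB : B ≤ A := by rw [hA]; have : 0 < 1 / (1 - Real.exp (-h)) := by positivity
                         linarith
  have base : ∀ y ≤ x₀ + h, -(A * Real.exp y) ≤ S y := by
    intro y hy
    rcases lt_or_ge y 0 with hy0 | hy0
    · rw [hS0 y hy0]
      have := Real.exp_pos y
      have : 0 ≤ A * Real.exp y := by positivity
      linarith
    · have h1 := hB y hy
      have h2 : 1 ≤ Real.exp y := Real.one_le_exp hy0
      have h3 := neg_abs_le (S y)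
      nlinarith
  refine ⟨A, hA0, ?_⟩
  have ind : ∀ n : ℕ, ∀ y ≤ x₀ + h + n * h, -(A * Real.exp y) ≤ S y := by
    intro n
    induction n with
    | zero => intro y hy; exact base y (by simpa using hy)
    | succ n ih =>
      intro y hy
      push_cast at hy
      rcases le_or_gt y (x₀ + h) with hy1 | hy1
      · exact base y hy1
      · have h1 := ih (y - h) (by linarith)
        have h2 := H (y - h) y (by linarith) (by linarith) (by linarith)
        have h3 : Real.exp (y - h) = Real.exp y * Real.exp (-h) := by
          rw [← Real.exp_add]; congr 1
        have h4 := Real.exp_pos y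
        rw [h3] at h1 h2
        nlinarith
  intro y
  obtain ⟨n, hn⟩ := exists_nat_ge ((y - x₀ - h) / h)
  refine ind n y ?_
  rw [div_le_iff₀ hh] at hn
  linarith

lemma WI_upper (S : ℝ → ℝ) (hslow : LogLinSlowlyDecreasing S) (hS0 : ∀ x < 0, S x = 0)
    (hloc : ∀ R : ℝ, ∃ B : ℝ, ∀ x ≤ R, |S x| ≤ B)
    (hint : ∀ σ : ℝ, 1 < σ → Integrable (fun x => Real.exp (-σ * x) * S x))
    (C : ℝ) (k : ℕ) (hC : 0 < C)
    (hgrow : ∀ σ ∈ Ioc (1:ℝ) 2, ∫ x, Real.exp (-σ * x) * S x ≤ C / (σ - 1) ^ k) :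
    ∃ D : ℝ, 0 ≤ D ∧ ∃ m : ℕ, ∀ x : ℝ, |Real.exp (-x) * S x| ≤ D * (1 + |x|) ^ m := by
  obtain ⟨A, hA0, hA⟩ := WI_lower S hslow hS0 hloc
  obtain ⟨h, hh, x₀, hx₀, H⟩ := WI_slow S hslow 1 one_pos
  have up : ∀ x, x₀ ≤ x → 1 ≤ x → Real.exp (-x) * S x ≤
      1 + Real.exp (1 + 2 * h) / h * (C * x ^ k + A * x) := by
    intro x hx hx1
    have hx0 : 0 < x := by linarith
    rcases le_or_gt (S x) (Real.exp x) with hle | hgt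
    · have : Real.exp (-x) * S x ≤ 1 := by
        rw [Real.exp_neg, inv_mul_le_iff₀ (Real.exp_pos x)]; linarith
      have : 0 ≤ Real.exp (1 + 2 * h) / h * (C * x ^ k + A * x) := by positivity
      linarith
    · set σ := 1 + 1 / x with hσ
      have hinv : 1 / x ≤ 1 := by rw [div_le_one hx0]; exact hx1
      have hinv0 : 0 < 1 / x := by positivity
      have hσ1 : 1 < σ := by linarith
      have hg := hgrow σ ⟨hσ1, by linarith⟩
      have hσx : σ - 1 = 1 / x := by rw [hσ]; ring
      rw [hσx] at hg
      have e1 : ∫ y in Ici (0:ℝ), Real.exp (-σ * y) * S y = ∫ x, Real.exp (-σ * x) * S x := by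
        apply setIntegral_eq_integral_of_forall_compl_eq_zero
        intro y hy
        rw [hS0 y (by simpa using hy), mul_zero]
      have i2 : IntegrableOn (fun y : ℝ => Real.exp (-σ * y) * (A * Real.exp y)) (Ici 0) := by
        have : (fun y : ℝ => Real.exp (-σ * y) * (A * Real.exp y)) =
            fun y => A * Real.exp ((-(1 / x)) * y) := by
          ext y
          rw [mul_left_comm, ← Real.exp_add, hσ]; congr 2; ring
        rw [this, integrableOn_Ici_iff_integrableOn_Ioi]
        exact (integrableOn_exp_mul_Ioi (by linarith) 0).const_mul A
      have e2 : ∫ y in Ici (0:ℝ), Real.exp (-σ * y) * (A * Real.exp y) = A * x := by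
        have : (fun y : ℝ => Real.exp (-σ * y) * (A * Real.exp y)) =
            fun y => A * Real.exp ((-(1 / x)) * y) := by
          ext y
          rw [mul_left_comm, ← Real.exp_add, hσ]; congr 2; ring
        rw [this, integral_Ici_eq_integral_Ioi, integral_const_mul,
          integral_exp_mul_Ioi (by linarith) 0]
        simp
      have i1 : IntegrableOn (fun y : ℝ => Real.exp (-σ * y) * S y) (Ici 0) := (hint σ hσ1).integrableOn
      have i3 : IntegrableOn (fun y : ℝ => Real.exp (-σ * y) * (S y + A * Real.exp y)) (Ici 0) := by
        refine (i1.add i2).congr_fun (fun y _ => ?_) measurableSet_Ici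
        simp only [Pi.add_apply]; ring
      have e3 : ∫ y in Ici (0:ℝ), Real.exp (-σ * y) * (S y + A * Real.exp y) ≤ C * x ^ k + A * x := by
        have : ∫ y in Ici (0:ℝ), Real.exp (-σ * y) * (S y + A * Real.exp y) =
          (∫ y in Ici (0:ℝ), Real.exp (-σ * y) * S y) +
            ∫ y in Ici (0:ℝ), Real.exp (-σ * y) * (A * Real.exp y) := by
          rw [← integral_add i1 i2]
          congr 1; ext y; ring
        rw [this, e1, e2]
        have : C / (1 / x) ^ k = C * x ^ k := by
          rw [one_div, inv_pow, div_inv_eq_mul]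
        linarith
      have e4 : ∫ y in Icc x (x + h), Real.exp (-σ * y) * (S y + A * Real.exp y) ≤
          ∫ y in Ici (0:ℝ), Real.exp (-σ * y) * (S y + A * Real.exp y) := by
        refine setIntegral_mono_set i3 ?_ ?_
        · refine Eventually.of_forall fun y => ?_
          have := hA y
          have h2 : 0 ≤ S y + A * Real.exp y := by linarith
          exact mul_nonneg (Real.exp_pos _).le h2
        · exact (show Icc x (x + h) ⊆ Ici 0 from fun y hy => hx0.le.trans hy.1).eventuallyLE
      have e5 : ∫ y in Icc x (x + h), Real.exp (-σ * (x + h)) * (S x - Real.exp x) ≤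
          ∫ y in Icc x (x + h), Real.exp (-σ * y) * (S y + A * Real.exp y) := by
        refine setIntegral_mono_on ?_ (i3.mono_set (fun y hy => hx0.le.trans hy.1)) measurableSet_Icc ?_
        · exact integrableOn_const (by simp)
        · intro y hy
          have h1 := H x y hx hy.1 hy.2
          have h2 : 0 ≤ A * Real.exp y := by positivity
          have h3 : -σ * (x + h) ≤ -σ * y := by nlinarith [hy.2]
          have h4 : S x - Real.exp x ≤ S y + A * Real.exp y := by linarith
          have h5 : 0 ≤ S x - Real.exp x := by linarith
          gcongr
      rw [setIntegral_const] at e5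
      simp only [Measure.real, Real.volume_Icc, smul_eq_mul] at e5
      rw [show x + h - x = h by ring, ENNReal.toReal_ofReal hh.le] at e5
      have e6 : h * (Real.exp (-σ * (x + h)) * (S x - Real.exp x)) ≤ C * x ^ k + A * x := by linarith
      have e7 : Real.exp (-(1 + 2 * h)) * Real.exp (-x) ≤ Real.exp (-σ * (x + h)) := by
        rw [← Real.exp_add]
        apply Real.exp_le_exp.2
        have : σ * (x + h) = x + h + 1 + h / x := by rw [hσ]; field_simp; ring
        have : h / x ≤ h := div_le_self hh.le hx1
        linarith
      have e8 : h * ((Real.exp (-(1 + 2 * h)) * Real.exp (-x)) * (S x - Real.exp x)) ≤ C * x ^ k + A * x := by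
        refine le_trans ?_ e6
        have : 0 ≤ S x - Real.exp x := by linarith
        gcongr
      have e9 : Real.exp (-x) * Real.exp x = 1 := by rw [← Real.exp_add]; simp
      have e10 : Real.exp (-(1 + 2 * h)) * Real.exp (1 + 2 * h) = 1 := by rw [← Real.exp_add]; simp
      have e11 : Real.exp (1 + 2 * h) / h * (h * ((Real.exp (-(1 + 2 * h)) * Real.exp (-x)) * (S x - Real.exp x)))
          = Real.exp (-x) * S x - 1 := by
        calc _ = (Real.exp (-(1 + 2 * h)) * Real.exp (1 + 2 * h)) * (Real.exp (-x) * S x - Real.exp (-x) * Real.exp x) := by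
              field_simp
          _ = _ := by rw [e10, e9]; ring
      have e12 : Real.exp (1 + 2 * h) / h * (h * ((Real.exp (-(1 + 2 * h)) * Real.exp (-x)) * (S x - Real.exp x)))
          ≤ Real.exp (1 + 2 * h) / h * (C * x ^ k + A * x) := by gcongr
      linarith
  obtain ⟨B, hB⟩ := hloc (max x₀ 1)
  have hB0 : 0 ≤ B := (abs_nonneg _).trans (hB 1 (le_max_right _ _))
  have hlowτ : ∀ x, -A ≤ Real.exp (-x) * S x := by
    intro x
    have h1 := hA x
    have e9 : Real.exp (-x) * Real.exp x = 1 := by rw [← Real.exp_add]; simp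
    have := mul_le_mul_of_nonneg_left h1 (Real.exp_pos (-x)).le
    nlinarith
  set E := Real.exp (1 + 2 * h) / h with hE
  have hE0 : 0 ≤ E := by positivity
  refine ⟨A + B + 1 + E * (C + A), by positivity, k + 1, fun x => ?_⟩
  have hone : 1 ≤ (1 + |x|) ^ (k + 1) := one_le_pow₀ (by linarith [abs_nonneg x])
  have hD : 0 ≤ E * (C + A) := by positivity
  rw [abs_le]
  constructor
  · have := hlowτ x
    have h2 : A ≤ (A + B + 1 + E * (C + A)) * (1 + |x|) ^ (k + 1) := by nlinarith
    linarith
  · rcases le_or_gt x (max x₀ 1) with hx | hx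
    · rcases lt_or_ge x 0 with h0 | h0
      · rw [hS0 x h0, mul_zero]; positivity
      · have h1 : Real.exp (-x) * S x ≤ B := by
          have := (le_abs_self _).trans (hB x hx)
          have h3 : Real.exp (-x) ≤ 1 := by simpa using h0
          have := Real.exp_pos (-x)
          nlinarith
        nlinarith
    · have hx1 : 1 ≤ x := (le_max_right _ _).trans hx.le
      have h1 := up x ((le_max_left _ _).trans hx.le) hx1
      have hax : |x| = x := abs_of_nonneg (by linarith)
      rw [hax] at hone ⊢
      have h2 : x ^ k ≤ (1 + x) ^ (k + 1) :=
        (pow_le_pow_left₀ (by linarith) (by linarith) k).trans (pow_le_pow_right₀ (by linarith) (by omega))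
      have h3 : x ≤ (1 + x) ^ (k + 1) := by
        calc x ≤ (1 + x) ^ 1 := by linarith
          _ ≤ _ := pow_le_pow_right₀ (by linarith) (by omega)
      have h4 : E * (C * x ^ k + A * x) ≤ E * (C + A) * (1 + x) ^ (k + 1) := by
        rw [mul_assoc, add_mul]
        gcongr
      nlinarith

lemma WI_int2 : Integrable (fun x : ℝ => 1 / (1 + |x|) ^ 2) := by
  have h := integrable_one_add_norm (E := ℝ) (μ := volume) (r := 2) (by norm_num)
  refine h.congr (Eventually.of_forall fun x => ?_)
  simp only
  rw [Real.rpow_neg (by positivity), one_div, Real.norm_eq_abs]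
  norm_num

lemma WI_cont_cos (w : ℝ → ℝ) (hw : Integrable w) :
    Continuous (fun y : ℝ => ∫ t, w t * Real.cos (t * y)) := by
  refine continuous_of_dominated (bound := fun t => |w t|) (fun y => ?_) (fun y => ?_) hw.abs ?_
  · exact hw.aestronglyMeasurable.mul (by fun_prop)
  · refine Eventually.of_forall fun t => ?_
    rw [norm_mul]
    exact mul_le_of_le_one_right (norm_nonneg _) (Real.abs_cos_le_one _)
  · exact Eventually.of_forall fun t => by fun_prop

lemma WI_cont_sin (w : ℝ → ℝ) (hw : Integrable w) :
    Continuous (fun y : ℝ => ∫ t, w t * Real.sin (t * y)) := by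
  refine continuous_of_dominated (bound := fun t => |w t|) (fun y => ?_) (fun y => ?_) hw.abs ?_
  · exact hw.aestronglyMeasurable.mul (by fun_prop)
  · refine Eventually.of_forall fun t => ?_
    rw [norm_mul]
    exact mul_le_of_le_one_right (norm_nonneg _) (Real.abs_sin_le_one _)
  · exact Eventually.of_forall fun t => by fun_prop

/-- The real part of the transform, written through `S`. -/
noncomputable def WIV (S : ℝ → ℝ) (σ t : ℝ) : ℝ :=
  ∫ y, (Real.exp (-σ * y) * S y) * (σ * Real.cos (t * y) + t * Real.sin (t * y))

lemma WIV_cont (S : ℝ → ℝ) (σ : ℝ) (hint : Integrable (fun x => Real.exp (-σ * x) * S x)) :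
    Continuous (WIV S σ) := by
  have h1 := (WI_cont_cos _ hint).const_mul σ
  have h2 := continuous_id.mul (WI_cont_sin _ hint)
  refine (h1.add h2).congr fun t => ?_
  have ic : Integrable (fun y => (Real.exp (-σ * y) * S y) * Real.cos (y * t)) := by
    refine hint.mul_bdd (c := 1) (by fun_prop) (Eventually.of_forall fun t => ?_)
    simpa using Real.abs_cos_le_one _
  have is : Integrable (fun y => (Real.exp (-σ * y) * S y) * Real.sin (y * t)) := by
    refine hint.mul_bdd (c := 1) (by fun_prop) (Eventually.of_forall fun t => ?_)
    simpa using Real.abs_sin_le_one _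
  simp only [id, WIV, Pi.add_apply, Pi.mul_apply]
  rw [← integral_const_mul, ← integral_const_mul, ← integral_add (ic.const_mul σ) (is.const_mul t)]
  congr 1
  ext y
  rw [mul_comm t y]; ring

open scoped ContDiff in
lemma WI_test (S : ℝ → ℝ) (hSm : Measurable S) (hS0 : ∀ x < 0, S x = 0)
    (hint : ∀ σ : ℝ, 1 < σ → Integrable (fun x => Real.exp (-σ * x) * S x))
    (D : ℝ) (hD : 0 ≤ D) (m : ℕ) (hτ : ∀ x : ℝ, |Real.exp (-x) * S x| ≤ D * (1 + |x|) ^ m)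
    (φ : ℝ → ℝ) (hφ : ContDiff ℝ ∞ φ) (hcs : HasCompactSupport φ) :
    Tendsto (fun σ => ∫ t, WIV S σ t * φ t) (nhdsWithin 1 (Ioi 1))
      (nhds (∫ x, (Real.exp (-x) * S x) *
        ((∫ t, φ t * Real.cos (t * x)) + ∫ t, (t * φ t) * Real.sin (t * x)))) := by
  have hφ2 : ContDiff ℝ ∞ (fun t => t * φ t) := contDiff_id.mul hφ
  have hcs2 : HasCompactSupport (fun t => t * φ t) := hcs.mul_left
  have i1 : Integrable φ := hφ.continuous.integrable_of_hasCompactSupport hcs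
  have i2 : Integrable (fun t => t * φ t) := hφ2.continuous.integrable_of_hasCompactSupport hcs2
  obtain ⟨C1, hC1, H1⟩ := WI_decay φ hφ hcs (m + 2)
  obtain ⟨C2, hC2, H2⟩ := WI_decay _ hφ2 hcs2 (m + 2)
  set A : ℝ → ℝ := fun x => ∫ t, φ t * Real.cos (t * x) with hA
  set B : ℝ → ℝ := fun x => ∫ t, (t * φ t) * Real.sin (t * x) with hB
  have hAc : Continuous A := WI_cont_cos _ i1
  have hBc : Continuous B := WI_cont_sin _ i2
  have fub : ∀ σ : ℝ, 1 < σ → ∫ t, WIV S σ t * φ t =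
      ∫ x, (Real.exp (-σ * x) * S x) * (σ * A x + B x) := by
    intro σ hσ
    have hi := hint σ hσ
    have hp : Integrable (fun p : ℝ × ℝ => (Real.exp (-σ * p.2) * S p.2) *
        (σ * Real.cos (p.1 * p.2) + p.1 * Real.sin (p.1 * p.2)) * φ p.1) (volume.prod volume) := by
      have g1 := (i1.const_mul σ).mul_prod hi
      have g2 := i2.mul_prod hi
      have g1' := g1.mul_bdd (c := 1) (g := fun p : ℝ × ℝ => Real.cos (p.1 * p.2))
        (by fun_prop) (Eventually.of_forall fun t => by simpa using Real.abs_cos_le_one _)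
      have g2' := g2.mul_bdd (c := 1) (g := fun p : ℝ × ℝ => Real.sin (p.1 * p.2))
        (by fun_prop) (Eventually.of_forall fun t => by simpa using Real.abs_sin_le_one _)
      refine (g1'.add g2').congr (Eventually.of_forall fun p => ?_)
      simp only [Pi.add_apply]; ring
    have sw := integral_integral_swap (f := fun t y => (Real.exp (-σ * y) * S y) *
        (σ * Real.cos (t * y) + t * Real.sin (t * y)) * φ t) hp
    simp only [WIV, ← integral_mul_const]
    rw [sw]
    congr 1
    ext x
    have ic : Integrable (fun t => φ t * Real.cos (t * x)) := by
      refine i1.mul_bdd (c := 1) (by fun_prop) (Eventually.of_forall fun t => ?_)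
      simpa using Real.abs_cos_le_one _
    have is : Integrable (fun t => t * φ t * Real.sin (t * x)) := by
      refine i2.mul_bdd (c := 1) (by fun_prop) (Eventually.of_forall fun t => ?_)
      simpa using Real.abs_sin_le_one _
    simp only [hA, hB]
    rw [← integral_const_mul, ← integral_add (ic.const_mul σ) is, ← integral_const_mul]
    congr 1
    ext t
    ring
  have main : Tendsto (fun σ => ∫ x, (Real.exp (-σ * x) * S x) * (σ * A x + B x))
      (nhdsWithin 1 (Ioi 1)) (nhds (∫ x, (Real.exp (-x) * S x) * (A x + B x))) := by
    refine tendsto_integral_filter_of_dominated_convergence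
      (fun x => D * (2 * C1 + C2) * (1 / (1 + |x|) ^ 2)) ?_ ?_ (WI_int2.const_mul _) ?_
    · refine Eventually.of_forall fun σ => ?_
      have : Measurable (fun x => (Real.exp (-σ * x) * S x) * (σ * A x + B x)) := by
        have := hAc.measurable
        have := hBc.measurable
        fun_prop
      exact this.aestronglyMeasurable
    · have : ∀ᶠ σ : ℝ in nhdsWithin 1 (Ioi 1), σ ∈ Ioo (1:ℝ) 2 := Ioo_mem_nhdsGT (by norm_num)
      filter_upwards [this] with σ hσ
      refine Eventually.of_forall fun x => ?_
      rcases lt_or_ge x 0 with h0 | h0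
      · rw [hS0 x h0]; simp; positivity
      rw [norm_mul]
      have b1 : ‖Real.exp (-σ * x) * S x‖ ≤ D * (1 + |x|) ^ m := by
        refine le_trans ?_ (hτ x)
        rw [Real.norm_eq_abs, abs_mul, abs_mul, Real.abs_exp, Real.abs_exp]
        have : Real.exp (-σ * x) ≤ Real.exp (-x) := Real.exp_le_exp.2 (by nlinarith [hσ.1])
        gcongr
      have b2 : ‖σ * A x + B x‖ ≤ (2 * C1 + C2) / (1 + |x|) ^ (m + 2) := by
        have q1 := (H1 x).1
        have q2 := (H2 x).2
        calc ‖σ * A x + B x‖ ≤ |σ * A x| + |B x| := abs_add_le _ _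
          _ ≤ 2 * (C1 / (1 + |x|) ^ (m + 2)) + C2 / (1 + |x|) ^ (m + 2) := by
              rw [abs_mul]
              have : |σ| ≤ 2 := by rw [abs_of_pos (by linarith [hσ.1])]; exact hσ.2.le
              gcongr
          _ = _ := by ring
      calc _ ≤ (D * (1 + |x|) ^ m) * ((2 * C1 + C2) / (1 + |x|) ^ (m + 2)) := by gcongr
        _ = _ := by
          have : 0 < 1 + |x| := by positivity
          rw [pow_add]
          field_simp
    · refine Eventually.of_forall fun x => ?_
      have : Continuous (fun σ : ℝ => (Real.exp (-σ * x) * S x) * (σ * A x + B x)) := by fun_prop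
      have := this.tendsto 1
      simp only [one_mul, neg_mul] at this ⊢
      exact this.mono_left nhdsWithin_le_nhds
  refine main.congr' ?_
  filter_upwards [self_mem_nhdsWithin] with σ hσ
  exact (fub σ hσ).symm

lemma WI_boundary (V : ℝ → ℝ → ℝ) (hV : ∀ σ, 1 < σ → Continuous (V σ)) (f : ℝ → ℝ)
    (hf : ∀ a b : ℝ, a ≤ b → (0 : ℝ) ∉ Icc a b → IntegrableOn f (Icc a b) ∧
      Tendsto (fun σ : ℝ => ∫ t in a..b, |V σ t - f t|) (nhdsWithin 1 (Ioi 1)) (nhds 0))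
    (lam : ℝ) (g : ℝ → ℝ) (hg : IntegrableOn g (Ioo (-lam) lam))
    (hlow : ∀ σ ∈ Ioc (1 : ℝ) 2, ∀ᵐ t ∂(volume.restrict (Ioo (-lam) lam)), g t ≤ V σ t)
    (r : ℝ) (hr : 0 < r) (hrl : r < lam) (χ : ℝ → ℝ) (hχ : Continuous χ) (hχ0 : ∀ t, 0 ≤ χ t)
    (hχ1 : ∀ t, χ t ≤ 1) (hχr : ∀ t ∈ Icc (-r) r, χ t = 1) (hχl : ∀ t, t ∉ Ioo (-lam) lam → χ t = 0)
    (u : ℝ) (hu : Tendsto (fun σ => ∫ t, V σ t * χ t) (nhdsWithin 1 (Ioi 1)) (nhds u)) :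
    (∀ R, IntegrableOn f (Icc (-R) R)) ∧ ∃ c : ℝ, ∀ φ : ℝ → ℝ, Continuous φ → HasCompactSupport φ →
      Tendsto (fun σ => ∫ t, V σ t * φ t) (nhdsWithin 1 (Ioi 1))
        (nhds ((∫ t, f t * φ t) + c * φ 0)) := by
  have hχc : HasCompactSupport χ := by
    refine HasCompactSupport.intro (isCompact_Icc (a := -lam) (b := lam)) fun t ht => hχl t ?_
    exact fun h => ht (Ioo_subset_Icc_self h)
  have hev2 : ∀ᶠ σ : ℝ in nhdsWithin 1 (Ioi 1), σ ∈ Ioo (1:ℝ) 2 := Ioo_mem_nhdsGT (by norm_num)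
  obtain ⟨B, hB0, hB⟩ : ∃ B : ℝ, 0 ≤ B ∧ ∀ᶠ σ : ℝ in nhdsWithin 1 (Ioi 1),
      ∫ t in Icc (-r) r, |V σ t| ≤ B := by
    refine ⟨|u| + 1 + 2 * ∫ t in Ioo (-lam) lam, |g t|, ?_, ?_⟩
    · have : 0 ≤ ∫ t in Ioo (-lam) lam, |g t| := integral_nonneg fun t => abs_nonneg _
      positivity
    · have hlt : ∀ᶠ σ : ℝ in nhdsWithin 1 (Ioi 1), ∫ t, V σ t * χ t < |u| + 1 :=
        hu.eventually_lt_const (by linarith [le_abs_self u])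
      filter_upwards [hev2, hlt] with σ hσ hσu
      have hVc := hV σ hσ.1
      have j1 : Integrable (fun t => |V σ t| * χ t) :=
        (hVc.abs.mul hχ).integrable_of_hasCompactSupport hχc.mul_left
      have j2 : Integrable (fun t => V σ t * χ t) :=
        (hVc.mul hχ).integrable_of_hasCompactSupport hχc.mul_left
      have s1 : ∫ t in Icc (-r) r, |V σ t| = ∫ t in Icc (-r) r, |V σ t| * χ t := by
        refine setIntegral_congr_fun measurableSet_Icc fun t ht => ?_
        simp only [hχr t ht, mul_one]
      have s2 : ∫ t in Icc (-r) r, |V σ t| * χ t ≤ ∫ t in Ioo (-lam) lam, |V σ t| * χ t := by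
        refine setIntegral_mono_set j1.integrableOn ?_ ?_
        · exact Eventually.of_forall fun t => mul_nonneg (abs_nonneg _) (hχ0 t)
        · exact (show Icc (-r) r ⊆ Ioo (-lam) lam from
            fun y hy => ⟨by linarith [hy.1], by linarith [hy.2]⟩).eventuallyLE
      have s3 : ∫ t in Ioo (-lam) lam, |V σ t| * χ t ≤
          ∫ t in Ioo (-lam) lam, (V σ t * χ t + 2 * |g t|) := by
        refine integral_mono_ae j1.integrableOn (j2.integrableOn.add (hg.abs.const_mul 2)) ?_
        filter_upwards [hlow σ ⟨hσ.1, hσ.2.le⟩] with t ht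
        have a1 := hχ0 t
        have a2 := hχ1 t
        have a3 := neg_abs_le (g t)
        have a4 := abs_nonneg (g t)
        rcases abs_cases (V σ t) with ⟨h1, h2⟩ | ⟨h1, h2⟩
        · rw [h1]; linarith
        · rw [h1]; nlinarith
      have s4 : ∫ t in Ioo (-lam) lam, (V σ t * χ t + 2 * |g t|) =
          (∫ t, V σ t * χ t) + 2 * ∫ t in Ioo (-lam) lam, |g t| := by
        rw [integral_add j2.integrableOn (hg.abs.const_mul 2), integral_const_mul]
        congr 1
        apply setIntegral_eq_integral_of_forall_compl_eq_zero
        intro t ht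
        rw [hχl t ht, mul_zero]
      linarith
  have hfb : ∀ a b : ℝ, a ≤ b → (0:ℝ) ∉ Icc a b → Icc a b ⊆ Icc (-r) r →
      ∫ t in Ioc a b, ‖f t‖ ≤ B + 1 := by
    intro a b hab h0 hsub
    obtain ⟨hfi, hft⟩ := hf a b hab h0
    obtain ⟨σ, h1, h2, h3⟩ := (hev2.and (hB.and (hft.eventually_lt_const one_pos))).exists
    have hVc := hV σ h1.1
    have k0 : IntegrableOn f (Ioc a b) := hfi.mono_set Ioc_subset_Icc_self
    have k1 : IntegrableOn (V σ) (Ioc a b) := hVc.integrableOn_Ioc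
    have ksub : IntegrableOn (fun t => |V σ t - f t|) (Ioc a b) := (k1.sub k0).abs
    have k2 : ∫ t in Ioc a b, ‖f t‖ ≤ ∫ t in Ioc a b, (|V σ t| + |V σ t - f t|) := by
      refine integral_mono k0.norm (k1.abs.add (k1.sub k0).abs) fun t => ?_
      simp only [Real.norm_eq_abs]
      have := abs_sub_abs_le_abs_sub (f t) (V σ t)
      rw [abs_sub_comm] at this
      linarith
    rw [integral_add k1.abs ksub] at k2
    rw [intervalIntegral.integral_of_le hab] at h3
    have k3 : ∫ t in Ioc a b, |V σ t| ≤ ∫ t in Icc (-r) r, |V σ t| := by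
      refine setIntegral_mono_set hVc.abs.integrableOn_Icc ?_ ?_
      · exact Eventually.of_forall fun t => abs_nonneg _
      · exact (Ioc_subset_Icc_self.trans hsub).eventuallyLE
    linarith
  have hseq : Tendsto (fun n : ℕ => r / ((n:ℝ) + 1)) atTop (nhds 0) := by
    have := (tendsto_one_div_add_atTop_nhds_zero_nat (𝕜 := ℝ)).const_mul r
    simpa [div_eq_mul_inv] using this
  have hseq1 : ∀ n : ℕ, r / ((n:ℝ) + 1) ≤ r := fun n =>
    div_le_self hr.le (by linarith [n.cast_nonneg (α := ℝ)])
  have hseq0 : ∀ n : ℕ, 0 < r / ((n:ℝ) + 1) := fun n => by positivity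
  have fpos : IntegrableOn f (Ioc 0 r) := by
    refine integrableOn_Ioc_of_intervalIntegral_norm_bounded_left (I := B + 1) (l := atTop)
      (a := fun n : ℕ => r / ((n:ℝ) + 1)) (fun n => ?_) hseq (Eventually.of_forall fun n => ?_)
    · refine (hf _ _ (hseq1 n) ?_).1.mono_set Ioc_subset_Icc_self
      exact fun h => absurd h.1 (not_le.2 (hseq0 n))
    · refine hfb _ _ (hseq1 n) (fun h => absurd h.1 (not_le.2 (hseq0 n))) ?_
      exact Icc_subset_Icc (by linarith [hseq0 n]) le_rfl
  have fneg : IntegrableOn f (Ioc (-r) 0) := by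
    refine integrableOn_Ioc_of_intervalIntegral_norm_bounded_right (I := B + 1) (l := atTop)
      (b := fun n : ℕ => -(r / ((n:ℝ) + 1))) (fun n => ?_) (by simpa using hseq.neg)
      (Eventually.of_forall fun n => ?_)
    · refine (hf _ _ (neg_le_neg (hseq1 n)) ?_).1.mono_set Ioc_subset_Icc_self
      exact fun h => absurd h.2 (not_le.2 (by linarith [hseq0 n]))
    · refine hfb _ _ (neg_le_neg (hseq1 n)) (fun h => absurd h.2 (not_le.2 (by linarith [hseq0 n]))) ?_
      exact Icc_subset_Icc le_rfl (by linarith [hseq0 n])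
  have fmid : IntegrableOn f (Icc (-r) r) := by
    rw [integrableOn_Icc_iff_integrableOn_Ioc, ← Ioc_union_Ioc_eq_Ioc (b := 0) (by linarith) hr.le]
    exact fneg.union fpos
  have fall : ∀ R, IntegrableOn f (Icc (-R) R) := by
    intro R
    rcases le_or_gt R r with h | h
    · exact fmid.mono_set (Icc_subset_Icc (by linarith) h)
    · have q1 := (hf r R h.le (fun h => absurd h.1 (not_le.2 hr))).1
      have q2 := (hf (-R) (-r) (by linarith) (fun h => absurd h.2 (not_le.2 (by linarith)))).1
      rw [← Icc_union_Icc_eq_Icc (a := -R) (b := r) (c := R) (by linarith) h.le,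
        ← Icc_union_Icc_eq_Icc (a := -R) (b := -r) (c := r) (by linarith) (by linarith)]
      exact (q2.union fmid).union q1
  refine ⟨fall, u - ∫ t, f t * χ t, ?_⟩
  set F := ∫ t in Icc (-r) r, |f t| with hF
  have hF0 : 0 ≤ F := integral_nonneg fun t => abs_nonneg _
  -- products with compactly supported continuous functions
  have fprod : ∀ φ : ℝ → ℝ, Continuous φ → HasCompactSupport φ → Integrable (fun t => f t * φ t) := by
    intro φ hφ hφc
    obtain ⟨R, hR⟩ := hφc.isCompact.isBounded.subset_closedBall 0
    rw [Real.closedBall_eq_Icc, zero_sub, zero_add] at hR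
    obtain ⟨M, hM⟩ := hφ.bounded_above_of_compact_support hφc
    have : IntegrableOn (fun t => f t * φ t) (Icc (-R) R) :=
      (fall R).mul_bdd (c := M) hφ.aestronglyMeasurable (Eventually.of_forall hM)
    refine (integrableOn_iff_integrable_of_support_subset ?_).1 this
    intro t ht
    refine hR (subset_tsupport _ ?_)
    intro h0
    exact ht (by simp [h0])
  have key : ∀ φ : ℝ → ℝ, Continuous φ → HasCompactSupport φ → φ 0 = 0 →
      Tendsto (fun σ => ∫ t, V σ t * φ t) (nhdsWithin 1 (Ioi 1)) (nhds (∫ t, f t * φ t)) := by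
    intro φ hφ hφc hφ0
    obtain ⟨R', hR'⟩ := hφc.isCompact.isBounded.subset_closedBall 0
    rw [Real.closedBall_eq_Icc, zero_sub, zero_add] at hR'
    set R := max R' r with hRdef
    have hRr : r ≤ R := le_max_right _ _
    have hzero : ∀ t, t ∉ Icc (-R) R → φ t = 0 := by
      intro t ht
      by_contra hne
      have := hR' (subset_tsupport φ hne)
      have h3 : R' ≤ R := le_max_left _ _
      exact ht ⟨by linarith [this.1], by linarith [this.2]⟩
    obtain ⟨M, hM⟩ := hφ.bounded_above_of_compact_support hφc
    have hM0 : 0 ≤ M := (norm_nonneg _).trans (hM 0)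
    rw [Metric.tendsto_nhds]
    intro ε hε
    set ε' := ε / (4 * (B + F + 1)) with hε'
    have hε'0 : 0 < ε' := by positivity
    obtain ⟨δ', hδ'0, hδ'⟩ := Metric.continuous_iff.1 hφ 0 ε' hε'0
    set δ := min (δ' / 2) r with hδdef
    have hδ0 : 0 < δ := lt_min (by linarith) hr
    have hδr : δ ≤ r := min_le_right _ _
    have hδφ : ∀ t ∈ Icc (-δ) δ, |φ t| ≤ ε' := by
      intro t ht
      have h3 : δ ≤ δ' / 2 := min_le_left _ _
      have := hδ' t (by rw [Real.dist_eq, sub_zero, abs_lt]; constructor <;> linarith [ht.1, ht.2])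
      rw [hφ0, Real.dist_eq, sub_zero] at this
      exact this.le
    obtain ⟨fr, tr⟩ := hf δ R (by linarith) (fun h => absurd h.1 (not_le.2 hδ0))
    obtain ⟨fl, tl⟩ := hf (-R) (-δ) (by linarith) (fun h => absurd h.2 (not_le.2 (by linarith)))
    have hsm : 0 < ε / (8 * (M + 1)) := by positivity
    filter_upwards [hev2, hB, tr.eventually_lt_const hsm, tl.eventually_lt_const hsm] with σ hσ b1 b2 b3
    have hVc := hV σ hσ.1
    have iV : Integrable (fun t => V σ t * φ t) :=
      (hVc.mul hφ).integrable_of_hasCompactSupport hφc.mul_left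
    have iF := fprod φ hφ hφc
    rw [Real.dist_eq, ← integral_sub iV iF]
    have e1 : ∫ t, (V σ t * φ t - f t * φ t) = ∫ t in (-R)..R, (V σ t - f t) * φ t := by
      rw [intervalIntegral.integral_of_le (by linarith), ← integral_Icc_eq_integral_Ioc]
      symm
      rw [setIntegral_eq_integral_of_forall_compl_eq_zero]
      · congr 1; ext t; ring
      · intro t ht; rw [hzero t ht, mul_zero]
    rw [e1]
    have iD : ∀ a b, -R ≤ a → a ≤ b → b ≤ R →
        IntervalIntegrable (fun t => |V σ t - f t|) volume a b := by
      intro a b ha hab hb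
      rw [intervalIntegrable_iff_integrableOn_Icc_of_le hab]
      exact (hVc.integrableOn_Icc.sub ((fall R).mono_set (Icc_subset_Icc ha hb))).abs
    have iP : ∀ a b, -R ≤ a → a ≤ b → b ≤ R →
        IntervalIntegrable (fun t => |V σ t - f t| * |φ t|) volume a b := by
      intro a b ha hab hb
      exact (iD a b ha hab hb).mul_continuousOn hφ.abs.continuousOn
    have e2 : |∫ t in (-R)..R, (V σ t - f t) * φ t| ≤ ∫ t in (-R)..R, |V σ t - f t| * |φ t| := by
      refine (intervalIntegral.abs_integral_le_integral_abs (by linarith)).trans (le_of_eq ?_)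
      simp only [abs_mul]
    have e3 : ∫ t in (-R)..R, |V σ t - f t| * |φ t| =
        (∫ t in (-R)..(-δ), |V σ t - f t| * |φ t|) + (∫ t in (-δ)..δ, |V σ t - f t| * |φ t|) +
        ∫ t in δ..R, |V σ t - f t| * |φ t| := by
      rw [intervalIntegral.integral_add_adjacent_intervals
        (iP _ _ le_rfl (by linarith) (by linarith)) (iP _ _ (by linarith) (by linarith) (by linarith)),
        intervalIntegral.integral_add_adjacent_intervals
        (iP _ _ le_rfl (by linarith) (by linarith)) (iP _ _ (by linarith) (by linarith) (by linarith))]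
    have e4 : ∫ t in (-R)..(-δ), |V σ t - f t| * |φ t| ≤ (∫ t in (-R)..(-δ), |V σ t - f t|) * M := by
      rw [← intervalIntegral.integral_mul_const]
      refine intervalIntegral.integral_mono_on (by linarith) (iP _ _ le_rfl (by linarith) (by linarith))
        ((iD _ _ le_rfl (by linarith) (by linarith)).mul_const M) fun t _ => ?_
      have := hM t
      rw [Real.norm_eq_abs] at this
      gcongr
    have e5 : ∫ t in δ..R, |V σ t - f t| * |φ t| ≤ (∫ t in δ..R, |V σ t - f t|) * M := by
      rw [← intervalIntegral.integral_mul_const]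
      refine intervalIntegral.integral_mono_on (by linarith) (iP _ _ (by linarith) (by linarith) le_rfl)
        ((iD _ _ (by linarith) (by linarith) le_rfl).mul_const M) fun t _ => ?_
      have := hM t
      rw [Real.norm_eq_abs] at this
      gcongr
    have e6 : ∫ t in (-δ)..δ, |V σ t - f t| * |φ t| ≤ (∫ t in (-δ)..δ, |V σ t - f t|) * ε' := by
      rw [← intervalIntegral.integral_mul_const]
      refine intervalIntegral.integral_mono_on (by linarith)
        (iP _ _ (by linarith) (by linarith) (by linarith))
        ((iD _ _ (by linarith) (by linarith) (by linarith)).mul_const ε') fun t ht => ?_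
      have := hδφ t ht
      gcongr
    have e7 : ∫ t in (-δ)..δ, |V σ t - f t| ≤ B + F := by
      rw [intervalIntegral.integral_of_le (by linarith), ← integral_Icc_eq_integral_Ioc]
      have k1 : IntegrableOn (V σ) (Icc (-r) r) := hVc.integrableOn_Icc
      have k2 : ∫ t in Icc (-δ) δ, |V σ t - f t| ≤ ∫ t in Icc (-r) r, |V σ t - f t| := by
        refine setIntegral_mono_set (k1.sub fmid).abs ?_ ?_
        · exact Eventually.of_forall fun t => abs_nonneg _
        · exact (Icc_subset_Icc (by linarith) hδr).eventuallyLE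
      have k3 : ∫ t in Icc (-r) r, |V σ t - f t| ≤ ∫ t in Icc (-r) r, (|V σ t| + |f t|) := by
        refine integral_mono (k1.sub fmid).abs (k1.abs.add fmid.abs) fun t => ?_
        exact abs_sub _ _
      rw [integral_add k1.abs fmid.abs] at k3
      linarith
    have e8 : (∫ t in (-R)..(-δ), |V σ t - f t|) * M ≤ ε / 8 := by
      calc _ ≤ ε / (8 * (M + 1)) * M := by gcongr
        _ ≤ ε / (8 * (M + 1)) * (M + 1) := by gcongr; linarith
        _ = ε / 8 := by field_simp
    have e9 : (∫ t in δ..R, |V σ t - f t|) * M ≤ ε / 8 := by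
      calc _ ≤ ε / (8 * (M + 1)) * M := by gcongr
        _ ≤ ε / (8 * (M + 1)) * (M + 1) := by gcongr; linarith
        _ = ε / 8 := by field_simp
    have e10 : (∫ t in (-δ)..δ, |V σ t - f t|) * ε' ≤ ε / 4 := by
      calc _ ≤ (B + F) * ε' := by gcongr
        _ ≤ (B + F + 1) * ε' := by nlinarith
        _ = ε / 4 := by rw [hε']; field_simp
    linarith
  intro φ hφ hφc
  set φ₀ : ℝ → ℝ := fun t => φ t - φ 0 * χ t with hφ₀
  have hφ₀c : HasCompactSupport φ₀ := by
    exact hφc.sub hχc.mul_left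
  have hχ00 : χ 0 = 1 := hχr 0 ⟨by linarith, hr.le⟩
  have h1 := key φ₀ (by fun_prop) hφ₀c (by simp [hφ₀, hχ00])
  have h2 := h1.add (hu.mul_const (φ 0))
  have elim : (∫ t, f t * φ₀ t) + u * φ 0 = (∫ t, f t * φ t) + (u - ∫ t, f t * χ t) * φ 0 := by
    have : ∫ t, f t * φ₀ t = (∫ t, f t * φ t) - (∫ t, f t * χ t) * φ 0 := by
      rw [← integral_mul_const, ← integral_sub (fprod φ hφ hφc) ((fprod χ hχ hχc).mul_const _)]
      congr 1; ext t; simp only [hφ₀]; ring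
    rw [this]; ring
  rw [elim] at h2
  refine h2.congr' ?_
  filter_upwards [hev2] with σ hσ
  have hVc := hV σ hσ.1
  have iV1 : Integrable (fun t => V σ t * χ t) :=
    (hVc.mul hχ).integrable_of_hasCompactSupport hχc.mul_left
  have iV0 : Integrable (fun t => V σ t * φ₀ t) :=
    (hVc.mul (by fun_prop)).integrable_of_hasCompactSupport hφ₀c.mul_left
  rw [← integral_mul_const, ← integral_add iV0 (iV1.mul_const _)]
  congr 1; ext t; simp only [hφ₀]; ring

lemma WI_tauber (τ : ℝ → ℝ) (hm : Measurable τ) (K : ℝ → ℝ) (hKi : Integrable K)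
    (hK0 : ∀ v, 0 ≤ K v) (hJ : 0 < ∫ v, K v) (T : ℝ) (hT : ∀ x, |τ x| ≤ T)
    (hslow : ∀ ε > 0, ∃ h > 0, ∃ x₀ : ℝ, ∀ x y, x₀ ≤ x → x ≤ y → y ≤ x + h → τ x - ε ≤ τ y)
    (a : ℝ) (hlim : ∀ δ > 0, Tendsto (fun x => ∫ v, τ (x - δ * v) * K v) atTop
      (nhds (a * ∫ v, K v))) : Tendsto τ atTop (nhds a) := by
  set J := ∫ v, K v with hJdef
  have hT0 : 0 ≤ T := (abs_nonneg _).trans (hT 0)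
  have hint : ∀ δ x : ℝ, Integrable (fun v => τ (x - δ * v) * K v) := by
    intro δ x
    refine hKi.bdd_mul (c := T) ?_ (Eventually.of_forall fun v => hT _)
    exact (hm.comp (by fun_prop)).aestronglyMeasurable
  rw [Metric.tendsto_nhds]
  intro ε hε
  obtain ⟨h, hh, x₀, H⟩ := hslow (ε / 4) (by positivity)
  have htail : Tendsto (fun R : ℝ => ∫ v in (-R)..R, K v) atTop (nhds J) :=
    intervalIntegral_tendsto_integral hKi tendsto_neg_atTop_atBot tendsto_id
  have hη : 0 < ε / 4 * J / (2 * T + 1) := by positivity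
  obtain ⟨R, hR1, hR0⟩ := ((htail.eventually_const_lt (show J - ε / 4 * J / (2 * T + 1) < J by linarith)).and
    (eventually_gt_atTop 0)).exists
  rw [intervalIntegral.integral_of_le (by linarith), ← integral_Icc_eq_integral_Ioc] at hR1
  set O : ℝ → ℝ := (Icc (-R) R)ᶜ.indicator K with hO
  have hOi : Integrable O := hKi.indicator measurableSet_Icc.compl
  have hOval : 2 * T * ∫ v, O v ≤ ε / 4 * J := by
    rw [hO, integral_indicator measurableSet_Icc.compl]
    have h1 := integral_add_compl (μ := volume) (measurableSet_Icc (a := -R) (b := R)) hKi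
    have h2 : ∫ v in (Icc (-R) R)ᶜ, K v ≤ ε / 4 * J / (2 * T + 1) := by linarith
    calc _ ≤ 2 * T * (ε / 4 * J / (2 * T + 1)) := by gcongr
      _ ≤ (2 * T + 1) * (ε / 4 * J / (2 * T + 1)) := by gcongr; linarith
      _ = _ := by field_simp
  have hO0 : ∀ v, 0 ≤ O v := fun v => indicator_nonneg (fun v _ => hK0 v) v
  have hOin : ∀ v, v ∉ Icc (-R) R → O v = K v := fun v hv => indicator_of_mem hv K
  set δ := h / (2 * R) with hδ
  have hδ0 : 0 < δ := by positivity
  have hδR : δ * R = h / 2 := by rw [hδ]; field_simp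
  have hl := hlim δ hδ0
  have hlu := hl.eventually_lt_const (show a * J < a * J + ε / 4 * J by
    have : 0 < ε / 4 * J := by positivity
    linarith)
  have hll := hl.eventually_const_lt (show a * J - ε / 4 * J < a * J by
    have : 0 < ε / 4 * J := by positivity
    linarith)
  have ev1 : ∀ᶠ x in atTop, ∫ v, τ (x + h / 2 - δ * v) * K v < a * J + ε / 4 * J :=
    (tendsto_atTop_add_const_right atTop (h / 2) tendsto_id).eventually hlu
  have ev2 : ∀ᶠ x in atTop, a * J - ε / 4 * J < ∫ v, τ (x + -(h / 2) - δ * v) * K v :=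
    (tendsto_atTop_add_const_right atTop (-(h / 2)) tendsto_id).eventually hll
  filter_upwards [ev1, ev2, eventually_ge_atTop (x₀ + h)] with x q1 q2 hx
  have hbv : ∀ v ∈ Icc (-R) R, |δ * v| ≤ h / 2 := by
    intro v hv
    rw [abs_mul, abs_of_pos hδ0, ← hδR]
    have : |v| ≤ R := abs_le.2 hv
    gcongr
  have up : (τ x - ε / 4) * J - 2 * T * ∫ v, O v ≤ ∫ v, τ (x + h / 2 - δ * v) * K v := by
    rw [hJdef, ← integral_const_mul, ← integral_const_mul, ← integral_sub (hKi.const_mul _) (hOi.const_mul _)]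
    refine integral_mono ((hKi.const_mul _).sub (hOi.const_mul _)) (hint _ _) fun v => ?_
    simp only
    by_cases hv : v ∈ Icc (-R) R
    · have b := abs_le.1 (hbv v hv)
      have := H x (x + h / 2 - δ * v) (by linarith) (by linarith [b.2]) (by linarith [b.1])
      have h2 := mul_le_mul_of_nonneg_right this (hK0 v)
      have h3 : 0 ≤ 2 * T * O v := by have := hO0 v; positivity
      linarith
    · rw [hOin v hv]
      have b1 := abs_le.1 (hT x)
      have b2 := abs_le.1 (hT (x + h / 2 - δ * v))
      have : τ x - ε / 4 - 2 * T ≤ τ (x + h / 2 - δ * v) := by linarith [b1.2, b2.1]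
      have h2 := mul_le_mul_of_nonneg_right this (hK0 v)
      linarith
  have lo : ∫ v, τ (x + -(h / 2) - δ * v) * K v ≤ (τ x + ε / 4) * J + 2 * T * ∫ v, O v := by
    rw [hJdef, ← integral_const_mul, ← integral_const_mul, ← integral_add (hKi.const_mul _) (hOi.const_mul _)]
    refine integral_mono (hint _ _) ((hKi.const_mul _).add (hOi.const_mul _)) fun v => ?_
    simp only
    by_cases hv : v ∈ Icc (-R) R
    · have b := abs_le.1 (hbv v hv)
      have := H (x + -(h / 2) - δ * v) x (by linarith [b.2]) (by linarith [b.1]) (by linarith [b.2])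
      have h2 := mul_le_mul_of_nonneg_right (show τ (x + -(h / 2) - δ * v) ≤ τ x + ε / 4 by linarith) (hK0 v)
      have h3 : 0 ≤ 2 * T * O v := by have := hO0 v; positivity
      linarith
    · rw [hOin v hv]
      have b1 := abs_le.1 (hT x)
      have b2 := abs_le.1 (hT (x + -(h / 2) - δ * v))
      have : τ (x + -(h / 2) - δ * v) ≤ τ x + ε / 4 + 2 * T := by linarith [b1.1, b2.2]
      have h2 := mul_le_mul_of_nonneg_right this (hK0 v)
      linarith
  rw [Real.dist_eq, abs_lt]
  have f1 : (τ x) * J < (a + 3 * (ε / 4)) * J := by linarith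
  have f2 : (a - 3 * (ε / 4)) * J < τ x * J := by linarith
  have f1' := lt_of_mul_lt_mul_right f1 hJ.le
  have f2' := lt_of_mul_lt_mul_right f2 hJ.le
  constructor <;> linarith

lemma WI_bounded (τ : ℝ → ℝ) (K : ℝ → ℝ) (hKi : Integrable K) (hKc : Continuous K)
    (hK0 : ∀ v, 0 ≤ K v) (hKpos : 0 < K 0) (A : ℝ) (hA : ∀ x, -A ≤ τ x)
    (h x₀ : ℝ) (hh : 0 < h)
    (H : ∀ x y, x₀ ≤ x → x ≤ y → y ≤ x + h → Real.exp (x - y) * (τ x - 1) ≤ τ y)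
    (hA0 : 0 ≤ A)
    (hint : ∀ x, Integrable (fun v => τ (x - v) * K v)) (L : ℝ)
    (hlim : Tendsto (fun x => ∫ v, τ (x - v) * K v) atTop (nhds L)) :
    ∃ T : ℝ, ∀ᶠ x in atTop, τ x ≤ T := by
  obtain ⟨r', hr'0, hr'⟩ := Metric.continuous_iff.1 hKc 0 (K 0 / 2) (by positivity)
  set r := min (r' / 2) (h / 2) with hr
  have hr0 : 0 < r := lt_min (by linarith) (by linarith)
  have hrh : r ≤ h / 2 := min_le_right _ _
  have hrr : r ≤ r' / 2 := min_le_left _ _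
  set κ := K 0 / 2 with hκ
  have hκ0 : 0 < κ := by positivity
  have hKκ : ∀ v ∈ Icc (-r) r, κ ≤ K v := by
    intro v hv
    have := hr' v (by rw [Real.dist_eq, sub_zero, abs_lt]; constructor <;> linarith [hv.1, hv.2])
    rw [Real.dist_eq, abs_lt] at this
    linarith [this.1]
  set c := 2 * r * (Real.exp (-(2 * r)) * κ) with hc
  have hc0 : 0 < c := by have := Real.exp_pos (-(2 * r)); positivity
  set J := ∫ v, K v
  have hJ0 : 0 ≤ J := integral_nonneg hK0
  refine ⟨1 + (|L| + 1 + A * J) / c, ?_⟩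
  have ev := (tendsto_atTop_add_const_right atTop r tendsto_id).eventually
    (hlim.eventually_lt_const (show L < |L| + 1 by linarith [le_abs_self L]))
  filter_upwards [ev, eventually_ge_atTop x₀] with x hx hx0
  simp only [id] at hx
  rcases le_or_gt (τ x) 1 with h1 | h1
  · have : 0 ≤ (|L| + 1 + A * J) / c := by positivity
    linarith
  have i1 : Integrable (fun v => (τ (x + r - v) + A) * K v) := by
    refine ((hint (x + r)).add (hKi.const_mul A)).congr (Eventually.of_forall fun v => ?_)
    simp only [Pi.add_apply]; ring
  have e1 : ∫ v, (τ (x + r - v) + A) * K v = (∫ v, τ (x + r - v) * K v) + A * J := by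
    rw [← integral_const_mul, ← integral_add (hint _) (hKi.const_mul A)]
    congr 1; ext v; ring
  have e2 : ∫ v in Icc (-r) r, (τ (x + r - v) + A) * K v ≤ ∫ v, (τ (x + r - v) + A) * K v := by
    refine setIntegral_le_integral i1 (Eventually.of_forall fun v => ?_)
    exact mul_nonneg (by linarith [hA (x + r - v)]) (hK0 v)
  have e3 : ∫ v in Icc (-r) r, (Real.exp (-(2 * r)) * (τ x - 1)) * κ ≤
      ∫ v in Icc (-r) r, (τ (x + r - v) + A) * K v := by
    refine setIntegral_mono_on (integrableOn_const (by simp)) i1.integrableOn measurableSet_Icc ?_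
    intro v hv
    have g1 := H x (x + r - v) hx0 (by linarith [hv.2]) (by linarith [hv.1])
    have g2 : Real.exp (-(2 * r)) ≤ Real.exp (x - (x + r - v)) := Real.exp_le_exp.2 (by linarith [hv.1])
    have g3 : Real.exp (-(2 * r)) * (τ x - 1) ≤ τ (x + r - v) + A := by
      have := mul_le_mul_of_nonneg_right g2 (show 0 ≤ τ x - 1 by linarith)
      linarith
    have g4 : 0 ≤ Real.exp (-(2 * r)) * (τ x - 1) :=
      mul_nonneg (Real.exp_pos _).le (by linarith)
    exact mul_le_mul g3 (hKκ v hv) hκ0.le (g4.trans g3)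
  rw [setIntegral_const] at e3
  simp only [Measure.real, Real.volume_Icc, smul_eq_mul] at e3
  rw [ENNReal.toReal_ofReal (by linarith)] at e3
  have e4 : (τ x - 1) * c ≤ |L| + 1 + A * J := by
    calc _ = (r - -r) * (Real.exp (-(2 * r)) * (τ x - 1) * κ) := by rw [hc]; ring
      _ ≤ _ := by linarith
  rw [← le_div_iff₀ hc0] at e4
  linarith

lemma WI_abel (τ : ℝ → ℝ) (hm : Measurable τ) (h0 : ∀ x < 0, τ x = 0) (T : ℝ)
    (hT : ∀ x, |τ x| ≤ T) (a : ℝ) (hlim : Tendsto τ atTop (nhds a)) :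
    Tendsto (fun σ : ℝ => (σ - 1) * ∫ x, Real.exp (-(σ - 1) * x) * τ x)
      (nhdsWithin 1 (Ioi 1)) (nhds a) := by
  have hT0 : 0 ≤ T := (abs_nonneg _).trans (hT 0)
  have hI : ∫ v in Ioi (0:ℝ), Real.exp (-v) * a = a := by
    rw [integral_mul_const, integral_exp_neg_Ioi_zero, one_mul]
  rw [← hI]
  have main : Tendsto (fun σ : ℝ => ∫ v in Ioi (0:ℝ), Real.exp (-v) * τ (v / (σ - 1)))
      (nhdsWithin 1 (Ioi 1)) (nhds (∫ v in Ioi (0:ℝ), Real.exp (-v) * a)) := by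
    refine tendsto_integral_filter_of_dominated_convergence (fun v => Real.exp (-v) * T) ?_ ?_ ?_ ?_
    · refine Eventually.of_forall fun σ => ?_
      have : Measurable (fun v => Real.exp (-v) * τ (v / (σ - 1))) := by fun_prop
      exact this.aestronglyMeasurable
    · refine Eventually.of_forall fun σ => Eventually.of_forall fun v => ?_
      rw [norm_mul, Real.norm_eq_abs, Real.abs_exp]
      exact mul_le_mul_of_nonneg_left (hT _) (Real.exp_pos _).le
    · exact (integrableOn_exp_neg_Ioi 0).mul_const T
    · filter_upwards [ae_restrict_mem measurableSet_Ioi] with v hv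
      refine Tendsto.const_mul _ (hlim.comp ?_)
      have h1 : Tendsto (fun σ : ℝ => σ - 1) (nhdsWithin 1 (Ioi 1)) (nhdsWithin 0 (Ioi 0)) := by
        refine tendsto_nhdsWithin_iff.2 ⟨?_, ?_⟩
        · have : Continuous (fun σ : ℝ => σ - 1) := by fun_prop
          have := this.tendsto 1
          simp only [sub_self] at this
          exact this.mono_left nhdsWithin_le_nhds
        · filter_upwards [self_mem_nhdsWithin] with σ hσ
          simpa using hσ
      have h2 := (tendsto_inv_nhdsGT_zero.comp h1).const_mul_atTop (show 0 < v from hv)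
      simpa [div_eq_mul_inv] using h2
  refine main.congr' ?_
  filter_upwards [self_mem_nhdsWithin] with σ hσ
  have hη : 0 < σ - 1 := by simpa using hσ
  have e := Measure.integral_comp_mul_left (fun v => Real.exp (-v) * τ (v / (σ - 1))) (σ - 1)
  have e2 : ∀ x : ℝ, (σ - 1) * x / (σ - 1) = x := fun x => by field_simp
  simp only [e2, smul_eq_mul] at e
  simp only [neg_mul]
  rw [e, abs_of_pos (by positivity), ← mul_assoc, mul_inv_cancel₀ hη.ne', one_mul,
    ← integral_Ici_eq_integral_Ioi]
  apply setIntegral_eq_integral_of_forall_compl_eq_zero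
  intro v hv
  rw [h0, mul_zero]
  exact div_neg_of_neg_of_pos (by simpa using hv) hη

lemma WI_tauint (τ : ℝ → ℝ) (hm : Measurable τ) (D : ℝ) (m : ℕ)
    (hτ : ∀ x : ℝ, |τ x| ≤ D * (1 + |x|) ^ m) (G : ℝ → ℝ) (hG : Continuous G) (C h : ℝ)
    (hGb : ∀ x, |G x| ≤ C / (1 + |x - h|) ^ (m + 2)) : Integrable (fun x => τ x * G x) := by
  have hD : 0 ≤ D := by
    have := (abs_nonneg _).trans (hτ 0)
    simpa using this
  have hC : 0 ≤ C := by
    have := (abs_nonneg _).trans (hGb h)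
    simpa using this
  refine Integrable.mono' (WI_int2.const_mul (D * C * (1 + |h|) ^ (m + 2)))
    (hm.aestronglyMeasurable.mul hG.aestronglyMeasurable) (Eventually.of_forall fun x => ?_)
  have h1 : (1 + |x|) ≤ (1 + |h|) * (1 + |x - h|) := by
    have := abs_add_le (x - h) h
    rw [sub_add_cancel] at this
    nlinarith [mul_nonneg (abs_nonneg h) (abs_nonneg (x - h))]
  have h2 : (1 + |x|) ^ (m + 2) ≤ (1 + |h|) ^ (m + 2) * (1 + |x - h|) ^ (m + 2) := by
    rw [← mul_pow]
    exact pow_le_pow_left₀ (by positivity) h1 _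
  have hp1 : 0 < 1 + |x| := by positivity
  have hp2 : 0 < 1 + |x - h| := by positivity
  rw [norm_mul]
  calc ‖τ x‖ * ‖G x‖ ≤ (D * (1 + |x|) ^ m) * (C / (1 + |x - h|) ^ (m + 2)) := by
        gcongr
        · exact hτ x
        · exact hGb x
    _ = D * C * ((1 + |x|) ^ (m + 2) / (1 + |x - h|) ^ (m + 2)) * (1 / (1 + |x|) ^ 2) := by
        rw [pow_add (1 + |x|)]
        field_simp
    _ ≤ D * C * (1 + |h|) ^ (m + 2) * (1 / (1 + |x|) ^ 2) := by
        gcongr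
        rw [div_le_iff₀ (by positivity)]
        exact h2

lemma WI_RL (w : ℝ → ℝ) (hw : Integrable w) :
    Tendsto (fun y : ℝ => ∫ t, w t * Real.cos (t * y)) atTop (nhds 0) ∧
    Tendsto (fun y : ℝ => ∫ t, w t * Real.sin (t * y)) atTop (nhds 0) := by
  have h1 : Tendsto (fun y : ℝ => -(y / (2 * Real.pi))) atTop (cocompact ℝ) := by
    refine Tendsto.mono_right ?_ atBot_le_cocompact
    exact tendsto_neg_atTop_atBot.comp (tendsto_id.atTop_div_const (by positivity))
  have h2 := (Real.zero_at_infty_fourier (fun t => (w t : ℂ))).comp h1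
  have h3 : ∀ y : ℝ, ((FourierTransform.fourier fun t => (w t : ℂ)) ∘ fun y : ℝ => -(y / (2 * Real.pi))) y =
      ((∫ t, w t * Real.cos (t * y) : ℝ) : ℂ) + ((∫ t, w t * Real.sin (t * y) : ℝ) : ℂ) * Complex.I :=
    fun y => WI_fourier w hw y
  have h4 := h2.congr h3
  constructor
  · have := (Complex.continuous_re.tendsto 0).comp h4
    refine Tendsto.congr (fun y => ?_) (by simpa only [Complex.zero_re] using this)
    simp
  · have := (Complex.continuous_im.tendsto 0).comp h4
    refine Tendsto.congr (fun y => ?_) (by simpa only [Complex.zero_im] using this)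
    simp

lemma WI_fprod (f : ℝ → ℝ) (fall : ∀ R, IntegrableOn f (Icc (-R) R)) (φ : ℝ → ℝ)
    (hφ : Continuous φ) (hφc : HasCompactSupport φ) : Integrable (fun t => f t * φ t) := by
  obtain ⟨R, hR⟩ := hφc.isCompact.isBounded.subset_closedBall 0
  rw [Real.closedBall_eq_Icc, zero_sub, zero_add] at hR
  obtain ⟨M, hM⟩ := hφ.bounded_above_of_compact_support hφc
  have : IntegrableOn (fun t => f t * φ t) (Icc (-R) R) :=
    (fall R).mul_bdd (c := M) hφ.aestronglyMeasurable (Eventually.of_forall hM)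
  refine (integrableOn_iff_integrable_of_support_subset ?_).1 this
  intro t ht
  refine hR (subset_tsupport _ ?_)
  intro h0
  exact ht (by simp [h0])

lemma WI_trig (w : ℝ → ℝ) (hw : Integrable w) (y : ℝ) :
    Integrable (fun t => w t * Real.cos (t * y)) ∧ Integrable (fun t => w t * Real.sin (t * y)) := by
  constructor
  · refine hw.mul_bdd (c := 1) (by fun_prop) (Eventually.of_forall fun t => ?_)
    simpa using Real.abs_cos_le_one _
  · refine hw.mul_bdd (c := 1) (by fun_prop) (Eventually.of_forall fun t => ?_)
    simpa using Real.abs_sin_le_one _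

open scoped ContDiff in
lemma WI_conv (S : ℝ → ℝ) (hSm : Measurable S) (hS0 : ∀ x < 0, S x = 0)
    (hint : ∀ σ : ℝ, 1 < σ → Integrable (fun x => Real.exp (-σ * x) * S x))
    (D : ℝ) (hD : 0 ≤ D) (m : ℕ) (hτ : ∀ x : ℝ, |Real.exp (-x) * S x| ≤ D * (1 + |x|) ^ m)
    (f : ℝ → ℝ) (fall : ∀ R, IntegrableOn f (Icc (-R) R)) (c : ℝ)
    (hb : ∀ φ : ℝ → ℝ, Continuous φ → HasCompactSupport φ →
      Tendsto (fun σ => ∫ t, WIV S σ t * φ t) (nhdsWithin 1 (Ioi 1))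
        (nhds ((∫ t, f t * φ t) + c * φ 0)))
    (k : ℝ → ℝ) (hk : ContDiff ℝ ∞ k) (hkc : HasCompactSupport k) :
    (∀ h : ℝ, Integrable (fun x => (Real.exp (-x) * S x) * ∫ t, k t * Real.cos (t * (h - x)))) ∧
    Tendsto (fun h : ℝ => ∫ x, (Real.exp (-x) * S x) * ∫ t, k t * Real.cos (t * (h - x))) atTop
      (nhds (2 * c * k 0)) := by
  have hτm : Measurable (fun x => Real.exp (-x) * S x) := by fun_prop
  set τ : ℝ → ℝ := fun x => Real.exp (-x) * S x with hτdef
  have hki : Integrable k := hk.continuous.integrable_of_hasCompactSupport hkc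
  have hpos : ∀ t : ℝ, 1 + t ^ 2 ≠ 0 := fun t => by positivity
  have hinv : ContDiff ℝ ∞ (fun t : ℝ => (1 + t ^ 2)⁻¹) :=
    ContDiff.inv (by fun_prop) hpos
  set p : ℝ → ℝ := fun t => k t * (1 + t ^ 2)⁻¹ with hp
  have hpc : ContDiff ℝ ∞ p := hk.mul hinv
  have hps : HasCompactSupport p := hkc.mul_right
  set w1 : ℝ → ℝ := fun t => p t * (1 - t ^ 2) with hw1
  have hw1c : ContDiff ℝ ∞ w1 := hpc.mul (by fun_prop)
  have hw1s : HasCompactSupport w1 := hps.mul_right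
  have hw1i : Integrable w1 := hw1c.continuous.integrable_of_hasCompactSupport hw1s
  set w2 : ℝ → ℝ := fun t => p t * (2 * t) with hw2
  have hw2c : ContDiff ℝ ∞ w2 := hpc.mul (by fun_prop)
  have hw2s : HasCompactSupport w2 := hps.mul_right
  have hw2i : Integrable w2 := hw2c.continuous.integrable_of_hasCompactSupport hw2s
  set K : ℝ → ℝ := fun y => ∫ t, k t * Real.cos (t * y) with hK
  set M1 : ℝ → ℝ := fun y => ∫ t, w1 t * Real.cos (t * y) with hM1
  set M2 : ℝ → ℝ := fun y => ∫ t, w2 t * Real.sin (t * y) with hM2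
  have hKcont : Continuous K := WI_cont_cos _ hki
  have hM1cont : Continuous M1 := WI_cont_cos _ hw1i
  have hM2cont : Continuous M2 := WI_cont_sin _ hw2i
  obtain ⟨C0, hC0, H0⟩ := WI_decay k hk hkc (m + 2)
  obtain ⟨C1, hC1, H1⟩ := WI_decay w1 hw1c hw1s (m + 3)
  obtain ⟨C2, hC2, H2⟩ := WI_decay w2 hw2c hw2s (m + 3)
  have iK : ∀ h : ℝ, Integrable (fun x => τ x * K (h - x)) := by
    intro h
    refine WI_tauint τ hτm D m hτ (fun x => K (h - x)) (by fun_prop) C0 h fun x => ?_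
    rw [abs_sub_comm x h]
    exact (H0 (h - x)).1
  have hMb : ∀ y, |M1 y + M2 y| ≤ (C1 + C2) / (1 + |y|) ^ (m + 3) := by
    intro y
    calc _ ≤ |M1 y| + |M2 y| := abs_add_le _ _
      _ ≤ C1 / (1 + |y|) ^ (m + 3) + C2 / (1 + |y|) ^ (m + 3) := add_le_add (H1 y).1 (H2 y).2
      _ = _ := by ring
  have iM : ∀ h : ℝ, Integrable (fun x => τ x * (M1 (h + x) + M2 (h + x))) := by
    intro h
    refine WI_tauint τ hτm D m hτ (fun x => M1 (h + x) + M2 (h + x)) (by fun_prop) (C1 + C2) (-h) fun x => ?_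
    rw [sub_neg_eq_add, add_comm x h]
    refine (hMb (h + x)).trans ?_
    have : (1:ℝ) ≤ 1 + |h + x| := by linarith [abs_nonneg (h + x)]
    exact div_le_div_of_nonneg_left (by positivity) (by positivity)
      (pow_le_pow_right₀ this (by omega))
  refine ⟨iK, ?_⟩
  -- the identity
  have ident : ∀ h : ℝ, ∫ x, τ x * K (h - x) =
      2 * ((∫ t, (f t * p t) * Real.cos (t * h)) + ∫ t, (f t * (t * p t)) * Real.sin (t * h)) + 2 * c * k 0
        - ∫ x, τ x * (M1 (h + x) + M2 (h + x)) := by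
    intro h
    set φ : ℝ → ℝ := fun t => p t * (Real.cos (t * h) + t * Real.sin (t * h)) with hφ
    have hφc : ContDiff ℝ ∞ φ := by
      refine hpc.mul (ContDiff.add ?_ ?_)
      · exact Real.contDiff_cos.comp (by fun_prop)
      · exact contDiff_id.mul (Real.contDiff_sin.comp (by fun_prop))
    have hφs : HasCompactSupport φ := hps.mul_right
    have hφi : Integrable φ := hφc.continuous.integrable_of_hasCompactSupport hφs
    have hφ2i : Integrable (fun t => t * φ t) :=
      (continuous_id.mul hφc.continuous).integrable_of_hasCompactSupport hφs.mul_left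
    have L1 := WI_test S hSm hS0 hint D hD m hτ φ hφc hφs
    have L2 := hb φ hφc.continuous hφs
    have E := tendsto_nhds_unique L1 L2
    have E1 : ∀ x, ((∫ t, φ t * Real.cos (t * x)) + ∫ t, (t * φ t) * Real.sin (t * x)) =
        1 / 2 * K (h - x) + 1 / 2 * (M1 (h + x) + M2 (h + x)) := by
      intro x
      have a1 := (WI_trig φ hφi x).1
      have a2 := (WI_trig _ hφ2i x).2
      have a3 := (WI_trig k hki (h - x)).1
      have a4 := (WI_trig w1 hw1i (h + x)).1
      have a5 := (WI_trig w2 hw2i (h + x)).2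
      have a45 : Integrable (fun t => w1 t * Real.cos (t * (h + x)) +
          w2 t * Real.sin (t * (h + x))) := a4.add a5
      simp only [hK, hM1, hM2]
      rw [← integral_add a1 a2, ← integral_add a4 a5, ← integral_const_mul, ← integral_const_mul,
        ← integral_add (a3.const_mul _) (a45.const_mul _)]
      congr 1
      ext t
      have hkp : k t = p t * (1 + t ^ 2) := by
        simp only [hp]; field_simp [hpos t]
      simp only [hφ, hw1, hw2]
      rw [hkp, show t * (h - x) = t * h - t * x by ring,
        show t * (h + x) = t * h + t * x by ring, Real.cos_sub, Real.cos_add, Real.sin_add]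
      ring
    have E2 : ∫ t, f t * φ t = (∫ t, (f t * p t) * Real.cos (t * h)) +
        ∫ t, (f t * (t * p t)) * Real.sin (t * h) := by
      have b1 := (WI_trig _ (WI_fprod f fall p hpc.continuous hps) h).1
      have b2 := (WI_trig _ (WI_fprod f fall (fun t => t * p t)
        (continuous_id.mul hpc.continuous) hps.mul_left) h).2
      rw [← integral_add b1 b2]
      congr 1; ext t; simp only [hφ]; ring
    have E3 : φ 0 = k 0 := by simp [hφ, hp]
    have E4 : ∫ x, (Real.exp (-x) * S x) *
        ((∫ t, φ t * Real.cos (t * x)) + ∫ t, (t * φ t) * Real.sin (t * x)) =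
        1 / 2 * (∫ x, τ x * K (h - x)) + 1 / 2 * ∫ x, τ x * (M1 (h + x) + M2 (h + x)) := by
      rw [← integral_const_mul, ← integral_const_mul,
        ← integral_add ((iK h).const_mul _) ((iM h).const_mul _)]
      congr 1; ext x
      rw [E1 x]; simp only [hτdef]; ring
    rw [E4, E2, E3] at E
    linarith
  have R1 := (WI_RL _ (WI_fprod f fall p hpc.continuous hps)).1
  have R2 := (WI_RL _ (WI_fprod f fall (fun t => t * p t)
        (continuous_id.mul hpc.continuous) hps.mul_left)).2
  have R3 : Tendsto (fun h : ℝ => ∫ x, τ x * (M1 (h + x) + M2 (h + x))) atTop (nhds 0) := by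
    set Q := ∫ x : ℝ, D * (C1 + C2) * (1 / (1 + |x|) ^ 2) with hQ
    have hz : Tendsto (fun h : ℝ => Q / (1 + h)) atTop (nhds 0) :=
      (tendsto_const_nhds (x := Q)).div_atTop (tendsto_atTop_add_const_left atTop 1 tendsto_id)
    refine squeeze_zero_norm' ?_ hz
    filter_upwards [eventually_ge_atTop 0] with h hh
    have h1h : 0 < 1 + h := by linarith
    rw [hQ, div_eq_mul_inv, ← integral_mul_const]
    refine norm_integral_le_of_norm_le ((WI_int2.const_mul _).mul_const _) (Eventually.of_forall fun x => ?_)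
    rcases lt_or_ge x 0 with hx | hx
    · simp only [hτdef, hS0 x hx]
      simp only [mul_zero, zero_mul, norm_zero]
      positivity
    rw [norm_mul]
    have q1 : 1 + |x| ≤ 1 + |h + x| := by
      rw [abs_of_nonneg hx, abs_of_nonneg (by linarith)]; linarith
    have q2 : 1 + h ≤ 1 + |h + x| := by
      rw [abs_of_nonneg (by linarith)]; linarith
    have q3 : (1 + |x|) ^ (m + 2) * (1 + h) ≤ (1 + |h + x|) ^ (m + 3) := by
      rw [pow_succ (1 + |h + x|) (m + 2)]
      gcongr
    have hp1 : 0 < 1 + |x| := by positivity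
    calc ‖τ x‖ * ‖M1 (h + x) + M2 (h + x)‖ ≤
        (D * (1 + |x|) ^ m) * ((C1 + C2) / (1 + |h + x|) ^ (m + 3)) := by
          gcongr
          · exact hτ x
          · exact hMb _
      _ ≤ (D * (1 + |x|) ^ m) * ((C1 + C2) / ((1 + |x|) ^ (m + 2) * (1 + h))) := by
          gcongr
      _ = D * (C1 + C2) * (1 / (1 + |x|) ^ 2) * (1 + h)⁻¹ := by
          rw [pow_add (1 + |x|)]
          field_simp
  have R4 := (((R1.add R2).const_mul 2).add_const (2 * c * k 0)).sub R3
  simp only [add_zero, mul_zero, zero_add, sub_zero] at R4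
  exact R4.congr fun h => (ident h).symm

open scoped ContDiff in
lemma WI_core (S : ℝ → ℝ) (hSm : Measurable S) (hS0 : ∀ x < 0, S x = 0)
    (hloc : ∀ R : ℝ, ∃ B : ℝ, ∀ x ≤ R, |S x| ≤ B) (hslow : LogLinSlowlyDecreasing S)
    (hint : ∀ σ : ℝ, 1 < σ → Integrable (fun x => Real.exp (-σ * x) * S x))
    (f : ℝ → ℝ)
    (hf : ∀ a b : ℝ, a ≤ b → (0 : ℝ) ∉ Icc a b → IntegrableOn f (Icc a b) ∧
      Tendsto (fun σ : ℝ => ∫ t in a..b, |WIV S σ t - f t|) (nhdsWithin 1 (Ioi 1)) (nhds 0))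
    (lam : ℝ) (hlam : 0 < lam) (g : ℝ → ℝ) (hg : IntegrableOn g (Ioo (-lam) lam))
    (hlow : ∀ σ ∈ Ioc (1 : ℝ) 2, ∀ᵐ t ∂(volume.restrict (Ioo (-lam) lam)), g t ≤ WIV S σ t)
    (k : ℕ) (C : ℝ) (hC : 0 < C)
    (hgrow : ∀ σ ∈ Ioc (1 : ℝ) 2, |WIV S σ 0| ≤ C / (σ - 1) ^ k) :
    ∃ a : ℝ,
      Tendsto (fun σ : ℝ => (σ - 1) * WIV S σ 0) (nhdsWithin 1 (Ioi 1)) (nhds a) ∧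
      Tendsto (fun x : ℝ => Real.exp (-x) * S x) atTop (nhds a) := by
  have hτm : Measurable (fun x => Real.exp (-x) * S x) := by fun_prop
  have V0 : ∀ σ, WIV S σ 0 = σ * ∫ x, Real.exp (-σ * x) * S x := by
    intro σ
    rw [← integral_const_mul]
    simp only [WIV]
    congr 1; ext y; simp; ring
  have hgrow' : ∀ σ ∈ Ioc (1:ℝ) 2, ∫ x, Real.exp (-σ * x) * S x ≤ C / (σ - 1) ^ k := by
    intro σ hσ
    have h1 := (le_abs_self _).trans (hgrow σ hσ)
    rw [V0] at h1
    rcases le_or_gt (∫ x, Real.exp (-σ * x) * S x) 0 with h2 | h2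
    · have : 0 < σ - 1 := by linarith [hσ.1]
      exact h2.trans (by positivity)
    · nlinarith [hσ.1]
  obtain ⟨D, hD, m, hτ⟩ := WI_upper S hslow hS0 hloc hint C k hC hgrow'
  obtain ⟨A, hA0, hA⟩ := WI_lower S hslow hS0 hloc
  -- cutoff
  let χ : ContDiffBump (0 : ℝ) := ⟨lam / 3, lam / 2, by positivity, by linarith⟩
  have hχL := WI_test S hSm hS0 hint D hD m hτ χ χ.contDiff χ.hasCompactSupport
  obtain ⟨fall, c, hb⟩ := WI_boundary (WIV S) (fun σ hσ => WIV_cont S σ (hint σ hσ)) f hf lam g hg hlow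
    (lam / 3) (by positivity) (by linarith) χ χ.continuous (fun t => χ.nonneg) (fun t => χ.le_one)
    (fun t ht => χ.one_of_mem_closedBall (by
      rw [Real.closedBall_eq_Icc, zero_sub, zero_add]; exact ht))
    (fun t ht => χ.zero_of_le_dist (by
      rw [Real.dist_eq, sub_zero]
      by_contra hlt
      rw [not_le, abs_lt] at hlt
      have h1 := hlt.1
      have h2 := hlt.2
      simp only [χ] at h1 h2
      exact ht ⟨by linarith, by linarith⟩)) _ hχL
  obtain ⟨κ, hκ, hκc, hκpos, hκ0⟩ := WI_kernel
  have hκi : Integrable κ := hκ.continuous.integrable_of_hasCompactSupport hκc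
  set τ : ℝ → ℝ := fun x => Real.exp (-x) * S x with hτdef
  set K : ℝ → ℝ := fun y => ∫ t, κ t * Real.cos (t * y) with hK
  have hKc : Continuous K := WI_cont_cos _ hκi
  obtain ⟨CK, hCK, HK⟩ := WI_decay κ hκ hκc 2
  have hKi : Integrable K := by
    refine Integrable.mono' (WI_int2.const_mul CK) hKc.aestronglyMeasurable (Eventually.of_forall fun y => ?_)
    rw [mul_one_div]
    exact (HK y).1
  have hJ : 0 < ∫ v, K v := by
    rw [integral_pos_iff_support_of_nonneg hκpos hKi]
    refine (hKc.isOpen_support).measure_pos _ ⟨0, ?_⟩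
    exact hκ0.ne'
  -- scaled limits
  have scaled : ∀ δ > 0, Tendsto (fun x => ∫ v, τ (x - δ * v) * K v) atTop (nhds (2 * c * κ 0)) := by
    intro δ hδ
    have hκδ : ContDiff ℝ ∞ (fun t => κ (δ * t)) := hκ.comp (by fun_prop)
    have hκδc : HasCompactSupport (fun t => κ (δ * t)) :=
      hκc.comp_homeomorph (Homeomorph.mulLeft₀ δ hδ.ne')
    have L := (WI_conv S hSm hS0 hint D hD m hτ f fall c hb _ hκδ hκδc).2
    simp only [mul_zero] at L
    refine L.congr fun x => ?_
    have e1 : ∀ y, ∫ t, κ (δ * t) * Real.cos (t * y) = δ⁻¹ * K (δ⁻¹ * y) := by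
      intro y
      have := Measure.integral_comp_mul_left (fun t => κ t * Real.cos (t * (δ⁻¹ * y))) δ
      rw [abs_of_pos (by positivity), smul_eq_mul] at this
      rw [hK, ← this]
      congr 1; ext t
      congr 2
      field_simp
    have e2 := Measure.integral_comp_mul_left (fun v => τ (x - v) * (δ⁻¹ * K (δ⁻¹ * v))) δ
    have e3 := integral_sub_left_eq_self (fun v => τ v * (δ⁻¹ * K (δ⁻¹ * (x - v)))) volume x
    simp only [e1]
    rw [← e3]
    have e4 : ∀ v, x - (x - v) = v := fun v => by ring
    simp only [e4]
    have e5 : ∀ v, δ⁻¹ * (δ * v) = v := fun v => by field_simp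
    simp only [e5] at e2
    rw [abs_of_pos (by positivity), smul_eq_mul] at e2
    have e6 : ∫ v, τ (x - δ * v) * (δ⁻¹ * K v) = δ⁻¹ * ∫ v, τ (x - δ * v) * K v := by
      rw [← integral_const_mul]; congr 1; ext v; ring
    rw [e6] at e2
    exact (mul_left_cancel₀ (by positivity) e2).symm
  have inteK : ∀ x, Integrable (fun v => τ (x - v) * K v) := by
    intro x
    have := ((WI_conv S hSm hS0 hint D hD m hτ f fall c hb _ hκ hκc).1 x).comp_sub_left x
    refine this.congr (Eventually.of_forall fun v => ?_)
    simp only [hτdef, hK]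
    rw [show x - (x - v) = v by ring]
  have expone : ∀ x : ℝ, Real.exp (-x) * Real.exp x = 1 := fun x => by rw [← Real.exp_add]; simp
  have hτlow : ∀ x, -A ≤ τ x := by
    intro x
    have := mul_le_mul_of_nonneg_left (hA x) (Real.exp_pos (-x)).le
    have e := expone x
    simp only [hτdef]
    calc -A = -A * (Real.exp (-x) * Real.exp x) := by rw [e, mul_one]
      _ ≤ _ := by linarith
  have slowτ : ∀ ε > 0, ∃ h > 0, ∃ x₀ : ℝ, 0 < x₀ ∧ ∀ x y, x₀ ≤ x → x ≤ y → y ≤ x + h →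
      Real.exp (x - y) * (τ x - ε) ≤ τ y := by
    intro ε hε
    obtain ⟨h, hh, x₀, hx₀, H⟩ := WI_slow S hslow ε hε
    refine ⟨h, hh, x₀, hx₀, fun x y h1 h2 h3 => ?_⟩
    have := mul_le_mul_of_nonneg_left (H x y h1 h2 h3) (Real.exp_pos (-y)).le
    simp only [hτdef]
    refine le_trans (le_of_eq ?_) this
    have e := expone x
    have e' : Real.exp (x - y) = Real.exp x * Real.exp (-y) := by rw [← Real.exp_add]; congr 1
    rw [e']
    calc _ = Real.exp (-y) * (S x * (Real.exp (-x) * Real.exp x) - ε * Real.exp x) := by ring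
      _ = _ := by rw [e]; ring
  obtain ⟨h, hh, x₀, hx₀, H⟩ := slowτ 1 one_pos
  have lim1 := scaled 1 one_pos
  simp only [one_mul] at lim1
  obtain ⟨T₁, hT₁⟩ := WI_bounded τ K hKi hKc hκpos hκ0 A hτlow h x₀ hh H hA0 inteK _ lim1
  obtain ⟨X, hX⟩ := eventually_atTop.1 hT₁
  obtain ⟨B, hB⟩ := hloc X
  have hT : ∀ x, |τ x| ≤ |T₁| + A + |B| := by
    intro x
    have a1 := abs_nonneg T₁
    have a2 := abs_nonneg B
    rw [abs_le]
    constructor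
    · linarith [hτlow x]
    · rcases le_or_gt X x with hx | hx
      · linarith [hX x hx, le_abs_self T₁]
      · rcases lt_or_ge x 0 with h0 | h0
        · simp only [hτdef, hS0 x h0, mul_zero]; positivity
        · have b1 := (le_abs_self _).trans (hB x hx.le)
          have b2 := le_abs_self B
          have b3 : Real.exp (-x) ≤ 1 := by simpa using h0
          have b4 := Real.exp_pos (-x)
          have : Real.exp (-x) * S x ≤ |B| := by nlinarith
          simp only [hτdef]
          linarith
  set T := |T₁| + A + |B| with hTdef
  have hT0 : 0 ≤ T := (abs_nonneg _).trans (hT 0)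
  have slow2 : ∀ ε > 0, ∃ h > 0, ∃ x₀ : ℝ, ∀ x y, x₀ ≤ x → x ≤ y → y ≤ x + h → τ x - ε ≤ τ y := by
    intro ε hε
    obtain ⟨h, hh, x₀, hx₀, H⟩ := slowτ (ε / 2) (by positivity)
    refine ⟨min h (ε / 2 / (T + 1)), lt_min hh (by positivity), x₀, fun x y h1 h2 h3 => ?_⟩
    have g1 := H x y h1 h2 (h3.trans (by gcongr; exact min_le_left _ _))
    have g2 : y - x ≤ ε / 2 / (T + 1) := by
      have := min_le_right h (ε / 2 / (T + 1)); linarith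
    rw [le_div_iff₀ (by positivity)] at g2
    have g3 : 1 - (y - x) ≤ Real.exp (x - y) := by
      have := Real.add_one_le_exp (x - y); linarith
    have g4 : Real.exp (x - y) ≤ 1 := by simpa using h2
    have g5 := abs_le.1 (hT x)
    have g6 : (1 - Real.exp (x - y)) * τ x ≤ (y - x) * (T + 1) := by
      calc _ ≤ (1 - Real.exp (x - y)) * (T + 1) := by
            apply mul_le_mul_of_nonneg_left _ (by linarith)
            linarith [g5.2]
        _ ≤ _ := by
            apply mul_le_mul_of_nonneg_right _ (by linarith)
            linarith
    nlinarith
  set a := 2 * c * κ 0 / ∫ v, K v with ha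
  have haJ : a * ∫ v, K v = 2 * c * κ 0 := by rw [ha]; field_simp
  have final := WI_tauber τ hτm K hKi hκpos hJ T hT slow2 a (fun δ hδ => by
    rw [haJ]; exact scaled δ hδ)
  refine ⟨a, ?_, final⟩
  have ab := WI_abel τ hτm (fun x hx => by simp only [hτdef, hS0 x hx, mul_zero]) T hT a final
  have hid : Tendsto (fun σ : ℝ => σ) (nhdsWithin 1 (Ioi 1)) (nhds 1) :=
    tendsto_id.mono_left nhdsWithin_le_nhds
  have ab2 := hid.mul ab
  rw [one_mul] at ab2
  refine ab2.congr fun σ => ?_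
  rw [V0]
  have : ∀ x, Real.exp (-(σ - 1) * x) * τ x = Real.exp (-σ * x) * S x := by
    intro x
    simp only [hτdef]
    rw [← mul_assoc, ← Real.exp_add]
    congr 2; ring
  simp only [this]
  ring

/-- Theorem 1.3 for the Laplace–Stieltjes transform.
Here the locally finite signed Borel measure `μ` on `[0,∞)` is represented by the
Jordan-type decomposition `μ = μp - μm` into locally finite nonnegative measures,
and `S x = μ([0,x])`. -/
theorem wiener_ikehara_stieltjes_B3 (μp μm : Measure ℝ)
    [IsLocallyFiniteMeasure μp] [IsLocallyFiniteMeasure μm]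
    (hμp : μp (Iio 0) = 0) (hμm : μm (Iio 0) = 0)
    (hconv : ∀ s : ℂ, 1 < s.re →
      Integrable (fun x : ℝ => Complex.exp (-s * x)) μp ∧
      Integrable (fun x : ℝ => Complex.exp (-s * x)) μm)
    (S : ℝ → ℝ) (hSdef : ∀ x : ℝ, S x = (μp (Icc 0 x)).toReal - (μm (Icc 0 x)).toReal)
    (hslow : LogLinSlowlyDecreasing S)
    (U : ℂ → ℝ) (hU : ∀ s : ℂ, U s = (laplaceStieltjes μp μm s).re)
    (hbd : L1locBoundaryBehavior U)
    (lam : ℝ) (hlam : 0 < lam)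
    (g : ℝ → ℝ) (hg : IntegrableOn g (Ioo (-lam) lam))
    (k : ℕ) (C : ℝ) (hC : 0 < C)
    (hlow : ∀ σ ∈ Ioc (1 : ℝ) 2, ∀ᵐ t ∂(volume.restrict (Ioo (-lam) lam)),
      g t ≤ U (σ + t * Complex.I))
    (hgrow : ∀ t ∈ Ioo (-lam) lam, ∀ σ ∈ Ioc (1 : ℝ) 2,
      |U (σ + t * Complex.I)| ≤ C / (σ - 1) ^ k) :
    ∃ a : ℝ,
      Tendsto (fun σ : ℝ => (σ - 1) * U σ) (nhdsWithin 1 (Ioi 1)) (nhds a) ∧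
      Tendsto (fun x : ℝ => Real.exp (-x) * S x) atTop (nhds a) := by
  have mono : ∀ (μ : Measure ℝ) [IsLocallyFiniteMeasure μ],
      Monotone (fun x : ℝ => (μ (Icc 0 x)).toReal) := by
    intro μ _ x y hxy
    exact ENNReal.toReal_mono isCompact_Icc.measure_lt_top.ne
      (measure_mono (Icc_subset_Icc le_rfl hxy))
  have hSeq : S = fun x => (μp (Icc 0 x)).toReal - (μm (Icc 0 x)).toReal := funext hSdef
  have hSm : Measurable S := by
    rw [hSeq]
    exact (mono μp).measurable.sub (mono μm).measurable
  have hS0 : ∀ x < 0, S x = 0 := by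
    intro x hx
    rw [hSdef, Icc_eq_empty (by linarith)]; simp
  have hloc : ∀ R : ℝ, ∃ B : ℝ, ∀ x ≤ R, |S x| ≤ B := by
    intro R
    refine ⟨(μp (Icc 0 R)).toReal + (μm (Icc 0 R)).toReal, fun x hx => ?_⟩
    rw [hSdef]
    have h1 := mono μp hx
    have h2 := mono μm hx
    have h3 : 0 ≤ (μp (Icc 0 x)).toReal := ENNReal.toReal_nonneg
    have h4 : 0 ≤ (μm (Icc 0 x)).toReal := ENNReal.toReal_nonneg
    simp only at h1 h2
    rw [abs_le]; constructor <;> linarith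
  have hint : ∀ σ : ℝ, 1 < σ → Integrable (fun x => Real.exp (-σ * x) * S x) := by
    intro σ hσ
    obtain ⟨c1, c2⟩ := hconv (σ + (0:ℝ) * Complex.I) (by simpa using hσ)
    have h1 := (WI_measure_real μp hμp σ 0 (by linarith) c1).1
    have h2 := (WI_measure_real μm hμm σ 0 (by linarith) c2).1
    refine (h1.sub h2).congr (Eventually.of_forall fun x => ?_)
    simp only [Pi.sub_apply]
    rw [hSdef]; ring
  have hUV : ∀ σ t : ℝ, 1 < σ → U (σ + t * Complex.I) = WIV S σ t := by
    intro σ t hσ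
    obtain ⟨c1, c2⟩ := hconv (σ + t * Complex.I) (by simpa using hσ)
    obtain ⟨i1, e1⟩ := WI_measure_real μp hμp σ t (by linarith) c1
    obtain ⟨i2, e2⟩ := WI_measure_real μm hμm σ t (by linarith) c2
    have hb : ∀ y : ℝ, ‖σ * Real.cos (t * y) + t * Real.sin (t * y)‖ ≤ |σ| + |t| := by
      intro y
      refine (norm_add_le _ _).trans ?_
      rw [norm_mul, norm_mul]
      exact add_le_add (mul_le_of_le_one_right (abs_nonneg _) (Real.abs_cos_le_one _))
        (mul_le_of_le_one_right (abs_nonneg _) (Real.abs_sin_le_one _))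
    have j1 := i1.mul_bdd (c := |σ| + |t|) (g := fun y => σ * Real.cos (t * y) + t * Real.sin (t * y))
      (by fun_prop) (Eventually.of_forall hb)
    have j2 := i2.mul_bdd (c := |σ| + |t|) (g := fun y => σ * Real.cos (t * y) + t * Real.sin (t * y))
      (by fun_prop) (Eventually.of_forall hb)
    rw [hU, laplaceStieltjes, Complex.sub_re, ← e1, ← e2, ← integral_sub j1 j2, WIV]
    congr 1; ext y
    rw [hSdef]; ring
  obtain ⟨f, hf⟩ := hbd
  have hev : ∀ᶠ σ : ℝ in nhdsWithin 1 (Ioi 1), 1 < σ := self_mem_nhdsWithin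
  obtain ⟨a, ha1, ha2⟩ := WI_core S hSm hS0 hloc hslow hint f (fun a b hab h0 => by
      obtain ⟨h1, h2⟩ := hf a b hab h0
      refine ⟨h1, h2.congr' ?_⟩
      filter_upwards [hev] with σ hσ
      simp only [hUV σ _ hσ]) lam hlam g hg
    (fun σ hσ => by
      filter_upwards [hlow σ hσ] with t ht
      rwa [hUV σ t hσ.1] at ht) k C hC
    (fun σ hσ => by
      have := hgrow 0 ⟨by linarith, hlam⟩ σ hσ
      rwa [hUV σ 0 hσ.1] at this)
  refine ⟨a, ha1.congr' ?_, ha2⟩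
  filter_upwards [hev] with σ hσ
  rw [← hUV σ 0 hσ]
  simp
end
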